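/- For every δ ∈ (0,1) there exists a constant c(δ) > 0 such that for every intensity α ∈ (0,1/2] and every integer R ≥ 1, the random walk loop soup 𝓛_R in B_R with intensity α satisfies: the probability that every cluster of 𝓛_R has Euclidean diameter strictly less than δR is at least c(δ). -/

import Mathlib

open MeasureTheory Set
open scoped ENNReal NNReal

noncomputable section

namespace RWLSPaper

open scoped Classical

/-- Vertices of the square lattice `ℤ²`. -/
abbrev Lat : Type := ℤ × ℤ

/-- The plane `ℝ²`, with the Euclidean metric. -/
abbrev Plane : Type := EuclideanSpace ℝ (Fin 2)

/-- Embedding of the lattice into the plane. -/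
def emb (z : Lat) : Plane := (WithLp.equiv 2 (Fin 2 → ℝ)).symm ![(z.1 : ℝ), (z.2 : ℝ)]

/-- Lattice adjacency: Euclidean distance one. -/
def Adj (a b : Lat) : Prop := (a.1 - b.1) ^ 2 + (a.2 - b.2) ^ 2 = 1

/-- ℓ∞ norm on the lattice. -/
def linf (a : Lat) : ℤ := max |a.1| |a.2|

/-- The box `B_R(z) = {w : |w - z|_∞ ≤ R}`. -/
def box (z : Lat) (R : ℤ) : Set Lat := {w | linf (w - z) ≤ R}

/-- Inner vertex boundary of a set of vertices. -/
def bdry (A : Set Lat) : Set Lat := {z | z ∈ A ∧ ∃ w, w ∉ A ∧ linf (z - w) = 1}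

/-- A set of vertices, embedded in the plane. -/
def embS (A : Set Lat) : Set Plane := emb '' A

/-- The boundary of the box `B_R(z)`, embedded in the plane. -/
def bdryE (z : Lat) (R : ℤ) : Set Plane := embS (bdry (box z R))

/-- The solid box `z + [-R,R]²` in the plane. -/
def boxP (z : Lat) (R : ℤ) : Set Plane :=
  {p | |p 0 - (z.1 : ℝ)| ≤ (R : ℝ) ∧ |p 1 - (z.2 : ℝ)| ≤ (R : ℝ)}

/-- Trace of a list of vertices: the vertices, together with the segments joining
consecutive ones. -/
def traceL (l : List Lat) : Set Plane :=
  (⋃ z ∈ l, {emb z}) ∪ ⋃ p ∈ l.zip l.tail, segment ℝ (emb p.1) (emb p.2)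

/-- Nearest-neighbour paths: nonempty lists of successively adjacent vertices. -/
def IsPath (l : List Lat) : Prop := l ≠ [] ∧ l.Chain' Adj

/-- Number of steps of a path. -/
def steps (l : List Lat) : ℕ := l.length - 1

/-- Paths from `z` to `w` with at least one step. -/
def PathsBetween (z w : Lat) : Set (List Lat) :=
  {l | IsPath l ∧ l.head? = some z ∧ l.getLast? = some w ∧ 2 ≤ l.length}

/-- Total mass of a set of paths under the measure giving weight `4^{-|η|}` to each
path `η`. -/
def pathMass (M : Set (List Lat)) : ℝ≥0∞ :=
  ∑' l : M, (4 : ℝ≥0∞)⁻¹ ^ steps l.1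

/-- `A` disconnects `B` from `C` in the plane: every continuous path joining a point
of `B` to a point of `C` meets `A`. -/
def Disconnects (A B C : Set Plane) : Prop :=
  ∀ γ : ℝ → Plane, ContinuousOn γ (Icc 0 1) → γ 0 ∈ B → γ 1 ∈ C →
    ∃ t ∈ Icc (0 : ℝ) 1, γ t ∈ A

/-- The set `M^{z,w}_{r,R}` of paths from `z` to `w` which intersect `∂B_R` and do
not disconnect `B_r` from `∂B_R`. -/
def MSet (z w : Lat) (r R : ℤ) : Set (List Lat) :=
  {l | l ∈ PathsBetween z w ∧ (traceL l ∩ bdryE 0 R).Nonempty ∧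
    ¬ Disconnects (traceL l) (embS (box 0 r)) (bdryE 0 R)}

/-- Nearest-neighbour walks from `u` to `v` staying in `D`. -/
def WalksIn (D : Set Lat) (u v : Lat) : Set (List Lat) :=
  {l | IsPath l ∧ l.head? = some u ∧ l.getLast? = some v ∧ ∀ x ∈ l, x ∈ D}

/-- The Green's function of simple random walk killed upon exiting `D`, through the
path-sum formula `G_D(u,v) = Σ_{η : u → v, η ⊆ D} 4^{-|η|}`. -/
def green (D : Set Lat) (u v : Lat) : ℝ≥0∞ :=
  ∑' l : WalksIn D u v, (4 : ℝ≥0∞)⁻¹ ^ steps l.1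

/-! ### Loops -/

/-- A rooted loop, encoded by its cyclic word: a nonempty list of vertices which,
cyclically, are successively adjacent. -/
structure RootedLoop where
  word : List Lat
  ne : word ≠ []
  adj : (word ++ word.take 1).Chain' Adj

/-- Rerooting (cyclic relabeling) relation on rooted loops. -/
def loopRot (l l' : RootedLoop) : Prop := ∃ k, l'.word = l.word.rotate k

/-- Unrooted loops: rooted loops modulo rerooting. -/
def ULoop : Type := Quot loopRot

/-- A representative of an unrooted loop. -/
def ULoop.out (γ : ULoop) : RootedLoop := Quot.out γ

/-- Number of steps of a loop. -/
def ULoop.steps (γ : ULoop) : ℕ := γ.out.word.length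

/-- Vertices visited by a loop. -/
def ULoop.verts (γ : ULoop) : Set Lat := {x | x ∈ γ.out.word}

/-- The trace of a loop in the plane. -/
def ULoop.trace (γ : ULoop) : Set Plane := traceL (γ.out.word ++ γ.out.word.take 1)

/-- The multiplicity `J(γ)`: the largest `j` such that `γ` is the concatenation of
`j` copies of a single loop. -/
def ULoop.mult (γ : ULoop) : ℕ :=
  sSup {j : ℕ | ∃ u : List Lat, u ≠ [] ∧ γ.out.word = (List.replicate j u).flatten}

/-- The unrooted loop measure: `ν(γ) = 4^{-|γ|} / J(γ)`. -/
def loopWeight (γ : ULoop) : ℝ≥0 := (4 : ℝ≥0)⁻¹ ^ γ.steps / (γ.mult : ℝ≥0)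

/-- Total `ν`-mass of a set of loops. -/
def nuMass (S : Set ULoop) : ℝ≥0∞ := ∑' γ : S, (loopWeight γ.1 : ℝ≥0∞)

/-- `ν(γ)` if `γ` is contained in `D`, and `0` otherwise. -/
def nuD (D : Set Lat) (γ : ULoop) : ℝ≥0 := if ULoop.verts γ ⊆ D then loopWeight γ else 0

/-! ### The random walk loop soup -/

/-- Loop configurations: multiplicity functions on unrooted loops. -/
abbrev Config : Type := ULoop → ℕ

/-- The set of loops appearing in a configuration. -/
def Config.loops (ω : Config) : Set ULoop := {γ | ω γ ≠ 0}

/-- The Poisson probability mass function with mean `r`. -/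
def poissonProb (r : ℝ≥0) (k : ℕ) : ℝ≥0∞ :=
  ENNReal.ofReal (Real.exp (-(r : ℝ)) * (r : ℝ) ^ k / k.factorial)

/-- `P` is the law of the random walk loop soup in `D` with intensity `α`: a Poisson
point process with intensity `α·ν` restricted to loops contained in `D`; equivalently,
the multiplicities of the various loops are independent, the multiplicity of a loop
`γ ⊆ D` being Poisson-distributed with mean `α ν(γ)`. -/
def IsLoopSoup (D : Set Lat) (α : ℝ) (P : Measure Config) : Prop :=
  IsProbabilityMeasure P ∧
  ∀ (s : Finset ULoop) (m : ULoop → ℕ),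
    P {ω | ∀ γ ∈ s, ω γ = m γ} = ∏ γ ∈ s, poissonProb (α.toNNReal * nuD D γ) (m γ)

/-- Decreasing events of the loop soup. -/
def DecreasingEvent (E : Set Config) : Prop :=
  ∀ ω ω' : Config, (∀ γ, ω' γ ≤ ω γ) → ω ∈ E → ω' ∈ E

/-! ### Clusters -/

/-- Two loops are adjacent when they intersect. -/
def Touches (γ γ' : ULoop) : Prop := (ULoop.verts γ ∩ ULoop.verts γ').Nonempty

/-- Connection of loops within a family `L` of loops: transitive closure of adjacency. -/
def linkedL (L : Set ULoop) : ULoop → ULoop → Prop :=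
  Relation.ReflTransGen (fun a b => a ∈ L ∧ b ∈ L ∧ Touches a b)

/-- The cluster of `γ` in `L`, as a set of loops. -/
def clusterClass (L : Set ULoop) (γ : ULoop) : Set ULoop := {γ' | γ' ∈ L ∧ linkedL L γ γ'}

/-- The subset of the plane covered by a family of loops. -/
def classTrace (K : Set ULoop) : Set Plane := ⋃ γ ∈ K, ULoop.trace γ

/-- The clusters of a loop configuration, regarded as subsets of the plane. -/
def clusters (L : Set ULoop) : Set (Set Plane) :=
  {C | ∃ γ ∈ L, C = classTrace (clusterClass L γ)}

/-- `Λ(A, L)`: the union of `A` with all the clusters of `L` meeting `A`. -/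
def LamL (A : Set Plane) (L : Set ULoop) : Set Plane :=
  A ∪ ⋃ C ∈ {C | C ∈ clusters L ∧ (C ∩ A).Nonempty}, C

/-- Connection within an arbitrary family of subsets of the plane (two members being
adjacent when they intersect). -/
def linkedS (F : Set (Set Plane)) : Set Plane → Set Plane → Prop :=
  Relation.ReflTransGen (fun a b => a ∈ F ∧ b ∈ F ∧ (a ∩ b).Nonempty)

/-- Clusters of a family of subsets of the plane. -/
def clustersS (F : Set (Set Plane)) : Set (Set Plane) :=
  {C | ∃ S ∈ F, C = ⋃ S' ∈ {S' | S' ∈ F ∧ linkedS F S S'}, S'}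

/-- `Λ(A, F)` for a family `F` of subsets of the plane. -/
def LamS (A : Set Plane) (F : Set (Set Plane)) : Set Plane :=
  A ∪ ⋃ C ∈ {C | C ∈ clustersS F ∧ (C ∩ A).Nonempty}, C

/-- The traces of a family of loops. -/
def traces (L : Set ULoop) : Set (Set Plane) := ULoop.trace '' L

/-! ### Filling, frontier, outermost clusters, crossings -/

/-- The filling of a set: the complement of the union of all unbounded connected
subsets of the complement of its closure. -/
def Fill (A : Set Plane) : Set Plane :=
  {x | ∀ C : Set Plane, C ⊆ (closure A)ᶜ → IsConnected C → x ∈ C → Bornology.IsBounded C}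

/-- The frontier of a loop: the topological boundary of the filling of its trace. -/
def loopFrontier (γ : ULoop) : Set Plane := frontier (Fill (ULoop.trace γ))

/-- The frontiers of the loops of a family. -/
def frontiers (L : Set ULoop) : Set (Set Plane) := loopFrontier '' L

/-- An outermost cluster of `L`. -/
def Outermost (L : Set ULoop) (C : Set Plane) : Prop :=
  C ∈ clusters L ∧ ∀ C' ∈ clusters L, C' ≠ C → ¬ Fill C ⊆ Fill C'

/-- `S` crosses the annulus `A_{r,R}(z)`: it meets both `∂B_r(z)` and `∂B_R(z)`. -/
def CrossesAnn (S : Set Plane) (z : Lat) (r R : ℤ) : Prop :=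
  (S ∩ bdryE z r).Nonempty ∧ (S ∩ bdryE z R).Nonempty

/-! ### Arm events -/

/-- The four-arm event: at least two distinct outermost clusters cross `A_{l,d}(z)`. -/
def fourArm (z : Lat) (l d : ℤ) (L : Set ULoop) : Prop :=
  ∃ C1 C2 : Set Plane, Outermost L C1 ∧ Outermost L C2 ∧ C1 ≠ C2 ∧
    CrossesAnn C1 z l d ∧ CrossesAnn C2 z l d

/-- The four-arm event, as a set of configurations. -/
def A4 (z : Lat) (l d : ℤ) : Set Config := {ω | fourArm z l d ω.loops}

/-- The truncated four-arm event `→𝒜(z;l,d)`. -/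
def A4trunc (z : Lat) (l d : ℤ) : Set Config :=
  {ω | fourArm z l d ω.loops ∧ LamL (embS (box z l)) ω.loops ⊆ boxP z (2 * d)}

/-- The truncated inward four-arm event `←𝒜(z;l,d)`. -/
def A4in (z : Lat) (l d : ℤ) : Set Config :=
  {ω | fourArm z l d ω.loops ∧
    LamL (embS (bdry (box z d))) ω.loops ∩ embS (box z (l / 2)) = ∅}

/-- Lattice points in the open upper half-plane `ℍ`. -/
def upperLat : Set Lat := {w | 0 < w.2}

/-- The upper part of the boundary of `B_R`, embedded in the plane. -/
def bdryEP (R : ℤ) : Set Plane := embS (bdry (box 0 R) ∩ upperLat)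

/-- `S` crosses the half-annulus `A^+_{r,R}`. -/
def CrossesAnnP (S : Set Plane) (r R : ℤ) : Prop :=
  (S ∩ bdryEP r).Nonempty ∧ (S ∩ bdryEP R).Nonempty

/-- The interior two-arm event: some outermost cluster has a frontier crossing `A_{l,d}`. -/
def A2 (l d : ℤ) : Set Config :=
  {ω | ∃ C, Outermost ω.loops C ∧ CrossesAnn (frontier (Fill C)) 0 l d}

/-- The boundary two-arm event. -/
def A2P (l d : ℤ) : Set Config :=
  {ω | ∃ C, Outermost ω.loops C ∧ CrossesAnnP (frontier (Fill C)) l d}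

/-- The boundary four-arm event. -/
def A4P (l d : ℤ) : Set Config :=
  {ω | ∃ C1 C2, Outermost ω.loops C1 ∧ Outermost ω.loops C2 ∧ C1 ≠ C2 ∧
    CrossesAnnP C1 l d ∧ CrossesAnnP C2 l d}

/-- Outward truncation condition: `Λ(B_l, ·) ⊆ B_{2d}`. -/
def TruncOut (l d : ℤ) (ω : Config) : Prop :=
  LamL (embS (box 0 l)) ω.loops ⊆ boxP 0 (2 * d)

/-- Inward truncation condition: `Λ(∂B_d, ·) ∩ B_{⌊l/2⌋} = ∅`. -/
def TruncIn (l d : ℤ) (ω : Config) : Prop :=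
  LamL (embS (bdry (box 0 d))) ω.loops ∩ embS (box 0 (l / 2)) = ∅

/-! ### Random walks and qualities -/

/-- `μ` is the law of the simple random walk on `ℤ²` started at `z`, as a measure on
`ℕ → ℤ²`. -/
def IsSRW (z : Lat) (μ : Measure (ℕ → Lat)) : Prop :=
  IsProbabilityMeasure μ ∧
  ∀ (n : ℕ) (f : ℕ → Lat), f 0 = z → (∀ i < n, Adj (f i) (f (i + 1))) →
    μ {w | ∀ i ≤ n, w i = f i} = (4 : ℝ≥0∞)⁻¹ ^ n

/-- First hitting time of a set of vertices by a walk. -/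
def hitTime (w : ℕ → Lat) (A : Set Lat) : ℕ := sInf {i | w i ∈ A}

/-- Position of a walk at its first hitting of `A`. -/
def hitPt (w : ℕ → Lat) (A : Set Lat) : Lat := w (hitTime w A)

/-- Trace of a walk, stopped at its first hitting of `A`. -/
def stoppedTrace (w : ℕ → Lat) (A : Set Lat) : Set Plane :=
  traceL ((List.range (hitTime w A + 1)).map w)

/-- The walk stays in `D` up to its first hitting of `A`. -/
def StaysIn (w : ℕ → Lat) (D A : Set Lat) : Prop := ∀ i ≤ hitTime w A, w i ∈ D

/-- `μ` is the law of the simple random walk started at `z`, conditioned to stay in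
`D` until it first hits `A`. -/
def IsCondSRW (z : Lat) (D A : Set Lat) (μ : Measure (ℕ → Lat)) : Prop :=
  ∃ ν : Measure (ℕ → Lat), IsSRW z ν ∧
    μ = (ν {w | StaysIn w D A})⁻¹ • ν.restrict {w | StaysIn w D A}

/-- Lattice ball of real radius (ℓ∞ distance). -/
def ballV (c : Lat) (ρ : ℝ) : Set Lat := {w | ((linf (w - c) : ℤ) : ℝ) ≤ ρ}

/-- Union of the stopped traces of a packet of walks. -/
def packTrace {j : ℕ} (ws : Fin j → ℕ → Lat) (A : Set Lat) : Set Plane :=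
  ⋃ i, stoppedTrace (ws i) A

/-- Union of the balls of radius `ρ` around the hitting points of a packet of walks. -/
def packBalls {j : ℕ} (ws : Fin j → ℕ → Lat) (A : Set Lat) (ρ : ℝ) : Set Plane :=
  ⋃ i, embS (ballV (hitPt (ws i) A) ρ)

/-- The frontiers of the loops of `ω` not contained in `B_r`. -/
def outerFrontiers (r : ℤ) (ω : Config) : Set (Set Plane) :=
  frontiers {γ | γ ∈ ω.loops ∧ ¬ ULoop.verts γ ⊆ box 0 r}

/-- The frontiers of the loops of `ω` meeting `B_R`. -/
def meetFrontiers (R : ℤ) (ω : Config) : Set (Set Plane) :=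
  frontiers {γ | γ ∈ ω.loops ∧ (ULoop.verts γ ∩ box 0 R).Nonempty}

/-- Quality at scale `s` for two packets of walks inside a loop soup, with initial
configuration `(Lr, V1, V2)` at scale `r`. -/
def qualityJK (Lr : Set ULoop) (V1 V2 : Set Lat) (r : ℤ) {j k : ℕ}
    (w1 : Fin j → ℕ → Lat) (w2 : Fin k → ℕ → Lat) (ω : Config) (s : ℤ) : ℝ :=
  sSup {δ : ℝ | 0 ≤ δ ∧
    LamS (embS V1 ∪ packTrace w1 (bdry (box 0 s)) ∪ packBalls w1 (bdry (box 0 s)) (δ * (s : ℝ)))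
        (traces Lr ∪ outerFrontiers r ω) ∩
      (embS V2 ∪ packTrace w2 (bdry (box 0 s)) ∪
        packBalls w2 (bdry (box 0 s)) (δ * (s : ℝ))) = ∅}

/-- Quality at scale `s` for a single pair of walks. -/
def qualityPair (Lr : Set ULoop) (V1 V2 : Set Lat) (r : ℤ)
    (w1 w2 : ℕ → Lat) (ω : Config) (s : ℤ) : ℝ :=
  qualityJK Lr V1 V2 r (fun _ : Fin 1 => w1) (fun _ : Fin 1 => w2) ω s

/-- Reversed quality at scale `s`, for two packets walking inward from `∂B_R`. -/
def qualityRev (L : Set ULoop) (V1 V2 : Set Lat) (R : ℤ) {j k : ℕ}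
    (w1 : Fin j → ℕ → Lat) (w2 : Fin k → ℕ → Lat) (ω : Config) (s : ℤ) : ℝ :=
  sSup {δ : ℝ | 0 ≤ δ ∧
    LamS (embS V1 ∪ packTrace w1 (bdry (box 0 s)) ∪ packBalls w1 (bdry (box 0 s)) (δ * (s : ℝ)))
        (traces L ∪ meetFrontiers R ω) ∩
      (embS V2 ∪ packTrace w2 (bdry (box 0 s)) ∪
        packBalls w2 (bdry (box 0 s)) (δ * (s : ℝ))) = ∅}

/-- Quality at scale `s` for one packet of walks, with non-disconnection of `U`. -/
def qualityDisc (Lr : Set ULoop) (U : Set Lat) (r : ℤ) {j : ℕ}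
    (ws : Fin j → ℕ → Lat) (ω : Config) (s : ℤ) : ℝ :=
  sSup {δ : ℝ | 0 ≤ δ ∧
    embS U ∩ Fill (LamS
      (packTrace ws (bdry (box 0 s)) ∪ packBalls ws (bdry (box 0 s)) (δ * (s : ℝ)))
      (traces Lr ∪ outerFrontiers r ω)) = ∅}

/-! ### Crossing loops and bad clusters -/

/-- Crossing loops: loops contained in `D` which cross `A_{d,k}` without
disconnecting `B_d` from `∂B_k`. -/
def crossingLoops (D : Set Lat) (d k : ℤ) : Set ULoop :=
  {γ | ULoop.verts γ ⊆ D ∧ CrossesAnn (ULoop.trace γ) 0 d k ∧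
    ¬ Disconnects (ULoop.trace γ) (embS (box 0 d)) (bdryE 0 k)}

/-- `K` is a bad cluster of `L` for the annulus `A_{l,d}`, relative to the set `CL` of
crossing loops: an outermost cluster crossing `A_{l,d}` which no longer crosses it
once its crossing loops are removed. -/
def IsBad (CL : Set ULoop) (l d : ℤ) (L : Set ULoop) (K : Set ULoop) : Prop :=
  (∃ γ ∈ L, K = clusterClass L γ) ∧
  Outermost L (classTrace K) ∧ CrossesAnn (classTrace K) 0 l d ∧
  ¬ CrossesAnn (classTrace (K \ CL)) 0 l d

/-- `E_1`: the four-arm event holds, with exactly one bad cluster. -/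
def E1 (CL : Set ULoop) (l d : ℤ) : Set Config :=
  {ω | fourArm 0 l d ω.loops ∧ ∃! K : Set ULoop, IsBad CL l d ω.loops K}

/-- `E_2`: the four-arm event holds, with at least two bad clusters. -/
def E2 (CL : Set ULoop) (l d : ℤ) : Set Config :=
  {ω | fourArm 0 l d ω.loops ∧
    ∃ K K' : Set ULoop, K ≠ K' ∧ IsBad CL l d ω.loops K ∧ IsBad CL l d ω.loops K'}

/-- Number of crossing loops of a configuration, counted with multiplicity. -/
def crossingCount (CL : Set ULoop) (ω : Config) : ℝ≥0∞ := ∑' γ : CL, (ω γ.1 : ℝ≥0∞)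

/-! ### Arcs of the square -/

/-- The square curve `{‖p‖_∞ = n}`: the closed polygonal curve through `∂B_n`. -/
def sqCurve (n : ℤ) : Set Plane := {p | max |p 0| |p 1| = (n : ℝ)}

/-- `J` is one of the two arcs of the closed curve `∂B_n` with endpoints `x` and `y`. -/
def IsArc (n : ℤ) (x y : Lat) (J : Set Plane) : Prop :=
  IsClosed J ∧ IsConnected J ∧ J ⊆ sqCurve n ∧ emb x ∈ J ∧ emb y ∈ J ∧
  IsConnected ((sqCurve n \ J) ∪ {emb x, emb y})



/-! ### Finite Bernoulli expectations -/

/-- Expectation of `f` of a random subset of `F`, each `i` being present with probability `p i`. -/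
def Ex {ι : Type*} (F : Finset ι) (p : ι → ℝ) (f : Finset ι → ℝ) : ℝ :=
  ∑ T ∈ F.powerset, f T * ((∏ i ∈ T, p i) * ∏ i ∈ F \ T, (1 - p i))

theorem Ex_empty {ι : Type*} (p : ι → ℝ) (f : Finset ι → ℝ) : Ex ∅ p f = f ∅ := by
  simp [Ex]

theorem Ex_insert {ι : Type*} {i : ι} {F : Finset ι} (hi : i ∉ F) (p : ι → ℝ)
    (f : Finset ι → ℝ) :
    Ex (insert i F) p f = p i * Ex F p (fun T => f (insert i T)) + (1 - p i) * Ex F p f := by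
  unfold Ex
  rw [Finset.sum_powerset_insert hi, Finset.mul_sum, Finset.mul_sum, add_comm]
  congr 1
  · apply Finset.sum_congr rfl
    intro T hT
    have hT' : i ∉ T := fun h => hi (Finset.mem_powerset.1 hT h)
    rw [Finset.prod_insert hT', Finset.insert_sdiff_insert, Finset.sdiff_insert_of_notMem hi]
    ring
  · apply Finset.sum_congr rfl
    intro T hT
    have hT' : i ∉ T := fun h => hi (Finset.mem_powerset.1 hT h)
    rw [Finset.insert_sdiff_of_notMem _ hT', Finset.prod_insert (by simp [hi])]
    ring

theorem Ex_const {ι : Type*} (F : Finset ι) (p : ι → ℝ) (c : ℝ) : Ex F p (fun _ => c) = c := by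
  induction F using Finset.induction_on with
  | empty => simp [Ex_empty]
  | insert i F hi ih => rw [Ex_insert hi, ih]; ring

theorem Ex_mono {ι : Type*} {F : Finset ι} {p : ι → ℝ} (hp : ∀ i, 0 ≤ p i ∧ p i ≤ 1)
    {f g : Finset ι → ℝ} (h : ∀ T, T ⊆ F → f T ≤ g T) : Ex F p f ≤ Ex F p g := by
  unfold Ex
  apply Finset.sum_le_sum
  intro T hT
  apply mul_le_mul_of_nonneg_right (h T (Finset.mem_powerset.1 hT))
  exact mul_nonneg (Finset.prod_nonneg fun i _ => (hp i).1)
    (Finset.prod_nonneg fun i _ => sub_nonneg.2 (hp i).2)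

theorem Ex_sum {ι κ : Type*} (F : Finset ι) (p : ι → ℝ) (K : Finset κ) (f : κ → Finset ι → ℝ) :
    Ex F p (fun T => ∑ k ∈ K, f k T) = ∑ k ∈ K, Ex F p (f k) := by
  unfold Ex
  rw [Finset.sum_comm]
  apply Finset.sum_congr rfl
  intro T _
  rw [Finset.sum_mul]

theorem Ex_nonneg {ι : Type*} {F : Finset ι} {p : ι → ℝ} (hp : ∀ i, 0 ≤ p i ∧ p i ≤ 1)
    {f : Finset ι → ℝ} (h : ∀ T, T ⊆ F → 0 ≤ f T) : 0 ≤ Ex F p f := by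
  have := Ex_mono (F := F) hp (f := fun _ => 0) (g := f) h
  rwa [Ex_const] at this

theorem antitone_ins {ι : Type*} {f : Finset ι → ℝ} (hf : Antitone f) (i : ι) :
    Antitone (fun T => f (insert i T)) :=
  fun _ _ h => hf (Finset.insert_subset_insert i h)

/-- Harris inequality for decreasing functions. -/
theorem Ex_harris {ι : Type*} {F : Finset ι} {p : ι → ℝ} (hp : ∀ i, 0 ≤ p i ∧ p i ≤ 1)
    {f g : Finset ι → ℝ} (hf : Antitone f) (hg : Antitone g) :
    Ex F p f * Ex F p g ≤ Ex F p (fun T => f T * g T) := by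
  induction F using Finset.induction_on generalizing f g with
  | empty => simp [Ex_empty]
  | insert i F hi ih =>
    rw [Ex_insert hi, Ex_insert hi, Ex_insert hi]
    have h1 := ih (antitone_ins hf i) (antitone_ins hg i)
    have h2 := ih hf hg
    have h3 : Ex F p (fun T => f (insert i T)) ≤ Ex F p f :=
      Ex_mono hp fun T _ => hf (Finset.subset_insert i T)
    have h4 : Ex F p (fun T => g (insert i T)) ≤ Ex F p g :=
      Ex_mono hp fun T _ => hg (Finset.subset_insert i T)
    obtain ⟨p0, p1⟩ := hp i
    set a := Ex F p (fun T => f (insert i T))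
    set b := Ex F p (fun T => g (insert i T))
    set c := Ex F p f
    set d := Ex F p g
    have q0 : 0 ≤ 1 - p i := sub_nonneg.2 p1
    have k1 := mul_le_mul_of_nonneg_left h1 p0
    have k2 := mul_le_mul_of_nonneg_left h2 q0
    have k3 : 0 ≤ p i * (1 - p i) * ((c - a) * (d - b)) :=
      mul_nonneg (mul_nonneg p0 q0) (mul_nonneg (sub_nonneg.2 h3) (sub_nonneg.2 h4))
    nlinarith

theorem Ex_harris_prod {ι κ : Type*} {F : Finset ι} {p : ι → ℝ} (hp : ∀ i, 0 ≤ p i ∧ p i ≤ 1)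
    (K : Finset κ) (f : κ → Finset ι → ℝ) (hf : ∀ k, Antitone (f k)) (h0 : ∀ k T, 0 ≤ f k T) :
    ∏ k ∈ K, Ex F p (f k) ≤ Ex F p (fun T => ∏ k ∈ K, f k T) := by
  induction K using Finset.induction_on with
  | empty => simp [Ex_const]
  | insert k K hk ih =>
    simp only [Finset.prod_insert hk]
    have hm : Antitone (fun T => ∏ k ∈ K, f k T) := fun A B h =>
      Finset.prod_le_prod (fun k _ => h0 k _) (fun k _ => hf k h)
    refine le_trans ?_ (Ex_harris hp (hf k) hm)
    exact mul_le_mul_of_nonneg_left ih (Ex_nonneg hp fun T _ => h0 k T)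

/-- A decreasing function has a smaller expectation when the probabilities are larger. -/
theorem Ex_anti_p {ι : Type*} {F : Finset ι} {p q : ι → ℝ} (hp : ∀ i, 0 ≤ p i ∧ p i ≤ 1)
    (hq : ∀ i, 0 ≤ q i ∧ q i ≤ 1) (hpq : ∀ i ∈ F, p i ≤ q i)
    {f : Finset ι → ℝ} (hf : Antitone f) : Ex F q f ≤ Ex F p f := by
  induction F using Finset.induction_on generalizing f with
  | empty => simp [Ex_empty]
  | insert i F hi ih =>
    rw [Ex_insert hi, Ex_insert hi]
    have hpq' : ∀ i ∈ F, p i ≤ q i := fun j hj => hpq j (Finset.mem_insert_of_mem hj)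
    have h1 := ih hpq' (antitone_ins hf i)
    have h2 := ih hpq' hf
    have h3 : Ex F p (fun T => f (insert i T)) ≤ Ex F p f :=
      Ex_mono hp fun T _ => hf (Finset.subset_insert i T)
    obtain ⟨p0, p1⟩ := hq i
    have q0 : 0 ≤ 1 - q i := sub_nonneg.2 p1
    have k := hpq i (Finset.mem_insert_self i F)
    have k1 := mul_le_mul_of_nonneg_left h1 p0
    have k2 := mul_le_mul_of_nonneg_left h2 q0
    have k3 := mul_nonneg (sub_nonneg.2 k) (sub_nonneg.2 h3)
    nlinarith

theorem Ex_anti_F {ι : Type*} {F G : Finset ι} (hFG : F ⊆ G) {p : ι → ℝ}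
    (hp : ∀ i, 0 ≤ p i ∧ p i ≤ 1) {f : Finset ι → ℝ} (hf : Antitone f) :
    Ex G p f ≤ Ex F p f := by
  obtain ⟨D, rfl⟩ : ∃ D, G = D ∪ F := ⟨G, by rw [Finset.union_eq_left.2 hFG]⟩
  clear hFG
  induction D using Finset.induction_on with
  | empty => simp
  | insert i D hi ih =>
    rw [Finset.insert_union]
    by_cases h : i ∈ D ∪ F
    · rwa [Finset.insert_eq_of_mem h]
    · rw [Ex_insert h]
      have h3 : Ex (D ∪ F) p (fun T => f (insert i T)) ≤ Ex (D ∪ F) p f :=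
        Ex_mono hp fun T _ => hf (Finset.subset_insert i T)
      nlinarith [(hp i).1, (hp i).2]

/-- Void probability. -/
theorem Ex_void {ι : Type*} (F : Finset ι) (p : ι → ℝ) (b : ι → Prop) :
    Ex F p (fun T => if ∀ i ∈ T, ¬ b i then 1 else 0) = ∏ i ∈ F with b i, (1 - p i) := by
  induction F using Finset.induction_on with
  | empty => simp [Ex_empty]
  | insert i F hi ih =>
    rw [Ex_insert hi, ih, Finset.filter_insert]
    by_cases h : b i
    · simp only [h, if_true]
      rw [Finset.prod_insert (by simp [hi])]
      have : Ex F p (fun T => if ∀ j ∈ insert i T, ¬ b j then (1:ℝ) else 0) = 0 := by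
        have : (fun T : Finset ι => if ∀ j ∈ insert i T, ¬ b j then (1:ℝ) else 0) = fun _ => 0 := by
          funext T
          rw [if_neg]
          intro hh
          exact hh i (Finset.mem_insert_self i T) h
        rw [this, Ex_const]
      rw [this]; ring
    · simp only [h, if_false]
      have : (fun T : Finset ι => if ∀ j ∈ insert i T, ¬ b j then (1:ℝ) else 0)
          = fun T => if ∀ j ∈ T, ¬ b j then (1:ℝ) else 0 := by
        funext T
        simp [h]
      rw [this, ih]; ring

theorem Ex_filter {ι : Type*} (F : Finset ι) (p : ι → ℝ) (b : ι → Prop) (f : Finset ι → ℝ) :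
    Ex F p (fun T => f (T.filter b)) = Ex (F.filter b) p f := by
  induction F using Finset.induction_on generalizing f with
  | empty => simp [Ex_empty]
  | insert i F hi ih =>
    rw [Ex_insert hi, Finset.filter_insert]
    by_cases h : b i
    · simp only [h, if_true]
      rw [Ex_insert (by simp [hi]), ← ih, ← ih]
      simp only [Finset.filter_insert, h, if_true]
    · simp only [h, if_false]
      simp only [Finset.filter_insert, h, if_false]
      rw [ih]; ring

/-- The expectation is affine in each single probability. -/
theorem Ex_update {ι : Type*} (C : Finset ι) (c : ι) (hc : c ∈ C) (q q' : ι → ℝ) (s : ℝ)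
    (h : ∀ d ∈ C, d ≠ c → q' d = q d) (hs : 1 - q' c = (1 - s) * (1 - q c))
    (f : Finset ι → ℝ) :
    Ex C q' f = s * Ex C q (fun T => f (insert c T)) + (1 - s) * Ex C q f := by
  obtain ⟨D, hcD, rfl⟩ : ∃ D, c ∉ D ∧ C = insert c D :=
    ⟨C.erase c, by simp, (Finset.insert_erase hc).symm⟩
  have e : ∀ g : Finset ι → ℝ, Ex D q' g = Ex D q g := by
    intro g
    unfold Ex
    apply Finset.sum_congr rfl
    intro T hT
    have hT := Finset.mem_powerset.1 hT
    have hh : ∀ d ∈ D, q' d = q d := fun d hd =>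
      h d (Finset.mem_insert_of_mem hd) (fun e => hcD (e ▸ hd))
    congr 2
    · exact Finset.prod_congr rfl fun d hd => hh d (hT hd)
    · exact Finset.prod_congr rfl fun d hd => by rw [hh d (Finset.mem_sdiff.1 hd).1]
  rw [Ex_insert hcD, Ex_insert hcD, Ex_insert hcD, e, e]
  simp only [Finset.insert_idem]
  have : q' c = 1 - (1 - s) * (1 - q c) := by linarith
  rw [this]; ring

/-- Bernoulli parameter of a Poisson mass. -/
def pm (x : ℝ) : ℝ := 1 - Real.exp (-x)

theorem pm_bd {x : ℝ} (hx : 0 ≤ x) : 0 ≤ pm x ∧ pm x ≤ 1 := by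
  unfold pm
  have := Real.exp_pos (-x)
  have : Real.exp (-x) ≤ 1 := Real.exp_le_one_iff.2 (by linarith)
  constructor <;> linarith

theorem pm_mono {x y : ℝ} (h : x ≤ y) : pm x ≤ pm y := by
  unfold pm
  have : Real.exp (-y) ≤ Real.exp (-x) := Real.exp_le_exp.2 (by linarith)
  linarith

theorem Ex_label {ι κ : Type*} (I : Finset ι) (m : ι → ℝ) (lab : ι → κ) (C : Finset κ)
    (hC : ∀ i ∈ I, lab i ∈ C) (f : Finset κ → ℝ) :
    Ex I (fun i => pm (m i)) (fun T => f (T.image lab)) =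
      Ex C (fun c => pm (∑ i ∈ I with lab i = c, m i)) f := by
  induction I using Finset.induction_on generalizing f with
  | empty =>
    rw [Ex_empty]
    simp only [Finset.filter_empty, Finset.sum_empty, Finset.image_empty]
    have : ∀ C : Finset κ, Ex C (fun _ => pm 0) f = f ∅ := by
      intro C
      induction C using Finset.induction_on with
      | empty => simp [Ex_empty]
      | insert i F hi ih => rw [Ex_insert hi, ih]; simp [pm]
    rw [this]
  | insert i I hi ih =>
    have hC' : ∀ i ∈ I, lab i ∈ C := fun j hj => hC j (Finset.mem_insert_of_mem hj)
    rw [Ex_insert hi]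
    simp only [Finset.image_insert]
    rw [ih hC' f, ih hC' (fun T => f (insert (lab i) T))]
    symm
    apply Ex_update C (lab i) (hC i (Finset.mem_insert_self i I))
    · intro d _ hd
      simp only [Finset.filter_insert]
      rw [if_neg (Ne.symm hd)]
    · simp only [Finset.filter_insert, if_true]
      rw [Finset.sum_insert (by simp [hi])]
      unfold pm
      rw [neg_add, Real.exp_add]; ring

/-- Domination of label processes. -/
theorem Ex_dom {ι ι' κ : Type*} (I : Finset ι) (I' : Finset ι') (m : ι → ℝ) (m' : ι' → ℝ)
    (hm : ∀ i, 0 ≤ m i) (hm' : ∀ i, 0 ≤ m' i)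
    (lab : ι → κ) (lab' : ι' → κ)
    (h : ∀ c, ∑ i ∈ I with lab i = c, m i ≤ ∑ i ∈ I' with lab' i = c, m' i)
    {f : Finset κ → ℝ} (hf : Antitone f) :
    Ex I' (fun i => pm (m' i)) (fun T => f (T.image lab')) ≤
      Ex I (fun i => pm (m i)) (fun T => f (T.image lab)) := by
  rw [Ex_label I m lab (I.image lab ∪ I'.image lab')
      (fun i hi => Finset.mem_union_left _ (Finset.mem_image_of_mem _ hi)),
    Ex_label I' m' lab' (I.image lab ∪ I'.image lab')
      (fun i hi => Finset.mem_union_right _ (Finset.mem_image_of_mem _ hi))]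
  apply Ex_anti_p _ _ _ hf
  · intro c; exact pm_bd (Finset.sum_nonneg fun i _ => hm i)
  · intro c; exact pm_bd (Finset.sum_nonneg fun i _ => hm' i)
  · intro c _; exact pm_mono (h c)




/-! ### Gaussian integrals -/

open Matrix in
theorem diag_exists {V : Type*} [Fintype V] [DecidableEq V] (P : Matrix V V ℝ)
    (hP : P.IsHermitian)
    (hev : ∀ (l : ℝ) (v : V → ℝ), v ≠ 0 → P *ᵥ v = l • v → |l| < 1) :
    ∃ (U : Matrix V V ℝ) (lam : V → ℝ), U * Uᵀ = 1 ∧ Uᵀ * U = 1 ∧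
      P = U * diagonal lam * Uᵀ ∧ ∀ i, |lam i| < 1 := by
  refine ⟨(hP.eigenvectorUnitary : Matrix V V ℝ), hP.eigenvalues, ?_, ?_, ?_, ?_⟩
  · have := Unitary.coe_mul_star_self hP.eigenvectorUnitary
    rwa [Unitary.coe_star, Matrix.star_eq_conjTranspose,
      Matrix.conjTranspose_eq_transpose_of_trivial] at this
  · have := Unitary.coe_star_mul_self hP.eigenvectorUnitary
    rwa [Matrix.star_eq_conjTranspose,
      Matrix.conjTranspose_eq_transpose_of_trivial] at this
  · have := hP.spectral_theorem
    rw [Unitary.conjStarAlgAut_apply, Matrix.star_eq_conjTranspose,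
      Matrix.conjTranspose_eq_transpose_of_trivial] at this
    exact this
  · intro i
    apply hev _ (hP.eigenvectorBasis i)
    · intro h
      have h1 := hP.eigenvectorBasis.orthonormal.1 i
      have : hP.eigenvectorBasis i = 0 := by
        ext j; exact congrFun h j
      rw [this] at h1
      simp at h1
    · exact hP.mulVec_eigenvectorBasis i

theorem gauss_one (b c : ℝ) (hb : 0 < b) :
    Integrable (fun x : ℝ => Real.exp (-b / 2 * x ^ 2 + c * x)) ∧
    ∫ x : ℝ, Real.exp (-b / 2 * x ^ 2 + c * x) =
      √(2 * Real.pi) * Real.exp (-(Real.log b) / 2 + c ^ 2 / b / 2) := by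
  have e : ∀ x : ℝ, Real.exp (-b / 2 * x ^ 2 + c * x) =
      Real.exp (c ^ 2 / b / 2) * Real.exp (-(b / 2) * (x + (-(c / b))) ^ 2) := by
    intro x
    rw [← Real.exp_add]
    congr 1
    field_simp
    ring
  simp only [e]
  constructor
  · apply Integrable.const_mul
    exact (integrable_exp_neg_mul_sq (by positivity : 0 < b / 2)).comp_add_right (-(c / b))
  · rw [integral_const_mul, integral_add_right_eq_self (fun x => Real.exp (-(b / 2) * x ^ 2)),
      integral_gaussian, Real.exp_add]
    have h1 : Real.pi / (b / 2) = (2 * Real.pi) / b := by field_simp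
    have h2 : Real.exp (-(Real.log b) / 2) = (√b)⁻¹ := by
      rw [neg_div, Real.exp_neg, Real.sqrt_eq_rpow, Real.rpow_def_of_pos hb]
      congr 2; ring
    rw [h1, Real.sqrt_div (by positivity), h2]
    field_simp

open Matrix in
theorem gauss_main {V : Type*} [Fintype V] [DecidableEq V] (P : Matrix V V ℝ)
    (hP : P.IsHermitian)
    (hev : ∀ (l : ℝ) (v : V → ℝ), v ≠ 0 → P *ᵥ v = l • v → |l| < 1) :
    Summable (fun n : ℕ => (P ^ (n + 1)).trace / ((n : ℝ) + 1)) ∧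
    (∀ h h' : V → ℝ, Summable (fun n : ℕ => h ⬝ᵥ (P ^ n) *ᵥ h')) ∧
    ∀ h : V → ℝ,
      Integrable (fun φ : V → ℝ => Real.exp (-(φ ⬝ᵥ φ) / 2 + (φ ⬝ᵥ P *ᵥ φ) / 2 + h ⬝ᵥ φ)) ∧
      ∫ φ : V → ℝ, Real.exp (-(φ ⬝ᵥ φ) / 2 + (φ ⬝ᵥ P *ᵥ φ) / 2 + h ⬝ᵥ φ) =
        (√(2 * Real.pi)) ^ (Fintype.card V) *
          Real.exp ((∑' n : ℕ, (P ^ (n + 1)).trace / ((n : ℝ) + 1)) / 2 +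
            (∑' n : ℕ, h ⬝ᵥ (P ^ n) *ᵥ h) / 2) := by
  obtain ⟨U, lam, hU1, hU2, hPU, hlam⟩ := diag_exists P hP hev
  have hpow : ∀ n : ℕ, P ^ n = U * diagonal (fun i => lam i ^ n) * Uᵀ := by
    intro n
    induction n with
    | zero => simp [hU1]
    | succ n ih =>
      rw [pow_succ, ih]
      conv_lhs => rw [hPU]
      have : U * diagonal (fun i => lam i ^ n) * Uᵀ * (U * diagonal lam * Uᵀ) =
        U * (diagonal (fun i => lam i ^ n) * (Uᵀ * U) * diagonal lam) * Uᵀ := by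
        simp only [Matrix.mul_assoc]
      rw [this, hU2, Matrix.mul_one, diagonal_mul_diagonal]
      simp only [pow_succ]
  have htr : ∀ n : ℕ, (P ^ n).trace = ∑ i, lam i ^ n := by
    intro n
    rw [hpow, Matrix.trace_mul_comm, ← Matrix.mul_assoc, hU2, Matrix.one_mul, trace_diagonal]
  have hq : ∀ (n : ℕ) (h h' : V → ℝ),
      h ⬝ᵥ (P ^ n) *ᵥ h' = ∑ i, lam i ^ n * ((Uᵀ *ᵥ h) i * (Uᵀ *ᵥ h') i) := by
    intro n h h'
    rw [hpow, ← Matrix.mulVec_mulVec, ← Matrix.mulVec_mulVec, Matrix.dotProduct_mulVec,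
      ← Matrix.mulVec_transpose]
    simp only [dotProduct, mulVec_diagonal]
    apply Finset.sum_congr rfl; intro i _; ring
  have hs1 : ∀ i, HasSum (fun n : ℕ => lam i ^ (n + 1) / ((n : ℝ) + 1)) (-Real.log (1 - lam i)) :=
    fun i => Real.hasSum_pow_div_log_of_abs_lt_one (hlam i)
  have hs2 : ∀ i, HasSum (fun n : ℕ => lam i ^ n) (1 - lam i)⁻¹ :=
    fun i => hasSum_geometric_of_abs_lt_one (hlam i)
  have ht1 : HasSum (fun n : ℕ => (P ^ (n + 1)).trace / ((n : ℝ) + 1))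
      (∑ i, -Real.log (1 - lam i)) := by
    have := hasSum_sum (s := Finset.univ) (fun i _ => hs1 i)
    simp only [htr, Finset.sum_div]
    exact this
  have ht2 : ∀ h h' : V → ℝ, HasSum (fun n : ℕ => h ⬝ᵥ (P ^ n) *ᵥ h')
      (∑ i, (1 - lam i)⁻¹ * ((Uᵀ *ᵥ h) i * (Uᵀ *ᵥ h') i)) := by
    intro h h'
    have := hasSum_sum (s := Finset.univ)
      (fun i _ => (hs2 i).mul_right ((Uᵀ *ᵥ h) i * (Uᵀ *ᵥ h') i))
    simp only [hq]
    exact this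
  refine ⟨ht1.summable, fun h h' => (ht2 h h').summable, fun h => ?_⟩
  rw [ht1.tsum_eq, (ht2 h h).tsum_eq]
  have hdet : |U.det| = 1 := by
    have : U.det * U.det = 1 := by
      have := congrArg det hU1
      rwa [det_mul, det_transpose, det_one] at this
    have h2 : |U.det| * |U.det| = 1 := by rw [← abs_mul, this, abs_one]
    nlinarith [abs_nonneg U.det]
  have hdet0 : U.det ≠ 0 := by
    intro h0; rw [h0] at hdet; simp at hdet
  have hmap : Measure.map (⇑(Matrix.toLin' U)) (volume : Measure (V → ℝ)) = volume := by
    rw [Real.map_matrix_volume_pi_eq_smul_volume_pi hdet0, abs_inv, hdet]; simp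
  have hcU : Continuous (⇑(Matrix.toLin' U)) := LinearMap.continuous_of_finiteDimensional _
  set f : (V → ℝ) → ℝ := fun φ => Real.exp (-(φ ⬝ᵥ φ) / 2 + (φ ⬝ᵥ P *ᵥ φ) / 2 + h ⬝ᵥ φ) with hf
  have hfc : Continuous f := by
    rw [hf]; unfold dotProduct mulVec dotProduct; fun_prop
  have hcomp : ∀ ψ : V → ℝ, f (Matrix.toLin' U ψ) =
      ∏ i, Real.exp (-(1 - lam i) / 2 * ψ i ^ 2 + (Uᵀ *ᵥ h) i * ψ i) := by
    intro ψ
    rw [← Real.exp_sum, hf]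
    simp only [Matrix.toLin'_apply]
    congr 1
    have a1 : (U *ᵥ ψ) ⬝ᵥ (U *ᵥ ψ) = ∑ i, ψ i ^ 2 := by
      have := hq 0 (U *ᵥ ψ) (U *ᵥ ψ)
      simp only [pow_zero, Matrix.one_mulVec, Matrix.mulVec_mulVec, hU2, one_mul] at this
      rw [this]
      apply Finset.sum_congr rfl; intro i _; ring
    have a2 : (U *ᵥ ψ) ⬝ᵥ P *ᵥ (U *ᵥ ψ) = ∑ i, lam i * ψ i ^ 2 := by
      have := hq 1 (U *ᵥ ψ) (U *ᵥ ψ)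
      rw [pow_one] at this
      rw [this]
      simp only [Matrix.mulVec_mulVec, hU2, Matrix.one_mulVec, pow_one]
      apply Finset.sum_congr rfl; intro i _; ring
    have a3 : h ⬝ᵥ (U *ᵥ ψ) = ∑ i, (Uᵀ *ᵥ h) i * ψ i := by
      rw [Matrix.dotProduct_mulVec, ← Matrix.mulVec_transpose]; rfl
    rw [a1, a2, a3, ← Finset.sum_neg_distrib, Finset.sum_div, Finset.sum_div,
      ← Finset.sum_add_distrib, ← Finset.sum_add_distrib]
    apply Finset.sum_congr rfl; intro i _; ring
  have hpos : ∀ i, 0 < 1 - lam i := fun i => by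
    have := (abs_lt.1 (hlam i)).2; linarith
  have h_integ : Integrable (fun ψ : V → ℝ => f (Matrix.toLin' U ψ)) := by
    simp only [hcomp]
    exact Integrable.fintype_prod (f := fun i x =>
      Real.exp (-(1 - lam i) / 2 * x ^ 2 + (Uᵀ *ᵥ h) i * x)) fun i => (gauss_one _ _ (hpos i)).1
  constructor
  · rw [← hmap]
    exact (MeasureTheory.integrable_map_measure hfc.aestronglyMeasurable hcU.aemeasurable).2 h_integ
  · have e1 : ∫ φ, f φ = ∫ ψ, f (Matrix.toLin' U ψ) := by
      conv_lhs => rw [← hmap]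
      exact integral_map hcU.aemeasurable hfc.aestronglyMeasurable
    rw [e1]
    simp only [hcomp]
    rw [integral_fintype_prod_volume_eq_prod (f := fun i x =>
      Real.exp (-(1 - lam i) / 2 * x ^ 2 + (Uᵀ *ᵥ h) i * x))]
    simp only [(gauss_one _ _ (hpos _)).2]
    rw [Finset.prod_mul_distrib, Finset.prod_const, Finset.card_univ, ← Real.exp_sum]
    congr 2
    rw [Finset.sum_div, Finset.sum_div, ← Finset.sum_add_distrib]
    apply Finset.sum_congr rfl; intro i _
    have := (hpos i).ne'
    field_simp




/-! ### The FK inequality -/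

/-- Connection through a set of edges. -/
def eReach {X : Type*} (U : Finset (X × X)) : X → X → Prop :=
  Relation.ReflTransGen (fun a b => (a, b) ∈ U ∨ (b, a) ∈ U)

/-- `A` and `B` are not connected through the edges of `U`. -/
def Disc {X : Type*} (A B : Set X) (U : Finset (X × X)) : Prop :=
  ∀ a ∈ A, ∀ b ∈ B, ¬ eReach U a b

theorem eReach_mono {X : Type*} {S U : Finset (X × X)} (h : S ⊆ U) {a b : X}
    (hab : eReach S a b) : eReach U a b :=
  Relation.ReflTransGen.mono (fun x y (hh : (x, y) ∈ S ∨ (y, x) ∈ S) =>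
    Or.imp (fun k => h k) (fun k => h k) hh) _ _ hab

theorem Disc_anti {X : Type*} {A B : Set X} {S U : Finset (X × X)} (h : S ⊆ U)
    (hd : Disc A B U) : Disc A B S :=
  fun a ha b hb hr => hd a ha b hb (eReach_mono h hr)

/-- Sign flip. -/
def sgn {X : Type*} (T : Finset X) (x : X) : ℝ := if x ∈ T then -1 else 1

theorem sgn_cases {X : Type*} (T : Finset X) (x : X) : sgn T x = -1 ∨ sgn T x = 1 := by
  unfold sgn; split_ifs <;> simp

theorem sgn_ins_prod {X : Type*} (v : X) (T : Finset X) (hvT : v ∉ T) (L : Multiset X) :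
    (L.map (sgn (insert v T))).prod = (-1 : ℝ) ^ (L.count v) * (L.map (sgn T)).prod := by
  induction L using Multiset.induction_on with
  | empty => simp
  | cons a L ihL =>
    rw [Multiset.map_cons, Multiset.prod_cons, Multiset.map_cons, Multiset.prod_cons,
      Multiset.count_cons, ihL]
    by_cases h : v = a
    · subst h
      simp [sgn, hvT, pow_succ]
    · have : sgn (insert v T) a = sgn T a := by
        unfold sgn; simp [Ne.symm h]
      rw [this, if_neg h]; ring

theorem sgn_list_nonneg {X : Type*} (V : Finset X) (L : Multiset X) :
    0 ≤ ∑ T ∈ V.powerset, (L.map (sgn T)).prod := by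
  induction V using Finset.induction_on with
  | empty =>
    simp only [Finset.powerset_empty, Finset.sum_singleton]
    apply Multiset.prod_nonneg
    intro a ha
    obtain ⟨x, _, rfl⟩ := Multiset.mem_map.1 ha
    simp [sgn]
  | insert v V hv ih =>
    rw [Finset.sum_powerset_insert hv, ← Finset.sum_add_distrib]
    have key : ∀ T ∈ V.powerset, (L.map (sgn (insert v T))).prod =
        (-1 : ℝ) ^ (L.count v) * (L.map (sgn T)).prod := by
      intro T hT
      have hvT : v ∉ T := fun h => hv (Finset.mem_powerset.1 hT h)
      exact sgn_ins_prod v T hvT L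
    have : ∑ T ∈ V.powerset, ((L.map (sgn T)).prod + (L.map (sgn (insert v T))).prod) =
        (1 + (-1 : ℝ) ^ (L.count v)) * ∑ T ∈ V.powerset, (L.map (sgn T)).prod := by
      rw [Finset.mul_sum]
      apply Finset.sum_congr rfl
      intro T hT
      rw [key T hT]; ring
    rw [this]
    apply mul_nonneg _ ih
    rcases neg_one_pow_eq_or ℝ (L.count v) with h | h <;> rw [h] <;> norm_num

theorem sgn_edges_nonneg {X : Type*} (V : Finset X) (S : Finset (X × X)) :
    0 ≤ ∑ T ∈ V.powerset, ∏ e ∈ S, (sgn T e.1 * sgn T e.2) := by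
  have := sgn_list_nonneg V (S.val.map Prod.fst + S.val.map Prod.snd)
  simp only [Multiset.map_add, Multiset.prod_add, Multiset.map_map, Function.comp_def] at this
  convert this using 2 with T
  rw [Finset.prod_mul_distrib]
  rfl

theorem exp_sgn (j s s' : ℝ) (hs : s = -1 ∨ s = 1) (hs' : s' = -1 ∨ s' = 1) :
    Real.exp (j * (s * s')) = Real.cosh j + s * s' * Real.sinh j := by
  rw [Real.cosh_eq, Real.sinh_eq]
  rcases hs with rfl | rfl <;> rcases hs' with rfl | rfl <;> norm_num <;> ring

theorem FK_nonneg {X : Type*} (V : Finset X) (S : Finset (X × X)) (j : X × X → ℝ)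
    (hj : ∀ e, 0 ≤ j e) :
    0 ≤ ∑ T ∈ V.powerset, ∏ e ∈ S, (Real.exp (j e * (sgn T e.1 * sgn T e.2)) - 1) := by
  have h1 : ∀ T : Finset X, ∏ e ∈ S, (Real.exp (j e * (sgn T e.1 * sgn T e.2)) - 1) =
      ∑ W ∈ S.powerset, ((∏ e ∈ W, Real.sinh (j e)) * ∏ e ∈ S \ W, (Real.cosh (j e) - 1)) *
        ∏ e ∈ W, (sgn T e.1 * sgn T e.2) := by
    intro T
    have : ∀ e ∈ S, Real.exp (j e * (sgn T e.1 * sgn T e.2)) - 1 =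
        Real.sinh (j e) * (sgn T e.1 * sgn T e.2) + (Real.cosh (j e) - 1) := by
      intro e _
      rw [exp_sgn _ _ _ (sgn_cases T e.1) (sgn_cases T e.2)]; ring
    rw [Finset.prod_congr rfl this, Finset.prod_add]
    apply Finset.sum_congr rfl
    intro W _
    rw [Finset.prod_mul_distrib]; ring
  simp only [h1]
  rw [Finset.sum_comm]
  apply Finset.sum_nonneg
  intro W _
  rw [← Finset.mul_sum]
  apply mul_nonneg _ (sgn_edges_nonneg V W)
  apply mul_nonneg
  · exact Finset.prod_nonneg fun e _ => Real.sinh_nonneg_iff.2 (hj e)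
  · exact Finset.prod_nonneg fun e _ => sub_nonneg.2 (Real.one_le_cosh _)

/-- The FK inequality. -/
theorem FK_main {X : Type*} (V : Finset X) (A : Set X) (B : Finset X) (E : Finset (X × X))
    (hVA : ∀ x ∈ V, x ∉ A) (hVB : ∀ x ∈ V, x ∉ B) (hAB : ∀ x ∈ A, x ∉ B)
    (hE : ∀ e ∈ E, (e.1 ∈ V ∨ e.1 ∈ A ∨ e.1 ∈ B) ∧ (e.2 ∈ V ∨ e.2 ∈ A ∨ e.2 ∈ B))
    (j : X × X → ℝ) (hj : ∀ e, 0 ≤ j e) :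
    ∑ T ∈ V.powerset, ∏ e ∈ E, Real.exp (j e * (sgn (T ∪ B) e.1 * sgn (T ∪ B) e.2)) ≤
      ∑ S ∈ E.powerset with Disc A B S,
        ∑ T ∈ V.powerset, ∏ e ∈ S, (Real.exp (j e * (sgn T e.1 * sgn T e.2)) - 1) := by
  set a : X × X → ℝ := fun e => Real.exp (-j e) with ha
  set Jm : Finset X → X × X → ℝ := fun T e => Real.exp (j e * (sgn (T ∪ B) e.1 * sgn (T ∪ B) e.2))
    with hJm
  set Jp : Finset X → X × X → ℝ := fun T e => Real.exp (j e * (sgn T e.1 * sgn T e.2)) with hJp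
  set G : Finset (X × X) → ℝ := fun S => ∑ T ∈ V.powerset, ∏ e ∈ S, (Jp T e - 1) with hG
  have ha0 : ∀ e, 0 ≤ a e := fun e => (Real.exp_pos _).le
  have ha1 : ∀ e, 0 ≤ 1 - a e := fun e => by
    have : Real.exp (-j e) ≤ 1 := Real.exp_le_one_iff.2 (by linarith [hj e])
    rw [ha]; simpa using this
  have hG0 : ∀ S, 0 ≤ G S := fun S => FK_nonneg V S j hj
  -- expansion
  have e1 : ∀ T, ∏ e ∈ E, Jm T e =
      ∑ U ∈ E.powerset, (∏ e ∈ U, (Jm T e - a e)) * ∏ e ∈ E \ U, a e := by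
    intro T
    rw [← Finset.prod_add]
    exact Finset.prod_congr rfl fun e _ => by ring
  -- connected case
  have e2 : ∀ U ∈ E.powerset, ¬ Disc A B U → ∀ T ∈ V.powerset, ∏ e ∈ U, (Jm T e - a e) = 0 := by
    intro U hU hd T hT
    have hT := Finset.mem_powerset.1 hT
    unfold Disc at hd
    push Not at hd
    obtain ⟨x, hx, y, hy, hr⟩ := hd
    by_contra hne
    have hne' := Finset.prod_ne_zero_iff.1 hne
    have hstep : ∀ e ∈ U, sgn (T ∪ B) e.1 = sgn (T ∪ B) e.2 := by
      intro e he
      by_contra hs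
      apply hne' e he
      have : sgn (T ∪ B) e.1 * sgn (T ∪ B) e.2 = -1 := by
        rcases sgn_cases (T ∪ B) e.1 with h | h <;> rcases sgn_cases (T ∪ B) e.2 with h' | h' <;>
          simp [h, h'] at hs ⊢
      simp only [hJm, ha, this]
      simp
    have : sgn (T ∪ B) x = sgn (T ∪ B) y := by
      clear hy
      induction hr with
      | refl => rfl
      | tail _ h ih =>
        rw [ih]
        rcases h with h | h
        · exact hstep _ h
        · exact (hstep _ h).symm
    have hx' : sgn (T ∪ B) x = 1 := by
      unfold sgn
      rw [if_neg]
      rw [Finset.mem_union]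
      rintro (h | h)
      · exact hVA x (hT h) hx
      · exact hAB x hx h
    have hy' : sgn (T ∪ B) y = -1 := by
      unfold sgn
      rw [if_pos]
      exact Finset.mem_union_right _ hy
    rw [hx', hy'] at this
    norm_num at this
  -- disconnected case
  have e3 : ∀ U ∈ E.powerset, Disc A B U →
      ∑ T ∈ V.powerset, ∏ e ∈ U, (Jm T e - a e) = ∑ T ∈ V.powerset, ∏ e ∈ U, (Jp T e - a e) := by
    intro U hU hd
    have hU := Finset.mem_powerset.1 hU
    set C : Finset X := V.filter (fun x => ∃ b ∈ B, eReach U x b) with hC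
    have hmem : ∀ T ∈ V.powerset, symmDiff T C ∈ V.powerset := by
      intro T hT
      rw [Finset.mem_powerset] at hT ⊢
      intro x hx
      rcases Finset.mem_symmDiff.1 hx with h | h
      · exact hT h.1
      · exact (Finset.mem_filter.1 h.1).1
    refine Finset.sum_nbij' (fun T => symmDiff T C) (fun T => symmDiff T C) hmem hmem
      (fun T _ => by simp) (fun T _ => by simp) ?_
    intro T hT
    have hT := Finset.mem_powerset.1 hT
    apply Finset.prod_congr rfl
    intro e he
    have key : ∀ x, (x ∈ V ∨ x ∈ A ∨ x ∈ B) → sgn (T ∪ B) x =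
        sgn (symmDiff T C) x * (if ∃ b ∈ B, eReach U x b then -1 else 1) := by
      intro x hx
      unfold sgn
      simp only [Finset.mem_union, Finset.mem_symmDiff]
      rcases hx with hx | hx | hx
      · have h1 := hVB x hx
        have h2 : x ∈ C ↔ ∃ b ∈ B, eReach U x b := by rw [hC, Finset.mem_filter]; simp [hx]
        simp only [← h2]
        by_cases h3 : x ∈ T <;> by_cases h4 : x ∈ C <;> simp [h1, h3, h4]
      · have h1 : x ∉ T := fun h => hVA x (hT h) hx
        have h2 := hAB x hx
        have h3 : x ∉ C := fun h => hVA x (Finset.mem_filter.1 h).1 hx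
        have h4 : ¬ ∃ b ∈ B, eReach U x b := by
          rintro ⟨b, hb, hr⟩
          exact hd x hx b hb hr
        simp [h1, h2, h3, h4]
      · have h1 : x ∉ T := fun h => hVB x (hT h) hx
        have h3 : x ∉ C := fun h => hVB x (Finset.mem_filter.1 h).1 hx
        have h4 : ∃ b ∈ B, eReach U x b := ⟨x, hx, Relation.ReflTransGen.refl⟩
        simp [h1, hx, h3, h4]
    have hiff : (∃ b ∈ B, eReach U e.1 b) ↔ ∃ b ∈ B, eReach U e.2 b := by
      constructor
      · rintro ⟨b, hb, hr⟩
        exact ⟨b, hb, Relation.ReflTransGen.head (Or.inr he) hr⟩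
      · rintro ⟨b, hb, hr⟩
        exact ⟨b, hb, Relation.ReflTransGen.head (Or.inl he) hr⟩
    have := hE e (hU he)
    simp only [hJm, hJp]
    congr 3
    rw [key _ this.1, key _ this.2]
    simp only [hiff]
    split_ifs <;> ring
  have e4 : ∀ U, ∑ T ∈ V.powerset, ∏ e ∈ U, (Jp T e - a e) =
      ∑ S ∈ U.powerset, G S * ∏ e ∈ U \ S, (1 - a e) := by
    intro U
    simp only [hG, Finset.sum_mul]
    rw [Finset.sum_comm]
    apply Finset.sum_congr rfl
    intro T _
    rw [← Finset.prod_add]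
    exact Finset.prod_congr rfl fun e _ => by ring
  have e5 : ∀ S ∈ E.powerset, ∑ U ∈ E.powerset with S ⊆ U,
      (∏ e ∈ U \ S, (1 - a e)) * ∏ e ∈ E \ U, a e = 1 := by
    intro S hS
    have hS := Finset.mem_powerset.1 hS
    have h1 : (E.powerset.filter (fun U => S ⊆ U)) = Finset.Icc S E := by
      ext U; simp [Finset.mem_Icc, and_comm]
    rw [h1, Finset.Icc_eq_image_powerset hS, Finset.sum_image]
    · have : ∀ W ∈ (E \ S).powerset, (∏ e ∈ (S ∪ W) \ S, (1 - a e)) * ∏ e ∈ E \ (S ∪ W), a e =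
          (∏ e ∈ W, (1 - a e)) * ∏ e ∈ (E \ S) \ W, a e := by
        intro W hW
        have hW := Finset.mem_powerset.1 hW
        have h2 : (S ∪ W) \ S = W := by
          ext x
          have := @hW x
          simp only [Finset.mem_sdiff, Finset.mem_union] at this ⊢
          tauto
        rw [h2, sdiff_sdiff_left]
        rfl
      rw [Finset.sum_congr rfl this, ← Finset.prod_add]
      apply Finset.prod_eq_one
      intro e _; ring
    · intro W hW W' hW' h
      have hW := Finset.mem_powerset.1 hW
      have hW' := Finset.mem_powerset.1 hW'
      ext x
      have h1 := @hW x
      have h2 := @hW' x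
      have h3 := congrArg (fun Z => x ∈ Z) h
      simp only [Finset.mem_sdiff, Finset.mem_union, eq_iff_iff] at h1 h2 h3
      tauto
  calc ∑ T ∈ V.powerset, ∏ e ∈ E, Jm T e
      = ∑ U ∈ E.powerset, (∑ T ∈ V.powerset, ∏ e ∈ U, (Jm T e - a e)) * ∏ e ∈ E \ U, a e := by
        simp only [e1, Finset.sum_mul]
        rw [Finset.sum_comm]
    _ ≤ ∑ U ∈ E.powerset, ∑ S ∈ U.powerset with Disc A B S,
          G S * ((∏ e ∈ U \ S, (1 - a e)) * ∏ e ∈ E \ U, a e) := by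
        apply Finset.sum_le_sum
        intro U hU
        by_cases hd : Disc A B U
        · rw [e3 U hU hd, e4, Finset.sum_mul, Finset.filter_true_of_mem]
          · apply le_of_eq
            apply Finset.sum_congr rfl
            intro S _; ring
          · intro S hS
            exact Disc_anti (Finset.mem_powerset.1 hS) hd
        · rw [Finset.sum_eq_zero (e2 U hU hd), zero_mul]
          apply Finset.sum_nonneg
          intro S _
          exact mul_nonneg (hG0 S) (mul_nonneg (Finset.prod_nonneg fun e _ => ha1 e)
            (Finset.prod_nonneg fun e _ => ha0 e))
    _ = ∑ S ∈ E.powerset with Disc A B S, ∑ U ∈ E.powerset with S ⊆ U,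
          G S * ((∏ e ∈ U \ S, (1 - a e)) * ∏ e ∈ E \ U, a e) := by
        apply Finset.sum_comm'
        intro U S
        simp only [Finset.mem_powerset, Finset.mem_filter]
        constructor
        · rintro ⟨h1, h2, h3⟩; exact ⟨⟨h1, h2⟩, h2.trans h1, h3⟩
        · rintro ⟨⟨h1, h2⟩, _, h3⟩; exact ⟨h1, h2, h3⟩
    _ = ∑ S ∈ E.powerset with Disc A B S, G S := by
        apply Finset.sum_congr rfl
        intro S hS
        rw [← Finset.mul_sum, e5 S (Finset.mem_filter.1 hS).1, mul_one]




/-! ### Rooted and unrooted loops -/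

theorem loopRot_equiv : Equivalence loopRot := by
  refine ⟨fun l => ⟨0, by simp⟩, ?_, ?_⟩
  · rintro l l' ⟨k, hk⟩
    refine ⟨l.word.length * k - k, ?_⟩
    rw [hk, List.rotate_rotate]
    have h1 : 1 ≤ l.word.length := List.length_pos_iff.2 l.ne
    have h2 : k + (l.word.length * k - k) = l.word.length * k := by
      have : k ≤ l.word.length * k := Nat.le_mul_of_pos_left k h1
      omega
    rw [h2, List.rotate_length_mul]
  · rintro l l' l'' ⟨k, hk⟩ ⟨k', hk'⟩
    exact ⟨k + k', by rw [hk', hk, List.rotate_rotate]⟩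

/-- The unrooted loop of a rooted loop. -/
def umk (l : RootedLoop) : ULoop := Quot.mk loopRot l

theorem mk_eq_iff (l l' : RootedLoop) :
    umk l = umk l' ↔ loopRot l l' :=
  loopRot_equiv.quot_mk_eq_iff l l'

theorem mk_out (γ : ULoop) : umk γ.out = γ := Quot.out_eq γ

theorem out_mk (l : RootedLoop) : loopRot l (ULoop.out (umk l)) := by
  rw [← mk_eq_iff, mk_out]

theorem RootedLoop.ext' {l l' : RootedLoop} (h : l.word = l'.word) : l = l' := by
  cases l; cases l'; simp only at h; subst h; rfl

theorem chain_cyc_rotate_one {R : Lat → Lat → Prop} (w : List Lat)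
    (h : (w ++ w.take 1).IsChain R) : (w.rotate 1 ++ (w.rotate 1).take 1).IsChain R := by
  cases w with
  | nil => simpa using h
  | cons a t =>
    cases t with
    | nil => simpa using h
    | cons b t =>
      simp only [List.rotate_cons_succ, List.rotate_zero, List.cons_append, List.take_succ_cons,
        List.take_zero] at h ⊢
      rw [List.isChain_cons_cons] at h
      have : b :: (t ++ [a] ++ [b]) = (b :: (t ++ [a])) ++ [b] := by simp
      rw [this, List.isChain_append]
      refine ⟨h.2, by simp, ?_⟩
      intro x hx y hy
      have hx' : x = a := by
        have e : (b :: (t ++ [a])) = (b :: t) ++ [a] := by simp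
        rw [e, List.getLast?_append] at hx
        simpa [eq_comm] using hx
      have hy' : y = b := by simpa [eq_comm] using hy
      rw [hx', hy']; exact h.1

theorem chain_cyc_rotate {R : Lat → Lat → Prop} (w : List Lat) (k : ℕ)
    (h : (w ++ w.take 1).IsChain R) : (w.rotate k ++ (w.rotate k).take 1).IsChain R := by
  induction k with
  | zero => simpa using h
  | succ k ih =>
    have := chain_cyc_rotate_one _ ih
    rwa [List.rotate_rotate] at this

/-- A loop all of whose (oriented) steps satisfy `R`. -/
def lchain (R : Lat → Lat → Prop) (γ : ULoop) : Prop :=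
  (γ.out.word ++ γ.out.word.take 1).IsChain R

theorem lchain_mk (R : Lat → Lat → Prop) (l : RootedLoop) :
    lchain R (umk l) ↔ (l.word ++ l.word.take 1).IsChain R := by
  obtain ⟨k, hk⟩ := out_mk l
  obtain ⟨k', hk'⟩ := loopRot_equiv.symm (out_mk l)
  unfold lchain
  constructor
  · intro h; rw [hk']; exact chain_cyc_rotate _ k' h
  · intro h; rw [hk]; exact chain_cyc_rotate _ k h

theorem verts_mk (l : RootedLoop) : ULoop.verts (umk l) = {x | x ∈ l.word} := by
  obtain ⟨k, hk⟩ := out_mk l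
  unfold ULoop.verts
  rw [hk]
  ext x; simp

theorem comm_pow {α : Type*} (u : List α) (k : ℕ) : ∀ v : List α, v ++ u = u ++ v →
    v.length = k * u.length → v = (List.replicate k u).flatten := by
  induction k with
  | zero =>
    intro v _ h
    have : v = [] := List.length_eq_zero_iff.1 (by simpa using h)
    simp [this]
  | succ k ih =>
    intro v h hl
    have h1 : u <+: v := by
      apply List.prefix_of_prefix_length_le (l₃ := v ++ u)
      · rw [h]; exact List.prefix_append u v
      · exact List.prefix_append v u
      · rw [hl, Nat.succ_mul]; omega
    obtain ⟨v', rfl⟩ := h1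
    have h2 : v' ++ u = u ++ v' := by
      rw [List.append_assoc] at h
      exact List.append_cancel_left h
    have h3 : v'.length = k * u.length := by
      rw [List.length_append, Nat.succ_mul] at hl; omega
    rw [List.replicate_succ, List.flatten_cons, ← ih v' h2 h3]

theorem rot_iter (k : ℕ) (w : List Lat) :
    (fun l : List Lat => l.rotate 1)^[k] w = w.rotate k := by
  induction k generalizing w with
  | zero => simp
  | succ k ih => rw [Function.iterate_succ_apply, ih, List.rotate_rotate, Nat.add_comm]

/-- The rotation period of a word. -/
def per (w : List Lat) : ℕ := Function.minimalPeriod (fun l : List Lat => l.rotate 1) w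

theorem per_dvd (w : List Lat) {k : ℕ} (h : w.rotate k = w) : per w ∣ k :=
  Function.IsPeriodicPt.minimalPeriod_dvd (by
    unfold Function.IsPeriodicPt Function.IsFixedPt; rw [rot_iter]; exact h)

theorem rotate_per (w : List Lat) : w.rotate (per w) = w := by
  rw [← rot_iter]; exact Function.isPeriodicPt_minimalPeriod _ w

theorem per_pos (w : List Lat) (hw : w ≠ []) : 0 < per w :=
  Nat.pos_of_dvd_of_pos (per_dvd w (List.rotate_length w)) (List.length_pos_iff.2 hw)

theorem mult_mul_per (γ : ULoop) : γ.mult * per γ.out.word = γ.steps := by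
  set w := γ.out.word with hw
  have hne : w ≠ [] := γ.out.ne
  have hp := per_pos w hne
  obtain ⟨q, hq⟩ := per_dvd w (List.rotate_length w)
  have hlen : γ.steps = per w * q := hq
  have hmax : IsGreatest {j : ℕ | ∃ u : List Lat, u ≠ [] ∧ w = (List.replicate j u).flatten} q := by
    constructor
    · have hle : per w ≤ w.length := Nat.le_of_dvd (List.length_pos_iff.2 hne)
        (per_dvd w (List.rotate_length w))
      have hul : (w.take (per w)).length = per w := by simp [hle]
      refine ⟨w.take (per w), ?_, ?_⟩
      · intro h; rw [h] at hul; simp at hul; omega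
      · have hr := rotate_per w
        rw [List.rotate_eq_drop_append_take hle] at hr
        have hq1 : 1 ≤ q := by
          rcases Nat.eq_zero_or_pos q with h | h
          · rw [h] at hq; simp at hq; exact absurd hq hne
          · exact h
        obtain ⟨q', rfl⟩ : ∃ q', q = q' + 1 := ⟨q - 1, by omega⟩
        have := comm_pow (w.take (per w)) q' (w.drop (per w))
          (by rw [hr, List.take_append_drop]) (by
            rw [hul, List.length_drop, hq, Nat.mul_succ, Nat.mul_comm]; omega)
        rw [List.replicate_succ, List.flatten_cons, ← this, List.take_append_drop]
    · rintro j ⟨u, hu, h⟩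
      have hul : 0 < u.length := List.length_pos_iff.2 hu
      have hwl : w.length = j * u.length := by
        rw [h]; simp
      have hd : per w ∣ u.length := by
        apply per_dvd
        cases j with
        | zero => simp at h; exact absurd h hne
        | succ j =>
          conv_lhs => rw [h, List.replicate_succ, List.flatten_cons]
          rw [List.rotate_append_length_eq]
          rw [h, List.replicate_succ']
          simp
      have h2 : per w ≤ u.length := Nat.le_of_dvd hul hd
      have : j * per w ≤ q * per w := by
        calc j * per w ≤ j * u.length := Nat.mul_le_mul_left j h2
          _ = q * per w := by rw [← hwl, hq, Nat.mul_comm]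
      exact Nat.le_of_mul_le_mul_right this hp
  have : γ.mult = q := by
    unfold ULoop.mult
    exact hmax.csSup_eq
  rw [this, hlen, Nat.mul_comm]

theorem fiber_encard (γ : ULoop) :
    ((umk) ⁻¹' {γ} : Set RootedLoop).encard = per γ.out.word := by
  set w := γ.out.word with hw
  have h1 : RootedLoop.word '' ((umk) ⁻¹' {γ} : Set RootedLoop) =
      (fun k => (fun l : List Lat => l.rotate 1)^[k] w) '' (Iio (per w)) := by
    ext v
    constructor
    · rintro ⟨r, hr, rfl⟩
      have hr' : umk r = γ := hr
      have : loopRot γ.out r := by rw [← mk_eq_iff, hr', mk_out]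
      obtain ⟨k, hk⟩ := this
      refine ⟨k % per w, Nat.mod_lt _ (per_pos w γ.out.ne), ?_⟩
      have := Function.iterate_mod_minimalPeriod_eq (f := fun l : List Lat => l.rotate 1)
        (x := w) (n := k)
      simp only at this ⊢
      unfold per
      rw [this, rot_iter, hk]
    · rintro ⟨k, _, rfl⟩
      refine ⟨⟨w.rotate k, ?_, ?_⟩, ?_, ?_⟩
      · intro h; exact γ.out.ne (List.rotate_eq_nil_iff.1 h)
      · exact chain_cyc_rotate _ k γ.out.adj
      · refine Eq.trans ?_ (mk_out γ)
        refine (mk_eq_iff _ _).2 ?_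
        exact loopRot_equiv.symm ⟨k, rfl⟩
      · simp only [rot_iter]
  have hinj : Set.InjOn RootedLoop.word ((umk) ⁻¹' {γ} : Set RootedLoop) :=
    fun a _ b _ h => RootedLoop.ext' h
  rw [← hinj.encard_image, h1, Set.InjOn.encard_image]
  · rw [Set.encard_eq_coe_toFinset_card]; simp
  · exact Function.iterate_injOn_Iio_minimalPeriod

theorem steps_mk (l : RootedLoop) : ULoop.steps (umk l) = l.word.length := by
  obtain ⟨k, hk⟩ := out_mk l
  unfold ULoop.steps
  rw [hk, List.length_rotate]

theorem steps_pos (γ : ULoop) : 0 < γ.steps := List.length_pos_iff.2 γ.out.ne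

/-- Sums over unrooted loops as sums over rooted loops. -/
theorem tsum_unrooted (F : ULoop → ℝ≥0∞) :
    ∑' γ : ULoop, (loopWeight γ : ℝ≥0∞) * F γ =
      ∑' r : RootedLoop, ((4 : ℝ≥0∞)⁻¹ ^ r.word.length / r.word.length) *
        F (umk r) := by
  rw [← ENNReal.tsum_fiberwise _ (umk)]
  change _ = ∑' γ : ULoop, _
  apply tsum_congr
  intro γ
  have : ∀ b : ((umk) ⁻¹' {γ} : Set RootedLoop),
      ((4 : ℝ≥0∞)⁻¹ ^ b.1.word.length / b.1.word.length) * F (umk b.1) =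
      ((4 : ℝ≥0∞)⁻¹ ^ γ.steps / γ.steps) * F γ := by
    rintro ⟨b, hb⟩
    have hb' : umk b = γ := hb
    rw [← steps_mk b, hb']
  rw [tsum_congr this, ENNReal.tsum_set_const, fiber_encard, ← mul_assoc]
  congr 1
  have hm := mult_mul_per γ
  have hs := steps_pos γ
  have hp := per_pos γ.out.word γ.out.ne
  have hmu : 0 < γ.mult := by
    rcases Nat.eq_zero_or_pos γ.mult with h | h
    · rw [h] at hm; omega
    · exact h
  unfold loopWeight
  rw [ENNReal.coe_div (by positivity)]
  rw [← hm]
  have e1 : ((γ.mult : ℝ≥0) : ℝ≥0∞) = (γ.mult : ℝ≥0∞) := by simp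
  have e2 : (((4 : ℝ≥0)⁻¹ ^ (γ.mult * per γ.out.word) : ℝ≥0) : ℝ≥0∞) =
      (4 : ℝ≥0∞)⁻¹ ^ (γ.mult * per γ.out.word) := by
    rw [ENNReal.coe_pow, ENNReal.coe_inv (by norm_num)]; simp
  rw [e1, e2]
  have e3 : (((per γ.out.word : ℕ) : ℕ∞) : ℝ≥0∞) = (per γ.out.word : ℝ≥0∞) := by simp
  rw [e3]
  push_cast
  rw [div_eq_mul_inv, div_eq_mul_inv, ENNReal.mul_inv (by left; simp; omega) (by left; simp)]
  have : ((per γ.out.word : ℝ≥0∞)) * ((per γ.out.word : ℝ≥0∞))⁻¹ = 1 :=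
    ENNReal.mul_inv_cancel (by simp; omega) (by simp)
  calc _ = (4 : ℝ≥0∞)⁻¹ ^ (γ.mult * per γ.out.word) * (γ.mult : ℝ≥0∞)⁻¹ * 1 := by rw [mul_one]
    _ = _ := by rw [← this]; ring

/-! ### Walks -/

/-- Neighbours of a lattice point. -/
def nb (x : Lat) : Finset Lat :=
  {(x.1 + 1, x.2), (x.1 - 1, x.2), (x.1, x.2 + 1), (x.1, x.2 - 1)}

theorem Adj_iff (x y : Lat) : Adj x y ↔ y ∈ nb x := by
  obtain ⟨a, b⟩ := x
  obtain ⟨c, d⟩ := y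
  unfold Adj nb
  simp only [Finset.mem_insert, Finset.mem_singleton, Prod.mk.injEq]
  constructor
  · intro h
    have h1 : (a - c) ^ 2 ≤ 1 := by nlinarith [sq_nonneg (b - d)]
    have h2 : (b - d) ^ 2 ≤ 1 := by nlinarith [sq_nonneg (a - c)]
    have h3 : -1 ≤ a - c ∧ a - c ≤ 1 := by constructor <;> nlinarith
    have h4 : -1 ≤ b - d ∧ b - d ≤ 1 := by constructor <;> nlinarith
    obtain ⟨i, hi⟩ : ∃ i, i = a - c := ⟨_, rfl⟩
    obtain ⟨j, hj⟩ : ∃ j, j = b - d := ⟨_, rfl⟩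
    rw [← hi, ← hj] at h
    rw [← hi] at h3
    rw [← hj] at h4
    obtain ⟨h3, h3'⟩ := h3
    obtain ⟨h4, h4'⟩ := h4
    interval_cases i <;> interval_cases j <;> simp at h <;> omega
  · rintro (⟨rfl, rfl⟩ | ⟨rfl, rfl⟩ | ⟨rfl, rfl⟩ | ⟨rfl, rfl⟩) <;> ring

theorem Adj_symm {x y : Lat} (h : Adj x y) : Adj y x := by
  unfold Adj at *; linarith

theorem sum_nb {M : Type*} [AddCommMonoid M] (x : Lat) (f : Lat → M) :
    ∑ y ∈ nb x, f y = f (x.1 + 1, x.2) + (f (x.1 - 1, x.2) + (f (x.1, x.2 + 1) +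
      f (x.1, x.2 - 1))) := by
  unfold nb
  rw [Finset.sum_insert, Finset.sum_insert, Finset.sum_insert, Finset.sum_singleton]
  · simp; omega
  · simp
  · simp; omega

/-- Walks with `n` steps from `x`. -/
def walkF : ℕ → Lat → Finset (List Lat)
  | 0, x => {[x]}
  | n + 1, x => (nb x).biUnion fun y => (walkF n y).image (fun l => x :: l)

theorem mem_walkF (n : ℕ) (x : Lat) (l : List Lat) :
    l ∈ walkF n x ↔ l.length = n + 1 ∧ l.head? = some x ∧ l.IsChain Adj := by
  induction n generalizing x l with
  | zero =>
    simp only [walkF, Finset.mem_singleton]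
    constructor
    · rintro rfl; simp
    · rintro ⟨h1, h2, _⟩
      obtain ⟨a, rfl⟩ := List.length_eq_one_iff.1 h1
      simp at h2; rw [h2]
  | succ n ih =>
    simp only [walkF, Finset.mem_biUnion, Finset.mem_image]
    constructor
    · rintro ⟨y, hy, l', hl', rfl⟩
      obtain ⟨h1, h2, h3⟩ := (ih y l').1 hl'
      refine ⟨by simp [h1], by simp, ?_⟩
      cases l' with
      | nil => simp at h1
      | cons a t =>
        simp at h2
        subst h2
        exact List.isChain_cons_cons.2 ⟨(Adj_iff _ _).2 hy, h3⟩
    · rintro ⟨h1, h2, h3⟩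
      cases l with
      | nil => simp at h1
      | cons a t =>
        simp at h2
        subst h2
        cases t with
        | nil => simp at h1
        | cons b t =>
          rw [List.isChain_cons_cons] at h3
          exact ⟨b, (Adj_iff _ _).1 h3.1, b :: t, (ih b _).2 ⟨by simpa using h1, by simp, h3.2⟩, rfl⟩

theorem sum_walkF_succ {M : Type*} [AddCommMonoid M] (n : ℕ) (x : Lat) (f : List Lat → M) :
    ∑ l ∈ walkF (n + 1) x, f l = ∑ y ∈ nb x, ∑ l ∈ walkF n y, f (x :: l) := by
  rw [walkF, Finset.sum_biUnion]
  · apply Finset.sum_congr rfl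
    intro y _
    rw [Finset.sum_image]
    intro a _ b _ h
    exact (List.cons.inj h).2
  · intro y _ z _ hyz
    rw [Function.onFun, Finset.disjoint_left]
    intro l hl hl'
    obtain ⟨a, ha, rfl⟩ := Finset.mem_image.1 hl
    obtain ⟨b, hb, hab⟩ := Finset.mem_image.1 hl'
    have : b = a := (List.cons.inj hab).2
    subst this
    have h1 := ((mem_walkF _ _ _).1 ha).2.1
    have h2 := ((mem_walkF _ _ _).1 hb).2.1
    rw [h1] at h2
    exact hyz (Option.some.inj h2)

/-- Sums over paths, organised by length and starting point. -/
theorem tsum_paths (f : List Lat → ℝ≥0∞) (hf : ∀ l, f l ≠ 0 → IsPath l) :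
    ∑' l : List Lat, f l = ∑' n : ℕ, ∑' x : Lat, ∑ l ∈ walkF n x, f l := by
  have h1 : ∀ n x, ∑ l ∈ walkF n x, f l = ∑' l : List Lat, if l ∈ walkF n x then f l else 0 := by
    intro n x
    rw [tsum_eq_sum (s := walkF n x)]
    · exact Finset.sum_congr rfl fun l hl => by rw [if_pos hl]
    · intro l hl; rw [if_neg hl]
  simp only [h1]
  have h2 : ∀ n, ∑' x : Lat, ∑' l : List Lat, (if l ∈ walkF n x then f l else 0) =
      ∑' l : List Lat, ∑' x : Lat, (if l ∈ walkF n x then f l else 0) :=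
    fun n => ENNReal.tsum_comm
  simp only [h2]
  rw [ENNReal.tsum_comm]
  apply tsum_congr
  intro l
  by_cases hl : f l = 0
  · simp [hl]
  · obtain ⟨hne, hch⟩ := hf l hl
    obtain ⟨a, t, rfl⟩ := List.exists_cons_of_ne_nil hne
    rw [tsum_eq_single t.length, tsum_eq_single a, if_pos]
    · rw [mem_walkF]; exact ⟨by simp, by simp, hch⟩
    · intro b hb
      rw [if_neg]
      rw [mem_walkF]; rintro ⟨_, h, _⟩
      simp at h; exact hb h.symm
    · intro n hn
      apply ENNReal.tsum_eq_zero.2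
      intro b
      rw [if_neg]
      rw [mem_walkF]; rintro ⟨h, _, _⟩
      simp at h; exact hn h.symm

theorem cyc_cons (a : Lat) (t : List Lat) : (a :: t) ++ (a :: t).take 1 = (a :: t) ++ [a] := by simp

/-- Sums over rooted loops as sums over closed walks. -/
theorem tsum_rooted (g : List Lat → ℝ≥0∞) :
    ∑' r : RootedLoop, g (r.word ++ r.word.take 1) =
      ∑' n : ℕ, ∑' x : Lat, ∑ l ∈ walkF (n + 1) x, if l.getLast? = some x then g l else 0 := by
  set f : List Lat → ℝ≥0∞ := fun l =>
    if IsPath l ∧ l.getLast? = l.head? ∧ 2 ≤ l.length then g l else 0 with hf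
  have hinj : Function.Injective (fun r : RootedLoop => r.word ++ r.word.take 1) := by
    intro r r' h
    apply RootedLoop.ext'
    simp only at h
    obtain ⟨a, t, ht⟩ := List.exists_cons_of_ne_nil r.ne
    obtain ⟨a', t', ht'⟩ := List.exists_cons_of_ne_nil r'.ne
    rw [ht, ht', cyc_cons, cyc_cons] at h
    rw [ht, ht']
    exact (List.append_inj' h rfl).1
  have h1 : ∀ r : RootedLoop, g (r.word ++ r.word.take 1) = f (r.word ++ r.word.take 1) := by
    intro r
    simp only [hf]
    rw [if_pos]
    refine ⟨⟨by simp [r.ne], r.adj⟩, ?_, ?_⟩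
    · obtain ⟨a, t, ht⟩ := List.exists_cons_of_ne_nil r.ne
      rw [ht, cyc_cons, List.getLast?_append]; simp
    · obtain ⟨a, t, ht⟩ := List.exists_cons_of_ne_nil r.ne
      rw [ht, cyc_cons]; simp
  have hsup : Function.support f ⊆ Set.range (fun r : RootedLoop => r.word ++ r.word.take 1) := by
    intro l hl
    have : IsPath l ∧ l.getLast? = l.head? ∧ 2 ≤ l.length := by
      by_contra h
      exact hl (by simp only [hf]; rw [if_neg h])
    obtain ⟨⟨hne, hch⟩, hlast, hlen⟩ := this
    obtain ⟨a, t, rfl⟩ := List.exists_cons_of_ne_nil hne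
    rcases List.eq_nil_or_concat t with rfl | ⟨s, b, rfl⟩
    · simp at hlen
    · have hb : b = a := by
        have : (a :: s.concat b) = (a :: s) ++ [b] := by simp
        rw [this, List.getLast?_append] at hlast
        simpa using hlast
      subst hb
      refine ⟨⟨b :: s, by simp, ?_⟩, ?_⟩
      · rw [cyc_cons]; simpa using hch
      · simp
  simp only [h1]
  rw [hinj.tsum_eq (f := f) hsup, tsum_paths]
  · rw [tsum_eq_zero_add' ENNReal.summable]
    have : ∑' x : Lat, ∑ l ∈ walkF 0 x, f l = 0 := by
      apply ENNReal.tsum_eq_zero.2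
      intro x
      simp [walkF, hf]
    rw [this, zero_add]
    apply tsum_congr; intro n
    apply tsum_congr; intro x
    apply Finset.sum_congr rfl
    intro l hl
    obtain ⟨a1, a2, a3⟩ := (mem_walkF _ _ _).1 hl
    simp only [hf]
    have hp : IsPath l := ⟨by rintro rfl; simp at a1, a3⟩
    have h2 : 2 ≤ l.length := by omega
    simp only [hp, h2, a2, true_and, and_true]
  · intro l hl
    by_contra h
    exact hl (by simp only [hf]; rw [if_neg (fun k => h k.1)])




/-! ### The Gaussian field on a finite graph -/

open Matrix in
theorem eig_lt_one {V : Type*} [Fintype V] [DecidableEq V] (P : Matrix V V ℝ)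
    (hP : ∀ x y, 0 ≤ P x y) (U : V → ℝ) (hU : ∀ x, 0 < U x) (hPU : ∀ x, (P *ᵥ U) x < U x)
    (l : ℝ) (v : V → ℝ) (hv : v ≠ 0) (h : P *ᵥ v = l • v) : |l| < 1 := by
  obtain ⟨x0, hx0⟩ := Function.ne_iff.1 hv
  have hne : (Finset.univ : Finset V).Nonempty := ⟨x0, Finset.mem_univ _⟩
  obtain ⟨x, -, hx⟩ := Finset.exists_max_image Finset.univ (fun x => |v x| / U x) hne
  set c := |v x| / U x with hc
  have hc0 : 0 < c := by
    have h1 := hx x0 (Finset.mem_univ _)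
    have h2 : 0 < |v x0| / U x0 := div_pos (abs_pos.2 hx0) (hU x0)
    exact lt_of_lt_of_le h2 h1
  have hb : ∀ y, |v y| ≤ c * U y := fun y => (div_le_iff₀ (hU y)).1 (hx y (Finset.mem_univ _))
  have hvx : |v x| = c * U x := by rw [hc, div_mul_cancel₀ _ (hU x).ne']
  have h1 : |l| * |v x| ≤ c * (P *ᵥ U) x := by
    have : l * v x = (P *ᵥ v) x := by rw [h]; simp
    rw [← abs_mul, this]
    simp only [Matrix.mulVec, dotProduct]
    rw [Finset.mul_sum]
    refine (Finset.abs_sum_le_sum_abs _ _).trans (Finset.sum_le_sum fun y _ => ?_)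
    rw [abs_mul, abs_of_nonneg (hP x y)]
    calc P x y * |v y| ≤ P x y * (c * U y) := mul_le_mul_of_nonneg_left (hb y) (hP x y)
      _ = _ := by ring
  have h2 : |l| * (c * U x) < 1 * (c * U x) := by
    rw [hvx] at h1
    calc |l| * (c * U x) ≤ c * (P *ᵥ U) x := h1
      _ < c * U x := mul_lt_mul_of_pos_left (hPU x) hc0
      _ = _ := by ring
  exact lt_of_mul_lt_mul_right h2 (by have := hU x; positivity)

/-- Adjacency through the (unoriented) edges of `S`. -/
def adjS (S : Finset (Lat × Lat)) (x y : Lat) : Prop := (x, y) ∈ S ∨ (y, x) ∈ S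

theorem adjS_symm {S : Finset (Lat × Lat)} {x y : Lat} : adjS S x y ↔ adjS S y x := or_comm

/-- Transition matrix through the edges of `S`. -/
def PS (V : Finset Lat) (S : Finset (Lat × Lat)) : Matrix V V ℝ :=
  Matrix.of fun x y => if adjS S x y then 1 / 4 else 0

/-- Boundary term. -/
def hS (V C : Finset Lat) (S : Finset (Lat × Lat)) (g : Lat → ℝ) : V → ℝ :=
  fun x => ∑ β ∈ C, if adjS S x β then g β / 4 else 0

/-- Admissible edge sets. -/
def goodE (V C : Finset Lat) (E : Finset (Lat × Lat)) : Prop :=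
  ∀ e ∈ E, Adj e.1 e.2 ∧ (e.2, e.1) ∉ E ∧
    ((e.1 ∈ V ∧ (e.2 ∈ V ∨ e.2 ∈ C)) ∨ (e.1 ∈ C ∧ e.2 ∈ V))

theorem goodE_mono {V C : Finset Lat} {E S : Finset (Lat × Lat)} (h : goodE V C E) (hS : S ⊆ E) :
    goodE V C S := fun e he => ⟨(h e (hS he)).1, fun h' => (h e (hS he)).2.1 (hS h'),
      (h e (hS he)).2.2⟩

theorem goodE_adj {V C : Finset Lat} {E : Finset (Lat × Lat)} (h : goodE V C E) {x y : Lat}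
    (hxy : adjS E x y) : Adj x y := by
  rcases hxy with h' | h'
  · exact (h _ h').1
  · exact Adj_symm (h _ h').1

theorem PS_herm (V : Finset Lat) (S : Finset (Lat × Lat)) : (PS V S).IsHermitian := by
  ext x y
  simp only [PS, Matrix.conjTranspose_apply, Matrix.of_apply, star_trivial]
  simp only [adjS_symm]

theorem PS_nonneg (V : Finset Lat) (S : Finset (Lat × Lat)) (x y : V) : 0 ≤ PS V S x y := by
  simp only [PS, Matrix.of_apply]; split_ifs <;> norm_num

/-- Extension of a field by boundary values. -/
def extF (V : Finset Lat) (g : Lat → ℝ) (φ : V → ℝ) : Lat → ℝ :=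
  fun x => if h : x ∈ V then φ ⟨x, h⟩ else g x

theorem sum_PS (V : Finset Lat) (S : Finset (Lat × Lat)) (x : V) (f : Lat → ℝ) :
    (PS V S).mulVec (fun y : V => f y) x = ∑ y ∈ V, if adjS S x y then f y / 4 else 0 := by
  simp only [Matrix.mulVec, dotProduct, PS, Matrix.of_apply]
  rw [← Finset.sum_coe_sort V]
  apply Finset.sum_congr rfl
  intro y _
  split_ifs <;> ring

theorem PS_sum_le {V C : Finset Lat} {S : Finset (Lat × Lat)} (hE : goodE V C S) (x : Lat)
    (f : Lat → ℝ) (W : Finset Lat) (hf : ∀ y ∈ nb x, 0 ≤ f y) :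
    ∑ y ∈ W, (if adjS S x y then f y / 4 else 0) ≤ ∑ y ∈ nb x, f y / 4 := by
  rw [← Finset.sum_filter]
  apply Finset.sum_le_sum_of_subset_of_nonneg
  · intro y hy
    exact (Adj_iff _ _).1 (goodE_adj hE (Finset.mem_filter.1 hy).2)
  · intro y hy _
    have := hf y hy
    positivity

theorem PS_eig {V C : Finset Lat} {S : Finset (Lat × Lat)} (hE : goodE V C S)
    (l : ℝ) (v : V → ℝ) (hv : v ≠ 0) (h : (PS V S).mulVec v = l • v) : |l| < 1 := by
  obtain ⟨ρ, hρ⟩ : ∃ ρ : ℤ, ∀ z ∈ V, |z.1| ≤ ρ := by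
    refine ⟨∑ z ∈ V, |z.1|, fun z hz => ?_⟩
    exact Finset.single_le_sum (f := fun z : Lat => |z.1|) (fun i _ => abs_nonneg _) hz
  set U : Lat → ℝ := fun z => ((ρ : ℝ) + 1) ^ 2 - (z.1 : ℝ) ^ 2 with hUd
  have hz : ∀ z ∈ V, |(z.1 : ℝ)| ≤ ρ := fun z hzV => by exact_mod_cast hρ z hzV
  refine eig_lt_one (PS V S) (PS_nonneg V S) (fun x => U x) ?_ ?_ l v hv h
  · intro x
    have := abs_le.1 (hz x x.2)
    simp only [hUd]; nlinarith
  · intro x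
    rw [sum_PS V S x U]
    refine lt_of_le_of_lt (PS_sum_le hE x U V ?_) ?_
    · intro y hy
      have h1 := abs_le.1 (hz x x.2)
      have : |(y.1 : ℝ)| ≤ ρ + 1 := by
        unfold nb at hy
        simp only [Finset.mem_insert, Finset.mem_singleton] at hy
        rcases hy with rfl | rfl | rfl | rfl <;> push_cast <;> rw [abs_le] <;> constructor <;>
          linarith
      have := abs_le.1 this
      simp only [hUd]; nlinarith
    · rw [sum_nb]
      simp only [hUd]; push_cast; nlinarith

theorem energy {V C : Finset Lat} {S : Finset (Lat × Lat)} (hVC : Disjoint V C)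
    (hE : goodE V C S) (g : Lat → ℝ) (φ : V → ℝ) :
    ∑ e ∈ S, extF V g φ e.1 * extF V g φ e.2 / 4 =
      (φ ⬝ᵥ (PS V S).mulVec φ) / 2 + hS V C S g ⬝ᵥ φ := by
  set f := extF V g φ with hf
  have hfV : ∀ x : V, φ x = f x := by
    intro x; simp [hf, extF]
  have hfC : ∀ x ∈ C, g x = f x := by
    intro x hx
    have : x ∉ V := fun h => Finset.disjoint_left.1 hVC h hx
    simp [hf, extF, this]
  set W := V ∪ C with hW
  set G : Lat → Lat → ℝ := fun x y => if (x, y) ∈ S then f x * f y / 4 else 0 with hG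
  have h1 : ∑ e ∈ S, f e.1 * f e.2 / 4 = ∑ x ∈ W, ∑ y ∈ W, G x y := by
    rw [← Finset.sum_product']
    simp only [hG]
    rw [← Finset.sum_filter]
    have : (W ×ˢ W).filter (fun e => (e.1, e.2) ∈ S) = S := by
      ext e
      simp only [Finset.mem_filter, Finset.mem_product, hW, Finset.mem_union]
      constructor
      · exact fun h => h.2
      · intro he
        have := (hE e he).2.2
        tauto
    rw [this]
  have hGCC : ∀ x ∈ C, ∀ y ∈ C, G x y = 0 := by
    intro x hx y hy
    simp only [hG]
    rw [if_neg]
    intro he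
    have := (hE _ he).2.2
    have hx' : x ∉ V := fun h => Finset.disjoint_left.1 hVC h hx
    have hy' : y ∉ V := fun h => Finset.disjoint_left.1 hVC h hy
    simp only at this
    tauto
  have hadj : ∀ x y : Lat, (if adjS S x y then f x * f y / 4 else 0) = G x y + G y x := by
    intro x y
    simp only [hG]
    by_cases ha : (x, y) ∈ S
    · have hb : (y, x) ∉ S := (hE _ ha).2.1
      have hc : adjS S x y := Or.inl ha
      simp [ha, hb, hc]
    · by_cases hb : (y, x) ∈ S
      · have hc : adjS S x y := Or.inr hb
        simp [ha, hb, hc]; ring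
      · have hc : ¬ adjS S x y := by unfold adjS; tauto
        simp [ha, hb, hc]
  have h2 : φ ⬝ᵥ (PS V S).mulVec φ = ∑ x ∈ V, ∑ y ∈ V, (G x y + G y x) := by
    have hφ : φ = fun x : V => f x := funext hfV
    rw [hφ]
    simp only [dotProduct]
    simp only [sum_PS]
    rw [← Finset.sum_coe_sort V]
    apply Finset.sum_congr rfl
    intro x _
    rw [Finset.mul_sum]
    apply Finset.sum_congr rfl
    intro y _
    rw [← hadj]
    split_ifs <;> ring
  have h3 : hS V C S g ⬝ᵥ φ = ∑ x ∈ V, ∑ y ∈ C, (G x y + G y x) := by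
    simp only [dotProduct, hS]
    rw [← Finset.sum_coe_sort V]
    apply Finset.sum_congr rfl
    intro x _
    rw [Finset.sum_mul]
    apply Finset.sum_congr rfl
    intro y hy
    rw [← hadj, hfC y hy, hfV x]
    split_ifs <;> ring
  rw [h1, h2, h3, hW, Finset.sum_union hVC]
  simp only [Finset.sum_union hVC, Finset.sum_add_distrib]
  have h4 : ∑ x ∈ C, ∑ y ∈ C, G x y = 0 :=
    Finset.sum_eq_zero fun x hx => Finset.sum_eq_zero fun y hy => hGCC x hx y hy
  have h5 : ∑ x ∈ V, ∑ y ∈ V, G y x = ∑ x ∈ V, ∑ y ∈ V, G x y := Finset.sum_comm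
  have h6 : ∑ x ∈ V, ∑ y ∈ C, G y x = ∑ x ∈ C, ∑ y ∈ V, G x y := Finset.sum_comm
  rw [h4, h5, h6]; ring

/-- The density of the field with boundary values `g`, through the edges of `S`. -/
theorem gffZ {V C : Finset Lat} {S : Finset (Lat × Lat)} (hVC : Disjoint V C)
    (hE : goodE V C S) (g : Lat → ℝ) :
    Integrable (fun φ : V → ℝ => Real.exp (-(φ ⬝ᵥ φ) / 2) *
      ∏ e ∈ S, Real.exp (extF V g φ e.1 * extF V g φ e.2 / 4)) ∧
    ∫ φ : V → ℝ, Real.exp (-(φ ⬝ᵥ φ) / 2) *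
      ∏ e ∈ S, Real.exp (extF V g φ e.1 * extF V g φ e.2 / 4) =
      (√(2 * Real.pi)) ^ (Fintype.card V) *
        Real.exp ((∑' n : ℕ, ((PS V S) ^ (n + 1)).trace / ((n : ℝ) + 1)) / 2 +
          (∑' n : ℕ, hS V C S g ⬝ᵥ ((PS V S) ^ n).mulVec (hS V C S g)) / 2) := by
  have := (gauss_main (PS V S) (PS_herm V S) (fun l v => PS_eig hE l v)).2.2 (hS V C S g)
  have h1 : ∀ φ : V → ℝ, Real.exp (-(φ ⬝ᵥ φ) / 2) *
      ∏ e ∈ S, Real.exp (extF V g φ e.1 * extF V g φ e.2 / 4) =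
      Real.exp (-(φ ⬝ᵥ φ) / 2 + (φ ⬝ᵥ (PS V S).mulVec φ) / 2 + hS V C S g ⬝ᵥ φ) := by
    intro φ
    rw [← Real.exp_sum, energy hVC hE, ← Real.exp_add, add_assoc]
  simp only [h1]
  exact this




theorem sgn_sq {X : Type*} (T : Finset X) (x : X) : sgn T x * sgn T x = 1 := by
  rcases sgn_cases T x with h | h <;> rw [h] <;> norm_num

/-- Sign flip of a field. -/
def flip (V T : Finset Lat) (φ : V → ℝ) : V → ℝ := fun x => sgn T x.1 * φ x

theorem flip_flip (V T : Finset Lat) (φ : V → ℝ) : flip V T (flip V T φ) = φ := by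
  funext x; unfold flip; rw [← mul_assoc, sgn_sq, one_mul]

theorem flip_integral (V T : Finset Lat) (F : (V → ℝ) → ℝ) :
    ∫ φ : V → ℝ, F (flip V T φ) = ∫ φ : V → ℝ, F φ := by
  have h1 : MeasurePreserving (fun φ : V → ℝ => flip V T φ) := by
    refine volume_preserving_pi (f := fun (x : V) (t : ℝ) => sgn T x.1 * t) ?_
    intro x
    rcases sgn_cases T x.1 with h | h <;> rw [h]
    · simpa using Measure.measurePreserving_neg (volume : Measure ℝ)
    · simp only [one_mul]; exact MeasurePreserving.id (volume : Measure ℝ)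
  have hm : Measurable (flip V T) := h1.measurable
  let e : (V → ℝ) ≃ᵐ (V → ℝ) :=
    { toFun := flip V T
      invFun := flip V T
      left_inv := flip_flip V T
      right_inv := flip_flip V T
      measurable_toFun := hm
      measurable_invFun := hm }
  exact h1.integral_comp e.measurableEmbedding F

theorem flip_integrable (V T : Finset Lat) (F : (V → ℝ) → ℝ) (hF : Integrable F) :
    Integrable (fun φ : V → ℝ => F (flip V T φ)) := by
  have h1 : MeasurePreserving (fun φ : V → ℝ => flip V T φ) := by
    refine volume_preserving_pi (f := fun (x : V) (t : ℝ) => sgn T x.1 * t) ?_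
    intro x
    rcases sgn_cases T x.1 with h | h <;> rw [h]
    · simpa using Measure.measurePreserving_neg (volume : Measure ℝ)
    · simp only [one_mul]; exact MeasurePreserving.id (volume : Measure ℝ)
  exact h1.integrable_comp_of_integrable hF

/-- The weight of an edge. -/
def Je (V : Finset Lat) (g : Lat → ℝ) (φ : V → ℝ) (e : Lat × Lat) : ℝ :=
  extF V g φ e.1 * extF V g φ e.2 / 4

/-- FK weight density. -/
def fkD (V : Finset Lat) (g : Lat → ℝ) (S : Finset (Lat × Lat)) (φ : V → ℝ) : ℝ :=
  Real.exp (-(φ ⬝ᵥ φ) / 2) * ∏ e ∈ S, (Real.exp (Je V g φ e) - 1)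

/-- Field density. -/
def zD (V : Finset Lat) (g : Lat → ℝ) (S : Finset (Lat × Lat)) (φ : V → ℝ) : ℝ :=
  Real.exp (-(φ ⬝ᵥ φ) / 2) * ∏ e ∈ S, Real.exp (Je V g φ e)

theorem zD_int {V C : Finset Lat} {S : Finset (Lat × Lat)} (hVC : Disjoint V C)
    (hE : goodE V C S) (g : Lat → ℝ) : Integrable (zD V g S) := (gffZ hVC hE g).1

theorem zD_sum (V : Finset Lat) (g : Lat → ℝ) (S : Finset (Lat × Lat)) (φ : V → ℝ) :
    ∑ S' ∈ S.powerset, fkD V g S' φ = zD V g S φ := by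
  unfold fkD zD
  rw [← Finset.mul_sum, ← Finset.prod_add_one]
  simp

theorem fkD_eq (V : Finset Lat) (g : Lat → ℝ) (S : Finset (Lat × Lat)) (φ : V → ℝ) :
    fkD V g S φ = ∑ S' ∈ S.powerset, (-1) ^ (S \ S').card * zD V g S' φ := by
  unfold fkD zD
  simp only [sub_eq_add_neg]
  rw [Finset.prod_add, Finset.mul_sum]
  apply Finset.sum_congr rfl
  intro S' _
  rw [Finset.prod_const]; ring

theorem fkD_int {V C : Finset Lat} {S : Finset (Lat × Lat)} (hVC : Disjoint V C)
    (hE : goodE V C S) (g : Lat → ℝ) : Integrable (fkD V g S) := by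
  have : fkD V g S = fun φ => ∑ S' ∈ S.powerset, (-1) ^ (S \ S').card * zD V g S' φ :=
    funext (fkD_eq V g S)
  rw [this]
  apply integrable_finsetSum
  intro S' hS'
  exact (zD_int hVC (goodE_mono hE (Finset.mem_powerset.1 hS')) g).const_mul _

theorem gS_sum {V C : Finset Lat} {S : Finset (Lat × Lat)} (hVC : Disjoint V C)
    (hE : goodE V C S) (g : Lat → ℝ) :
    ∑ S' ∈ S.powerset, ∫ φ, fkD V g S' φ = ∫ φ, zD V g S φ := by
  rw [← integral_finsetSum]
  · simp only [zD_sum]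
  · intro S' hS'
    exact fkD_int hVC (goodE_mono hE (Finset.mem_powerset.1 hS')) g

theorem sgn_symmDiff (T T' : Finset Lat) (x : Lat) :
    sgn (symmDiff T T') x = sgn T x * sgn T' x := by
  unfold sgn
  simp only [Finset.mem_symmDiff]
  by_cases h : x ∈ T <;> by_cases h' : x ∈ T' <;> simp [h, h']

/-- The negative set of a field. -/
def negS (V : Finset Lat) (φ : V → ℝ) : Finset Lat :=
  V.filter fun x => extF V 0 φ x < 0

theorem negS_abs (V : Finset Lat) (φ : V → ℝ) (x : V) :
    φ x = sgn (negS V φ) x.1 * |φ x| := by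
  have h1 : extF V 0 φ x.1 = φ x := by simp [extF]
  unfold sgn negS
  by_cases h : φ x < 0
  · rw [if_pos (Finset.mem_filter.2 ⟨x.2, by rw [h1]; exact h⟩), abs_of_neg h]; ring
  · rw [if_neg (fun h' => h (by have := (Finset.mem_filter.1 h').2; rwa [h1] at this)),
      abs_of_nonneg (not_lt.1 h)]; ring

theorem flip_sum_abs (V : Finset Lat) (F : (V → ℝ) → ℝ) (φ : V → ℝ) :
    ∑ T ∈ V.powerset, F (flip V T φ) = ∑ T ∈ V.powerset, F (flip V T (fun x => |φ x|)) := by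
  have hneg : negS V φ ⊆ V := Finset.filter_subset _ _
  have hsub : ∀ T ∈ V.powerset, symmDiff T (negS V φ) ∈ V.powerset := by
    intro T hT
    rw [Finset.mem_powerset] at *
    intro x hx
    rcases Finset.mem_symmDiff.1 hx with h | h
    · exact hT h.1
    · exact hneg h.1
  refine Finset.sum_nbij' (fun T => symmDiff T (negS V φ)) (fun T => symmDiff T (negS V φ))
    hsub hsub ?_ ?_ ?_
  · intro T _; simp
  · intro T _; simp
  · intro T _
    congr 1
    funext x
    unfold flip
    rw [sgn_symmDiff, mul_assoc, ← negS_abs]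

theorem flip_dot (V T : Finset Lat) (φ : V → ℝ) : flip V T φ ⬝ᵥ flip V T φ = φ ⬝ᵥ φ := by
  simp only [dotProduct, flip]
  apply Finset.sum_congr rfl
  intro x _
  calc _ = (sgn T x.1 * sgn T x.1) * (φ x * φ x) := by ring
    _ = _ := by rw [sgn_sq, one_mul]

theorem FKZ {V A B : Finset Lat} {E : Finset (Lat × Lat)} (hVA : Disjoint V A)
    (hVB : Disjoint V B) (hAB : Disjoint A B) (hE : goodE V (A ∪ B) E) (u : ℝ) (hu : 0 ≤ u) :
    ∫ φ, zD V (fun x => if x ∈ B then -u else u) E φ ≤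
      ∑ S ∈ E.powerset with Disc (A : Set Lat) B S, ∫ φ, fkD V (fun _ => u) S φ := by
  have hVC : Disjoint V (A ∪ B) := Finset.disjoint_union_right.2 ⟨hVA, hVB⟩
  have h_integ : ∀ S ∈ E.powerset.filter (fun S => Disc (A : Set Lat) B S),
      Integrable (fkD V (fun _ => u) S) := by
    intro S hS
    exact fkD_int hVC (goodE_mono hE (Finset.mem_powerset.1 (Finset.mem_filter.1 hS).1)) _
  rw [← integral_finsetSum _ h_integ]
  set gm : Lat → ℝ := fun x => if x ∈ B then -u else u with hgm
  set F1 := zD V gm E with hF1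
  set F2 : (V → ℝ) → ℝ := fun φ => ∑ S ∈ E.powerset with Disc (A : Set Lat) B S,
    fkD V (fun _ => u) S φ with hF2
  have i1 : Integrable F1 := zD_int hVC hE _
  have i2 : Integrable F2 := integrable_finsetSum _ h_integ
  have key : ∀ φ : V → ℝ, ∑ T ∈ V.powerset, F1 (flip V T φ) ≤ ∑ T ∈ V.powerset, F2 (flip V T φ) := by
    intro φ
    rw [flip_sum_abs V F1, flip_sum_abs V F2]
    set ψ : V → ℝ := fun x => |φ x| with hψ
    have hψ0 : ∀ x, 0 ≤ extF V (fun _ => u) ψ x := by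
      intro x; unfold extF; split_ifs
      · exact abs_nonneg _
      · exact hu
    set j : Lat × Lat → ℝ := Je V (fun _ => u) ψ with hj
    have hj0 : ∀ e, 0 ≤ j e := fun e => by
      have := hψ0 e.1; have := hψ0 e.2
      simp only [hj, Je]; positivity
    have hm : ∀ T ∈ V.powerset, ∀ x, extF V gm (flip V T ψ) x =
        sgn (T ∪ B) x * extF V (fun _ => u) ψ x := by
      intro T hT x
      unfold extF flip
      by_cases hx : x ∈ V
      · have hxB : x ∉ B := fun h => Finset.disjoint_left.1 hVB hx h
        simp [hx, sgn, hxB]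
      · have hxT : x ∉ T := fun h => hx (Finset.mem_powerset.1 hT h)
        by_cases hxB : x ∈ B <;> simp [hx, sgn, hxB, hxT, hgm]
    have hp : ∀ T ∈ V.powerset, ∀ x, extF V (fun _ => u) (flip V T ψ) x =
        sgn T x * extF V (fun _ => u) ψ x := by
      intro T hT x
      unfold extF flip
      by_cases hx : x ∈ V
      · simp [hx]
      · have hxT : x ∉ T := fun h => hx (Finset.mem_powerset.1 hT h)
        simp [hx, sgn, hxT]
    have hFK := FK_main V (A : Set Lat) B E (fun x hx h => Finset.disjoint_left.1 hVA hx h)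
      (fun x hx h => Finset.disjoint_left.1 hVB hx h)
      (fun x hx h => Finset.disjoint_left.1 hAB hx h)
      (fun e he => by
        have := (hE e he).2.2
        simp only [Finset.mem_union] at this
        simp only [Finset.mem_coe]
        tauto) j hj0
    have e1 : ∑ T ∈ V.powerset, F1 (flip V T ψ) = Real.exp (-(ψ ⬝ᵥ ψ) / 2) *
        ∑ T ∈ V.powerset, ∏ e ∈ E, Real.exp (j e * (sgn (T ∪ B) e.1 * sgn (T ∪ B) e.2)) := by
      rw [Finset.mul_sum]
      apply Finset.sum_congr rfl
      intro T hT
      simp only [hF1, zD, flip_dot]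
      congr 1
      apply Finset.prod_congr rfl
      intro e _
      simp only [Je, hm T hT, hj]
      congr 1; ring
    have e2 : ∑ T ∈ V.powerset, F2 (flip V T ψ) = Real.exp (-(ψ ⬝ᵥ ψ) / 2) *
        ∑ S ∈ E.powerset with Disc (A : Set Lat) B S,
        ∑ T ∈ V.powerset, ∏ e ∈ S, (Real.exp (j e * (sgn T e.1 * sgn T e.2)) - 1) := by
      simp only [hF2]
      rw [Finset.sum_comm, Finset.mul_sum]
      apply Finset.sum_congr rfl
      intro S _
      rw [Finset.mul_sum]
      apply Finset.sum_congr rfl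
      intro T hT
      simp only [fkD, flip_dot]
      congr 1
      apply Finset.prod_congr rfl
      intro e _
      simp only [Je, hp T hT, hj]
      congr 2; ring
    rw [e1, e2]
    refine mul_le_mul_of_nonneg_left ?_ (Real.exp_pos _).le
    have hu' : ∀ T : Finset Lat, (T ∪ B) = @Union.union (Finset Lat)
        (@Finset.instUnion Lat fun a b => Classical.propDecidable (a = b)) T B := by
      intro T; ext x; simp only [Finset.mem_union]
    simp only [hu']
    exact hFK
  have k1 : ∀ F : (V → ℝ) → ℝ, Integrable F →
      ∫ φ, ∑ T ∈ V.powerset, F (flip V T φ) = (V.powerset.card : ℝ) * ∫ φ, F φ := by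
    intro F hF
    rw [integral_finsetSum _ (fun T _ => flip_integrable V T F hF)]
    simp only [flip_integral, Finset.sum_const, nsmul_eq_mul]
  have k2 := integral_mono
    (integrable_finsetSum _ (fun T (_ : T ∈ V.powerset) => flip_integrable V T F1 i1))
    (integrable_finsetSum _ (fun T (_ : T ∈ V.powerset) => flip_integrable V T F2 i2))
    key
  rw [k1 F1 i1, k1 F2 i2] at k2
  have hc : (0 : ℝ) < (V.powerset.card : ℝ) := by
    rw [Finset.card_powerset]; positivity
  exact le_of_mul_le_mul_left k2 hc




/-! ### Masses of loops and excursions -/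

/-- Items: loops or boundary excursions. -/
inductive Item where
  | lp : ULoop → Item
  | ex : List Lat → Item

/-- All steps of an item satisfy `R`. -/
def itemChain (R : Lat → Lat → Prop) : Item → Prop
  | Item.lp γ => lchain R γ
  | Item.ex l => l.IsChain R

/-- Paths in `V` ending with a final point in `C`. -/
def bex (V C : Finset Lat) : List Lat → Prop
  | [] => False
  | [_] => False
  | [x, y] => x ∈ V ∧ y ∈ C
  | x :: y :: z :: t => x ∈ V ∧ bex V C (y :: z :: t)

/-- Excursions: from `C`, through `V`, to `C`. -/
def excOK (V C : Finset Lat) : List Lat → Prop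
  | [] => False
  | x :: l => x ∈ C ∧ bex V C l

/-- Masses of the items. -/
def mI (V C : Finset Lat) (u : ℝ≥0) : Item → ℝ≥0
  | Item.lp γ => if ULoop.verts γ ⊆ (V : Set Lat) then loopWeight γ / 2 else 0
  | Item.ex l => if excOK V C l ∧ l.IsChain Adj then u ^ 2 / 2 * 4⁻¹ ^ steps l else 0

theorem tsum_item (f : Item → ℝ≥0∞) :
    ∑' i, f i = ∑' γ, f (Item.lp γ) + ∑' l, f (Item.ex l) := by
  set f1 : Item → ℝ≥0∞ := fun i => match i with
    | Item.lp γ => f (Item.lp γ)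
    | Item.ex _ => 0 with hf1
  set f2 : Item → ℝ≥0∞ := fun i => match i with
    | Item.lp _ => 0
    | Item.ex l => f (Item.ex l) with hf2
  have h : ∀ i, f i = f1 i + f2 i := by
    intro i; cases i <;> simp [hf1, hf2]
  have i1 : Function.Injective Item.lp := fun a b h => by injection h
  have i2 : Function.Injective Item.ex := fun a b h => by injection h
  have h1 : ∑' γ, f (Item.lp γ) = ∑' i, f1 i := by
    rw [← i1.tsum_eq (f := f1)]
    intro i hi
    cases i with
    | lp γ => exact ⟨γ, rfl⟩
    | ex l => exact absurd rfl hi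
  have h2 : ∑' γ, f (Item.ex γ) = ∑' i, f2 i := by
    rw [← i2.tsum_eq (f := f2)]
    intro i hi
    cases i with
    | ex γ => exact ⟨γ, rfl⟩
    | lp l => exact absurd rfl hi
  rw [h1, h2, ← ENNReal.tsum_add]
  exact tsum_congr h

theorem sum_walk_cons {V C : Finset Lat} {S : Finset (Lat × Lat)} (hE : goodE V C S)
    (x : Lat) (f : Lat → ℝ) (hf : ∀ y, y ∉ V → f y = 0) :
    ∑ y ∈ nb x, (if adjS S x y then f y / 4 else 0) =
      ∑ y ∈ V, (if adjS S x y then f y / 4 else 0) := by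
  rw [← Finset.sum_filter, ← Finset.sum_filter]
  have : (nb x).filter (fun y => adjS S x y ∧ y ∈ V) = V.filter (fun y => adjS S x y) := by
    ext y
    simp only [Finset.mem_filter]
    constructor
    · rintro ⟨_, h, h'⟩; exact ⟨h', h⟩
    · rintro ⟨h, h'⟩; exact ⟨(Adj_iff _ _).1 (goodE_adj hE h'), h', h⟩
  rw [← this]
  symm
  apply Finset.sum_subset
  · intro y hy
    rw [Finset.mem_filter] at *
    exact ⟨hy.1, hy.2.1⟩
  · intro y hy hy'
    rw [Finset.mem_filter] at hy hy'
    rw [hf y (fun h => hy' ⟨hy.1, hy.2, h⟩)]; simp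

theorem kernel_sum {V C : Finset Lat} {S : Finset (Lat × Lat)} (hE : goodE V C S)
    (n : ℕ) (x y : V) :
    ∑ l ∈ walkF n x.1, (if l.getLast? = some y.1 ∧ l.IsChain (adjS S) ∧ ∀ z ∈ l, z ∈ V
      then (1 / 4 : ℝ) ^ n else 0) = (PS V S ^ n) x y := by
  induction n generalizing x with
  | zero =>
    simp only [walkF, Finset.sum_singleton, pow_zero, Matrix.one_apply]
    by_cases h : x = y
    · subst h; simp
    · have : x.1 ≠ y.1 := fun h' => h (Subtype.ext h')
      simp [h, this]
  | succ n ih =>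
    rw [sum_walkF_succ]
    set f : Lat → ℝ := fun z => ∑ l ∈ walkF n z, (if l.getLast? = some y.1 ∧ l.IsChain (adjS S) ∧
      ∀ z ∈ l, z ∈ V then (1 / 4 : ℝ) ^ n else 0) with hf
    have hf0 : ∀ z, z ∉ V → f z = 0 := by
      intro z hz
      apply Finset.sum_eq_zero
      intro l hl
      rw [if_neg]
      rintro ⟨_, _, h⟩
      have h2 := ((mem_walkF _ _ _).1 hl).2.1
      exact hz (h z (List.mem_of_mem_head? h2))
    have h1 : ∀ z ∈ nb x.1, ∑ l ∈ walkF n z, (if (x.1 :: l).getLast? = some y.1 ∧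
        (x.1 :: l).IsChain (adjS S) ∧ ∀ z ∈ (x.1 :: l), z ∈ V then (1 / 4 : ℝ) ^ (n + 1) else 0) =
        if adjS S x.1 z then f z / 4 else 0 := by
      intro z _
      have : (if adjS S x.1 z then f z / 4 else 0) = ∑ l ∈ walkF n z, (if adjS S x.1 z then
          (if l.getLast? = some y.1 ∧ l.IsChain (adjS S) ∧
            ∀ z ∈ l, z ∈ V then (1 / 4 : ℝ) ^ n else 0) / 4 else 0) := by
        split_ifs with h
        · rw [Finset.sum_div]
        · simp
      rw [this]
      apply Finset.sum_congr rfl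
      intro l hl
      obtain ⟨a1, a2, a3⟩ := (mem_walkF _ _ _).1 hl
      obtain ⟨b, t, rfl⟩ : ∃ b t, l = b :: t := by
        cases l with
        | nil => simp at a1
        | cons b t => exact ⟨b, t, rfl⟩
      simp only [List.head?_cons, Option.some.injEq] at a2
      subst a2
      simp only [List.getLast?_cons_cons, List.isChain_cons_cons, List.mem_cons, forall_eq_or_imp,
        x.2, true_and]
      by_cases h : adjS S x.1 b
      · simp only [h, true_and, if_true]
        split_ifs
        · ring
        · simp
      · simp [h]
    rw [Finset.sum_congr rfl h1, sum_walk_cons hE x.1 f hf0, pow_succ', Matrix.mul_apply,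
      ← Finset.sum_coe_sort V]
    apply Finset.sum_congr rfl
    intro z _
    rw [← ih z]
    simp only [PS, Matrix.of_apply]
    split_ifs
    · simp only [hf]; ring
    · ring

theorem hit_sum {V C : Finset Lat} {S : Finset (Lat × Lat)} (hE : goodE V C S) (u : ℝ)
    (n : ℕ) (x : V) :
    ∑ l ∈ walkF (n + 1) x.1, (if bex V C l ∧ l.IsChain (adjS S)
      then u * (1 / 4 : ℝ) ^ (n + 1) else 0) =
      ((PS V S ^ n).mulVec (hS V C S (fun _ => u))) x := by
  induction n generalizing x with
  | zero =>
    rw [sum_walkF_succ]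
    simp only [walkF, Finset.sum_singleton, pow_zero, Matrix.one_mulVec, hS, bex, x.2, true_and,
      List.isChain_cons_cons, List.isChain_singleton, and_true, zero_add, pow_one]
    rw [← Finset.sum_filter, ← Finset.sum_filter]
    apply Finset.sum_congr
    · ext y
      simp only [Finset.mem_filter]
      constructor
      · rintro ⟨_, h, h'⟩; exact ⟨h, h'⟩
      · rintro ⟨h, h'⟩; exact ⟨(Adj_iff _ _).1 (goodE_adj hE h'), h, h'⟩
    · intros; ring
  | succ n ih =>
    rw [sum_walkF_succ]
    set f : Lat → ℝ := fun z => ∑ l ∈ walkF (n + 1) z, (if bex V C l ∧ l.IsChain (adjS S)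
      then u * (1 / 4 : ℝ) ^ (n + 1) else 0) with hf
    have hf0 : ∀ z, z ∉ V → f z = 0 := by
      intro z hz
      apply Finset.sum_eq_zero
      intro l hl
      rw [if_neg]
      rintro ⟨h, _⟩
      obtain ⟨a1, h2, _⟩ := ((mem_walkF _ _ _).1 hl)
      match l, h, h2 with
      | [_, _], h, h2 => simp at h2; subst h2; exact hz h.1
      | _ :: _ :: _ :: _, h, h2 => simp at h2; subst h2; exact hz h.1
    have h1 : ∀ z ∈ nb x.1, ∑ l ∈ walkF (n + 1) z, (if bex V C (x.1 :: l) ∧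
        (x.1 :: l).IsChain (adjS S) then u * (1 / 4 : ℝ) ^ (n + 1 + 1) else 0) =
        if adjS S x.1 z then f z / 4 else 0 := by
      intro z _
      have : (if adjS S x.1 z then f z / 4 else 0) = ∑ l ∈ walkF (n + 1) z, (if adjS S x.1 z then
          (if bex V C l ∧ l.IsChain (adjS S) then u * (1 / 4 : ℝ) ^ (n + 1) else 0) / 4 else 0) := by
        split_ifs with h
        · rw [Finset.sum_div]
        · simp
      rw [this]
      apply Finset.sum_congr rfl
      intro l hl
      obtain ⟨a1, a2, a3⟩ := (mem_walkF _ _ _).1 hl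
      obtain ⟨b, c, t, rfl⟩ : ∃ b c t, l = b :: c :: t := by
        match l, a1 with
        | b :: c :: t, _ => exact ⟨b, c, t, rfl⟩
      simp only [List.head?_cons, Option.some.injEq] at a2
      subst a2
      simp only [List.isChain_cons_cons]
      simp only [bex, x.2, true_and]
      by_cases h : adjS S x.1 b
      · simp only [h, true_and, if_true]
        split_ifs
        · ring
        · simp
      · simp [h]
    rw [Finset.sum_congr rfl h1, sum_walk_cons hE x.1 f hf0, pow_succ', ← Matrix.mulVec_mulVec,
      ← sum_PS]
    congr 1
    funext z
    exact ih z

theorem exc_sum {V C : Finset Lat} {S : Finset (Lat × Lat)} (hE : goodE V C S) (u : ℝ)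
    (n : ℕ) :
    ∑ x ∈ C, ∑ l ∈ walkF (n + 2) x, (if excOK V C l ∧ l.IsChain (adjS S)
      then u ^ 2 * (1 / 4 : ℝ) ^ (n + 2) else 0) =
      hS V C S (fun _ => u) ⬝ᵥ ((PS V S ^ n).mulVec (hS V C S (fun _ => u))) := by
  set f : Lat → ℝ := fun z => ∑ l ∈ walkF (n + 1) z, (if bex V C l ∧ l.IsChain (adjS S)
      then u * (1 / 4 : ℝ) ^ (n + 1) else 0) with hf
  have hf0 : ∀ z, z ∉ V → f z = 0 := by
    intro z hz
    apply Finset.sum_eq_zero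
    intro l hl
    rw [if_neg]
    rintro ⟨h, _⟩
    obtain ⟨a1, h2, _⟩ := ((mem_walkF _ _ _).1 hl)
    match l, h, h2 with
    | [_, _], h, h2 => simp at h2; subst h2; exact hz h.1
    | _ :: _ :: _ :: _, h, h2 => simp at h2; subst h2; exact hz h.1
  have h0 : ∀ x ∈ C, ∑ l ∈ walkF (n + 2) x, (if excOK V C l ∧ l.IsChain (adjS S)
      then u ^ 2 * (1 / 4 : ℝ) ^ (n + 2) else 0) =
      u * ∑ z ∈ V, if adjS S x z then f z / 4 else 0 := by
    intro x hx
    rw [← sum_walk_cons hE x f hf0, sum_walkF_succ, Finset.mul_sum]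
    apply Finset.sum_congr rfl
    intro z _
    have : (if adjS S x z then f z / 4 else 0) = ∑ l ∈ walkF (n + 1) z, (if adjS S x z then
        (if bex V C l ∧ l.IsChain (adjS S) then u * (1 / 4 : ℝ) ^ (n + 1) else 0) / 4 else 0) := by
      split_ifs with h
      · rw [Finset.sum_div]
      · simp
    rw [this, Finset.mul_sum]
    apply Finset.sum_congr rfl
    intro l hl
    obtain ⟨a1, a2, a3⟩ := (mem_walkF _ _ _).1 hl
    obtain ⟨b, t, rfl⟩ : ∃ b t, l = b :: t := by
      match l, a1 with
      | b :: t, _ => exact ⟨b, t, rfl⟩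
    simp only [List.head?_cons, Option.some.injEq] at a2
    subst a2
    simp only [List.isChain_cons_cons]
    simp only [excOK, hx, true_and]
    by_cases h : adjS S x b
    · simp only [h, true_and, if_true]
      split_ifs
      · ring
      · simp
    · simp [h]
  rw [Finset.sum_congr rfl h0]
  simp only [Finset.mul_sum]
  rw [Finset.sum_comm, ← Finset.sum_coe_sort V, dotProduct]
  apply Finset.sum_congr rfl
  intro z _
  rw [← hit_sum hE u n z, hS, Finset.sum_mul]
  apply Finset.sum_congr rfl
  intro x _
  simp only [adjS_symm (x := x) (y := z.1)]
  simp only [hf]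
  split_ifs
  · ring
  · ring




/-- Total mass of the items through the edges of `S`. -/
def MS (V C : Finset Lat) (S : Finset (Lat × Lat)) (u : ℝ) : ℝ :=
  (∑' n : ℕ, ((PS V S) ^ (n + 1)).trace / ((n : ℝ) + 1)) / 2 +
    (∑' n : ℕ, hS V C S (fun _ => u) ⬝ᵥ ((PS V S) ^ n).mulVec (hS V C S (fun _ => u))) / 2

theorem PSpow_nonneg (V : Finset Lat) (S : Finset (Lat × Lat)) (n : ℕ) (x y : V) :
    0 ≤ (PS V S ^ n) x y := by
  induction n generalizing x with
  | zero => simp only [pow_zero, Matrix.one_apply]; split_ifs <;> norm_num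
  | succ n ih =>
    rw [pow_succ', Matrix.mul_apply]
    exact Finset.sum_nonneg fun z _ => mul_nonneg (PS_nonneg V S x z) (ih z)

theorem hS_nonneg (V C : Finset Lat) (S : Finset (Lat × Lat)) (u : ℝ) (hu : 0 ≤ u) (x : V) :
    0 ≤ hS V C S (fun _ => u) x := by
  unfold hS
  apply Finset.sum_nonneg
  intro y _; split_ifs <;> positivity

theorem hPh_nonneg (V C C' : Finset Lat) (S : Finset (Lat × Lat)) (u : ℝ) (hu : 0 ≤ u) (n : ℕ) :
    0 ≤ hS V C S (fun _ => u) ⬝ᵥ ((PS V S) ^ n).mulVec (hS V C' S (fun _ => u)) := by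
  apply Finset.sum_nonneg
  intro x _
  refine mul_nonneg (hS_nonneg V C S u hu x) ?_
  apply Finset.sum_nonneg
  intro y _
  exact mul_nonneg (PSpow_nonneg V S n x y) (hS_nonneg V C' S u hu y)

theorem tr_nonneg (V : Finset Lat) (S : Finset (Lat × Lat)) (n : ℕ) :
    0 ≤ ((PS V S) ^ (n + 1)).trace / ((n : ℝ) + 1) := by
  apply div_nonneg
  · exact Finset.sum_nonneg fun x _ => PSpow_nonneg V S (n + 1) x x
  · positivity

theorem tsum_lat (V : Finset Lat) (f : Lat → ℝ≥0∞) (hf : ∀ x, x ∉ V → f x = 0) :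
    ∑' x, f x = ∑ x ∈ V, f x := tsum_eq_sum (fun x hx => hf x hx)

theorem quarter_pow (n : ℕ) : ENNReal.ofReal ((1 / 4 : ℝ) ^ n) = (4 : ℝ≥0∞)⁻¹ ^ n := by
  rw [ENNReal.ofReal_pow (by norm_num), one_div, ENNReal.ofReal_inv_of_pos (by norm_num)]
  norm_num

theorem loop_mass {V C : Finset Lat} {S : Finset (Lat × Lat)} (hE : goodE V C S) :
    ∑' γ : ULoop, (loopWeight γ : ℝ≥0∞) *
      (if lchain (adjS S) γ ∧ ULoop.verts γ ⊆ (V : Set Lat) then 1 else 0) =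
      ENNReal.ofReal (∑' n : ℕ, ((PS V S) ^ (n + 1)).trace / ((n : ℝ) + 1)) := by
  rw [tsum_unrooted]
  set g : List Lat → ℝ≥0∞ := fun l =>
    ((4 : ℝ≥0∞)⁻¹ ^ (l.length - 1) / ((l.length - 1 : ℕ) : ℝ≥0∞)) *
      (if l.IsChain (adjS S) ∧ ∀ x ∈ l, x ∈ V then 1 else 0) with hg
  have h1 : ∀ r : RootedLoop, ((4 : ℝ≥0∞)⁻¹ ^ r.word.length / r.word.length) *
      (if lchain (adjS S) (umk r) ∧ ULoop.verts (umk r) ⊆ (V : Set Lat) then 1 else 0) =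
      g (r.word ++ r.word.take 1) := by
    intro r
    obtain ⟨a, t, ht⟩ := List.exists_cons_of_ne_nil r.ne
    have hlen : (r.word ++ r.word.take 1).length - 1 = r.word.length := by rw [ht]; simp
    simp only [hg, hlen]
    congr 1
    have : (lchain (adjS S) (umk r) ∧ ULoop.verts (umk r) ⊆ (V : Set Lat)) ↔
        ((r.word ++ r.word.take 1).IsChain (adjS S) ∧ ∀ x ∈ r.word ++ r.word.take 1, x ∈ V) := by
      rw [lchain_mk, verts_mk]
      apply and_congr Iff.rfl
      constructor
      · intro h x hx
        rcases List.mem_append.1 hx with hx | hx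
        · exact h hx
        · exact h (List.mem_of_mem_take hx)
      · intro h x hx
        exact h x (List.mem_append.2 (Or.inl hx))
    simp only [this]
  rw [tsum_congr h1, tsum_rooted, ENNReal.ofReal_tsum_of_nonneg (tr_nonneg V S)
    (gauss_main (PS V S) (PS_herm V S) (fun l v => PS_eig hE l v)).1]
  apply tsum_congr
  intro n
  rw [tsum_lat V]
  · have hn : (0 : ℝ) < (n : ℝ) + 1 := by positivity
    rw [← Finset.sum_coe_sort V, Matrix.trace, Finset.sum_div]
    simp only [Matrix.diag_apply]
    rw [ENNReal.ofReal_sum_of_nonneg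
        (fun x _ => div_nonneg (PSpow_nonneg V S (n + 1) x x) hn.le)]
    apply Finset.sum_congr rfl
    intro x _
    rw [← kernel_sum hE, Finset.sum_div, ENNReal.ofReal_sum_of_nonneg]
    · apply Finset.sum_congr rfl
      intro l hl
      have hl1 := ((mem_walkF _ _ _).1 hl).1
      have hl2 : l.length - 1 = n + 1 := by omega
      simp only [hg, hl2]
      by_cases a : l.getLast? = some x.1
      · by_cases b : l.IsChain (adjS S) ∧ ∀ x ∈ l, x ∈ V
        · rw [if_pos a, if_pos b, if_pos ⟨a, b⟩, mul_one, ENNReal.ofReal_div_of_pos hn, quarter_pow]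
          congr 1
          rw [ENNReal.ofReal_add (by positivity) (by positivity)]; simp
        · rw [if_pos a, if_neg b, if_neg (fun h => b h.2)]; simp
      · rw [if_neg a, if_neg (fun h => a h.1)]; simp
    · intro l _
      split_ifs <;> positivity
  · intro x hx
    apply Finset.sum_eq_zero
    intro l hl
    split_ifs with h
    · simp only [hg]
      rw [if_neg, mul_zero]
      rintro ⟨_, h'⟩
      exact hx (h' x (List.mem_of_mem_head? ((mem_walkF _ _ _).1 hl).2.1))
    · rfl

theorem exc_mass {V C : Finset Lat} {S : Finset (Lat × Lat)} (hE : goodE V C S) (u : ℝ≥0) :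
    ∑' l : List Lat, (if excOK V C l ∧ l.IsChain (adjS S) then (u : ℝ≥0∞) ^ 2 * 4⁻¹ ^ steps l
      else 0) =
      ENNReal.ofReal (∑' n : ℕ, hS V C S (fun _ => (u : ℝ)) ⬝ᵥ
        ((PS V S) ^ n).mulVec (hS V C S (fun _ => (u : ℝ)))) := by
  set f : List Lat → ℝ≥0∞ := fun l => (if excOK V C l ∧ l.IsChain (adjS S) then
    (u : ℝ≥0∞) ^ 2 * 4⁻¹ ^ steps l else 0) with hf
  have hshort : ∀ l : List Lat, l.length ≤ 2 → f l = 0 := by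
    intro l hl
    simp only [hf]
    rw [if_neg]
    rintro ⟨h, _⟩
    match l, hl, h with
    | [a], _, h => exact h.2
    | [a, b], _, h => exact h.2
  have hC : ∀ n x, x ∉ C → ∑ l ∈ walkF n x, f l = 0 := by
    intro n x hx
    apply Finset.sum_eq_zero
    intro l hl
    have h2 := ((mem_walkF _ _ _).1 hl).2.1
    simp only [hf]
    rw [if_neg]
    rintro ⟨h, _⟩
    match l, h, h2 with
    | a :: t, h, h2 => simp at h2; subst h2; exact hx h.1
  rw [tsum_paths f]
  · rw [tsum_eq_zero_add' ENNReal.summable, tsum_eq_zero_add' ENNReal.summable]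
    have z0 : ∑' x, ∑ l ∈ walkF 0 x, f l = 0 := by
      apply ENNReal.tsum_eq_zero.2; intro x
      apply Finset.sum_eq_zero; intro l hl
      exact hshort l (by have := ((mem_walkF _ _ _).1 hl).1; omega)
    have z1 : ∑' x, ∑ l ∈ walkF (0 + 1) x, f l = 0 := by
      apply ENNReal.tsum_eq_zero.2; intro x
      apply Finset.sum_eq_zero; intro l hl
      exact hshort l (by have := ((mem_walkF _ _ _).1 hl).1; omega)
    rw [z0, z1, zero_add, zero_add, ENNReal.ofReal_tsum_of_nonneg
      (hPh_nonneg V C C S u u.2)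
      ((gauss_main (PS V S) (PS_herm V S) (fun l v => PS_eig hE l v)).2.1 _ _)]
    apply tsum_congr
    intro n
    rw [tsum_lat C _ (hC _), ← exc_sum hE, ENNReal.ofReal_sum_of_nonneg]
    · apply Finset.sum_congr rfl
      intro x _
      rw [ENNReal.ofReal_sum_of_nonneg]
      · apply Finset.sum_congr rfl
        intro l hl
        have hl1 := ((mem_walkF _ _ _).1 hl).1
        have hl2 : steps l = n + 2 := by unfold steps; omega
        simp only [hf, hl2]
        split_ifs
        · rw [ENNReal.ofReal_mul (by positivity), quarter_pow, ENNReal.ofReal_pow (NNReal.coe_nonneg u)]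
          simp
        · simp
      · intro l _; split_ifs <;> positivity
    · intro x _
      apply Finset.sum_nonneg
      intro l _; split_ifs <;> positivity
  · intro l hl
    have h : excOK V C l ∧ l.IsChain (adjS S) := by
      by_contra h
      exact hl (by simp only [hf]; rw [if_neg h])
    refine ⟨?_, h.2.imp fun a b hab => goodE_adj hE hab⟩
    rintro rfl
    exact h.1

theorem item_mass {V C : Finset Lat} {S : Finset (Lat × Lat)} (hE : goodE V C S) (u : ℝ≥0) :
    ∑' i : Item, (if itemChain (adjS S) i then (mI V C u i : ℝ≥0∞) else 0) =
      ENNReal.ofReal (MS V C S u) := by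
  rw [tsum_item]
  have h1 : ∀ γ, (if itemChain (adjS S) (Item.lp γ) then (mI V C u (Item.lp γ) : ℝ≥0∞) else 0) =
      2⁻¹ * ((loopWeight γ : ℝ≥0∞) *
      (if lchain (adjS S) γ ∧ ULoop.verts γ ⊆ (V : Set Lat) then 1 else 0)) := by
    intro γ
    simp only [itemChain, mI]
    by_cases a : lchain (adjS S) γ
    · by_cases b : ULoop.verts γ ⊆ (V : Set Lat)
      · simp only [a, b, if_true, and_self, mul_one]
        rw [ENNReal.coe_div (by norm_num), div_eq_mul_inv, mul_comm]; simp
      · simp [a, b]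
    · simp [a]
  have h2 : ∀ l, (if itemChain (adjS S) (Item.ex l) then (mI V C u (Item.ex l) : ℝ≥0∞) else 0) =
      2⁻¹ * (if excOK V C l ∧ l.IsChain (adjS S) then (u : ℝ≥0∞) ^ 2 * 4⁻¹ ^ steps l else 0) := by
    intro l
    simp only [itemChain, mI]
    by_cases a : l.IsChain (adjS S)
    · have a' : l.IsChain Adj := a.imp fun a b hab => goodE_adj hE hab
      by_cases b : excOK V C l
      · simp only [a, a', b, if_true, and_self]
        rw [ENNReal.coe_mul, ENNReal.coe_div (by norm_num), div_eq_mul_inv, ENNReal.coe_pow,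
          ENNReal.coe_pow, ENNReal.coe_inv (by norm_num)]
        simp only [ENNReal.coe_ofNat]; ring
      · simp [b]
    · simp [a]
  simp only [h1, h2]
  rw [ENNReal.tsum_mul_left, ENNReal.tsum_mul_left, loop_mass hE, exc_mass hE, MS,
    ENNReal.ofReal_add]
  · have : ENNReal.ofReal 2 = 2 := by norm_num
    rw [ENNReal.ofReal_div_of_pos (by norm_num), ENNReal.ofReal_div_of_pos (by norm_num),
      div_eq_mul_inv, div_eq_mul_inv, this]
    ring
  · exact div_nonneg (tsum_nonneg (tr_nonneg V S)) (by norm_num)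
  · exact div_nonneg (tsum_nonneg (hPh_nonneg V C C S u u.2)) (by norm_num)




/-! ### Percolation of items through the field -/

/-- The edges used by a set of items. -/
def edgesT (E : Finset (Lat × Lat)) (T : Finset Item) : Finset (Lat × Lat) :=
  E.filter fun e => ∃ i ∈ T, ¬ itemChain (fun x y => (x, y) ≠ e ∧ (y, x) ≠ e) i

theorem edgesT_mono {E : Finset (Lat × Lat)} {T T' : Finset Item} (h : T ⊆ T') :
    edgesT E T ⊆ edgesT E T' := by
  intro e he
  unfold edgesT at *
  rw [Finset.mem_filter] at *
  obtain ⟨h1, i, hi, h2⟩ := he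
  exact ⟨h1, i, h hi, h2⟩

theorem chain_split {V C : Finset Lat} {E S : Finset (Lat × Lat)} (hE : goodE V C E) (hS : S ⊆ E)
    (l : List Lat) (hl : l.IsChain (adjS E)) :
    l.IsChain (adjS S) ↔ ∀ e ∈ E \ S, l.IsChain (fun x y => (x, y) ≠ e ∧ (y, x) ≠ e) := by
  rw [List.isChain_iff_getElem] at hl
  simp only [List.isChain_iff_getElem]
  constructor
  · intro h e he i hi
    rw [Finset.mem_sdiff] at he
    have := h i hi
    rcases this with h' | h'
    · refine ⟨fun h2 => he.2 (h2 ▸ h'), fun h2 => ?_⟩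
      exact (hE _ (hS h')).2.1 (by simp only; rw [h2]; exact he.1)
    · refine ⟨fun h2 => ?_, fun h2 => he.2 (h2 ▸ h')⟩
      exact (hE _ (hS h')).2.1 (by simp only; rw [h2]; exact he.1)
  · intro h i hi
    rcases hl i hi with h' | h'
    · by_cases h2 : (l[i], l[i + 1]) ∈ S
      · exact Or.inl h2
      · exact absurd rfl (h _ (Finset.mem_sdiff.2 ⟨h', h2⟩) i hi).1
    · by_cases h2 : (l[i + 1], l[i]) ∈ S
      · exact Or.inr h2
      · exact absurd rfl (h _ (Finset.mem_sdiff.2 ⟨h', h2⟩) i hi).2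

theorem item_split {V C : Finset Lat} {E S : Finset (Lat × Lat)} (hE : goodE V C E) (hS : S ⊆ E)
    (i : Item) (hi : itemChain (adjS E) i) :
    itemChain (adjS S) i ↔ ∀ e ∈ E \ S, itemChain (fun x y => (x, y) ≠ e ∧ (y, x) ≠ e) i := by
  cases i with
  | lp γ => exact chain_split hE hS _ hi
  | ex l => exact chain_split hE hS _ hi

theorem bex_chain {V C : Finset Lat} {E : Finset (Lat × Lat)}
    (hfull : ∀ x ∈ V, ∀ y, y ∈ V ∨ y ∈ C → Adj x y → adjS E x y) :
    ∀ l : List Lat, bex V C l → l.IsChain Adj → l.IsChain (adjS E)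
  | [x, y], h, h' => by
    simp only [List.isChain_cons_cons, List.isChain_singleton, and_true] at h' ⊢
    exact hfull x h.1 y (Or.inr h.2) h'
  | x :: y :: z :: t, h, h' => by
    rw [List.isChain_cons_cons] at h' ⊢
    refine ⟨hfull x h.1 y ?_ h'.1, bex_chain hfull _ h.2 h'.2⟩
    have := h.2
    left
    cases t with
    | nil => exact this.1
    | cons a t => exact this.1

theorem bex_head {V C : Finset Lat} {x : Lat} {l : List Lat} (h : bex V C (x :: l)) : x ∈ V := by
  match l, h with
  | [y], h => exact h.1
  | y :: z :: t, h => exact h.1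

theorem item_full {V C : Finset Lat} {E : Finset (Lat × Lat)}
    (hfull : ∀ x ∈ V, ∀ y, y ∈ V ∨ y ∈ C → Adj x y → adjS E x y) (u : ℝ≥0) (i : Item)
    (hi : mI V C u i ≠ 0) : itemChain (adjS E) i := by
  cases i with
  | lp γ =>
    simp only [mI, ne_eq, ite_eq_right_iff, Classical.not_imp] at hi
    have hV := hi.1
    have h := γ.out.adj
    change (γ.out.word ++ γ.out.word.take 1).IsChain Adj at h
    change (γ.out.word ++ γ.out.word.take 1).IsChain (adjS E)
    have hm : ∀ x ∈ γ.out.word ++ γ.out.word.take 1, x ∈ V := by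
      intro x hx
      rcases List.mem_append.1 hx with hx | hx
      · exact hV hx
      · exact hV (List.mem_of_mem_take hx)
    rw [List.isChain_iff_getElem] at h ⊢
    intro k hk
    exact hfull _ (hm _ (List.getElem_mem _)) _ (Or.inl (hm _ (List.getElem_mem _))) (h k hk)
  | ex l =>
    simp only [mI, ne_eq, ite_eq_right_iff, Classical.not_imp] at hi
    obtain ⟨⟨h1, h2⟩, _⟩ := hi
    change l.IsChain (adjS E)
    match l, h1, h2 with
    | x :: y :: t, h1, h2 =>
      rw [List.isChain_cons_cons] at h2 ⊢
      exact ⟨adjS_symm.1 (hfull y (bex_head h1.2) x (Or.inr h1.1) (Adj_symm h2.1)),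
        bex_chain hfull _ h1.2 h2.2⟩

theorem MS_nonneg (V C : Finset Lat) (S : Finset (Lat × Lat)) (u : ℝ≥0) : 0 ≤ MS V C S u :=
  add_nonneg (div_nonneg (tsum_nonneg (tr_nonneg V S)) (by norm_num))
    (div_nonneg (tsum_nonneg (hPh_nonneg V C C S u u.2)) (by norm_num))

theorem item_hasSum {V C : Finset Lat} {S : Finset (Lat × Lat)} (hE : goodE V C S) (u : ℝ≥0) :
    HasSum (fun i : Item => if itemChain (adjS S) i then (mI V C u i : ℝ) else 0) (MS V C S u) := by
  have h := item_mass hE u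
  have h1 : ∀ i : Item, (if itemChain (adjS S) i then (mI V C u i : ℝ≥0∞) else 0) =
      ((if itemChain (adjS S) i then mI V C u i else 0 : ℝ≥0) : ℝ≥0∞) := by
    intro i; split_ifs <;> simp
  simp only [h1] at h
  have hs : Summable (fun i : Item => if itemChain (adjS S) i then mI V C u i else 0) := by
    rw [← ENNReal.tsum_coe_ne_top_iff_summable, h]; simp
  rw [← ENNReal.coe_tsum hs] at h
  have h2 := hs.hasSum
  have h3 := NNReal.hasSum_coe.2 h2
  have h4 : ((∑' i : Item, if itemChain (adjS S) i then mI V C u i else 0 : ℝ≥0) : ℝ) =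
      MS V C S u := by
    have := congrArg ENNReal.toReal h
    rw [ENNReal.toReal_ofReal (MS_nonneg V C S u)] at this
    exact this
  rw [h4] at h3
  convert h3 using 2 with i
  split_ifs <;> simp

open Filter Topology in
theorem tend_sub {V C : Finset Lat} {E S : Finset (Lat × Lat)} (hE : goodE V C E) (hS : S ⊆ E)
    (hfull : ∀ x ∈ V, ∀ y, y ∈ V ∨ y ∈ C → Adj x y → adjS E x y) (u : ℝ≥0) :
    Tendsto (fun F : Finset Item => Ex F (fun i => pm (mI V C u i))
      (fun T => if edgesT E T ⊆ S then 1 else 0)) atTop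
      (𝓝 (Real.exp (MS V C S u - MS V C E u))) := by
  set b : Item → Prop := fun i =>
    ∃ e ∈ E \ S, ¬ itemChain (fun x y => (x, y) ≠ e ∧ (y, x) ≠ e) i with hb
  have h1 : ∀ T : Finset Item, edgesT E T ⊆ S ↔ ∀ i ∈ T, ¬ b i := by
    intro T
    unfold edgesT
    constructor
    · rintro h i hi ⟨e, he, he'⟩
      rw [Finset.mem_sdiff] at he
      exact he.2 (h (Finset.mem_filter.2 ⟨he.1, i, hi, he'⟩))
    · intro h e he
      obtain ⟨h2, i, hi, h3⟩ := Finset.mem_filter.1 he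
      by_contra hn
      exact h i hi ⟨e, Finset.mem_sdiff.2 ⟨h2, hn⟩, h3⟩
  simp only [h1]
  have h2 : ∀ F : Finset Item, Ex F (fun i => pm (mI V C u i))
      (fun T => if ∀ i ∈ T, ¬ b i then 1 else 0) =
      Real.exp (-∑ i ∈ F, if b i then (mI V C u i : ℝ) else 0) := by
    intro F
    have hv := Ex_void F (fun i => pm (mI V C u i)) b
    refine Eq.trans ?_ (hv.trans ?_)
    · congr 1
      funext T
      congr
    · rw [← Finset.sum_filter, ← Finset.sum_neg_distrib, Real.exp_sum]
      refine Finset.prod_congr (Finset.filter_congr_decidable _ _ _) ?_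
      intro i _
      simp [pm]
  simp only [h2]
  have h3 : HasSum (fun i : Item => if b i then (mI V C u i : ℝ) else 0)
      (MS V C E u - MS V C S u) := by
    have := (item_hasSum hE u).sub (item_hasSum (goodE_mono hE hS) u)
    refine HasSum.congr_fun this fun i => ?_
    by_cases hm : mI V C u i = 0
    · simp [hm]
    · have hc := item_full hfull u i hm
      have hsp := item_split hE hS i hc
      by_cases hbi : b i
      · have : ¬ itemChain (adjS S) i := by
          rw [hsp]; push Not; obtain ⟨e, he, he'⟩ := hbi; exact ⟨e, he, he'⟩
        simp [hbi, hc, this]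
      · have : itemChain (adjS S) i := by
          rw [hsp]; intro e he; by_contra h; exact hbi ⟨e, he, h⟩
        simp [hbi, hc, this]
  have h4 : Tendsto (fun F : Finset Item => ∑ i ∈ F, if b i then (mI V C u i : ℝ) else 0) atTop
      (𝓝 (MS V C E u - MS V C S u)) := h3
  have h5 := (Real.continuous_exp.tendsto _).comp h4.neg
  rw [neg_sub] at h5
  exact h5

theorem Zp_eq {V C : Finset Lat} {S : Finset (Lat × Lat)} (hVC : Disjoint V C)
    (hE : goodE V C S) (u : ℝ≥0) :
    ∫ φ, zD V (fun _ => (u : ℝ)) S φ =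
      (√(2 * Real.pi)) ^ (Fintype.card V) * Real.exp (MS V C S u) := (gffZ hVC hE _).2

open Filter Topology in
theorem tend_eq {V C : Finset Lat} {E : Finset (Lat × Lat)} (hVC : Disjoint V C)
    (hE : goodE V C E)
    (hfull : ∀ x ∈ V, ∀ y, y ∈ V ∨ y ∈ C → Adj x y → adjS E x y) (u : ℝ≥0)
    (S : Finset (Lat × Lat)) : S ⊆ E →
    Tendsto (fun F : Finset Item => Ex F (fun i => pm (mI V C u i))
      (fun T => if edgesT E T = S then 1 else 0)) atTop
      (𝓝 ((∫ φ, fkD V (fun _ => (u : ℝ)) S φ) / ∫ φ, zD V (fun _ => (u : ℝ)) E φ)) := by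
  induction S using Finset.strongInduction with
  | H S ih =>
    intro hS
    have hES := goodE_mono hE hS
    set Z := ∫ φ, zD V (fun _ => (u : ℝ)) E φ with hZ
    have h1 : ∀ F : Finset Item, Ex F (fun i => pm (mI V C u i))
        (fun T => if edgesT E T = S then 1 else 0) =
        Ex F (fun i => pm (mI V C u i)) (fun T => if edgesT E T ⊆ S then 1 else 0) -
        ∑ S' ∈ S.ssubsets, Ex F (fun i => pm (mI V C u i))
          (fun T => if edgesT E T = S' then 1 else 0) := by
      intro F
      rw [eq_sub_iff_add_eq, ← Ex_sum]
      have : ∀ T : Finset Item, (if edgesT E T ⊆ S then (1 : ℝ) else 0) =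
          ∑ S' ∈ S.powerset, (if edgesT E T = S' then 1 else 0) := by
        intro T
        rw [Finset.sum_ite_eq]
        simp
      simp only [this]
      rw [Ex_sum, Ex_sum, ← Finset.insert_erase (Finset.mem_powerset_self S),
        Finset.sum_insert (Finset.notMem_erase _ _)]
      rfl
    simp only [h1]
    have h2 := tend_sub hE hS hfull u
    have h3 : Tendsto (fun F : Finset Item => ∑ S' ∈ S.ssubsets, Ex F (fun i => pm (mI V C u i))
          (fun T => if edgesT E T = S' then 1 else 0)) atTop
          (𝓝 (∑ S' ∈ S.ssubsets, (∫ φ, fkD V (fun _ => (u : ℝ)) S' φ) / Z)) := by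
      apply tendsto_finsetSum
      intro S' hS'
      have := Finset.mem_ssubsets.1 hS'
      exact ih S' this (this.1.trans hS)
    have h4 := h2.sub h3
    convert h4 using 2
    have hc : (0 : ℝ) < (√(2 * Real.pi)) ^ (Fintype.card V) := by positivity
    have hZ' := Zp_eq hVC hE u
    have hZS := Zp_eq hVC hES u
    have hZ0 : 0 < Z := by rw [hZ, hZ']; positivity
    have : Real.exp (MS V C S u - MS V C E u) = (∫ φ, zD V (fun _ => (u : ℝ)) S φ) / Z := by
      rw [hZ, hZ', hZS, Real.exp_sub]
      field_simp
    rw [this, ← gS_sum hVC hES, ← Finset.sum_div, ← sub_div]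
    congr 1
    rw [← Finset.insert_erase (Finset.mem_powerset_self S),
      Finset.sum_insert (Finset.notMem_erase _ _)]
    have : S.ssubsets = S.powerset.erase S := rfl
    rw [this]; ring




theorem hS_union {V A B : Finset Lat} (hAB : Disjoint A B) (E : Finset (Lat × Lat)) (g : Lat → ℝ) :
    hS V (A ∪ B) E g = hS V A E g + hS V B E g := by
  funext x
  simp only [hS, Pi.add_apply]
  rw [Finset.sum_union hAB]

theorem hS_congr {V C : Finset Lat} (E : Finset (Lat × Lat)) {g g' : Lat → ℝ}
    (h : ∀ x ∈ C, g x = g' x) : hS V C E g = hS V C E g' := by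
  funext x
  simp only [hS]
  apply Finset.sum_congr rfl
  intro y hy
  rw [h y hy]

theorem hS_neg {V C : Finset Lat} (E : Finset (Lat × Lat)) (g : Lat → ℝ) :
    hS V C E (fun x => - g x) = - hS V C E g := by
  funext x
  simp only [hS, Pi.neg_apply]
  rw [← Finset.sum_neg_distrib]
  apply Finset.sum_congr rfl
  intro y hy
  split_ifs <;> ring

theorem PS_pow_symm (V : Finset Lat) (E : Finset (Lat × Lat)) (n : ℕ) (f g : V → ℝ) :
    f ⬝ᵥ ((PS V E) ^ n).mulVec g = g ⬝ᵥ ((PS V E) ^ n).mulVec f := by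
  have h : ((PS V E) ^ n).transpose = (PS V E) ^ n := by
    rw [Matrix.transpose_pow]
    congr 1
    have := PS_herm V E
    rw [Matrix.IsHermitian, Matrix.conjTranspose_eq_transpose_of_trivial] at this
    exact this
  rw [Matrix.dotProduct_mulVec, ← Matrix.mulVec_transpose, h, dotProduct_comm]

theorem gff_ratio {V A B : Finset Lat} {E : Finset (Lat × Lat)} (hVA : Disjoint V A)
    (hVB : Disjoint V B) (hAB : Disjoint A B) (hE : goodE V (A ∪ B) E) (u : ℝ≥0) :
    (∫ φ, zD V (fun x => if x ∈ B then -(u : ℝ) else u) E φ) /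
      (∫ φ, zD V (fun _ => (u : ℝ)) E φ) =
    Real.exp (-2 * ∑' n : ℕ, hS V A E (fun _ => (u : ℝ)) ⬝ᵥ
      ((PS V E) ^ n).mulVec (hS V B E (fun _ => (u : ℝ)))) := by
  have hVC : Disjoint V (A ∪ B) := Finset.disjoint_union_right.2 ⟨hVA, hVB⟩
  have hsum := (gauss_main (PS V E) (PS_herm V E) (fun l v => PS_eig hE l v)).2.1
  set hA := hS V A E (fun _ => (u : ℝ)) with hhA
  set hB := hS V B E (fun _ => (u : ℝ)) with hhB
  have h1 : ∫ φ, zD V (fun x => if x ∈ B then -(u : ℝ) else u) E φ = _ := (gffZ hVC hE _).2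
  have h2 : ∫ φ, zD V (fun _ => (u : ℝ)) E φ = _ := (gffZ hVC hE _).2
  have e1 : hS V (A ∪ B) E (fun x => if x ∈ B then -(u : ℝ) else u) = hA - hB := by
    rw [hS_union hAB, hS_congr (C := A) (g' := fun _ => (u : ℝ)),
      hS_congr (C := B) (g' := fun _ => -(u : ℝ)), hS_neg, sub_eq_add_neg]
    · intro x hx; simp [hx]
    · intro x hx; simp [Finset.disjoint_left.1 hAB hx]
  have e2 : hS V (A ∪ B) E (fun _ => (u : ℝ)) = hA + hB := hS_union hAB _ _
  rw [e1] at h1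
  rw [e2] at h2
  have k : ∀ (s : ℝ) n, (hA + s • hB) ⬝ᵥ ((PS V E) ^ n).mulVec (hA + s • hB) =
      hA ⬝ᵥ ((PS V E) ^ n).mulVec hA + s ^ 2 * (hB ⬝ᵥ ((PS V E) ^ n).mulVec hB) +
        2 * s * (hA ⬝ᵥ ((PS V E) ^ n).mulVec hB) := by
    intro s n
    rw [Matrix.mulVec_add, Matrix.mulVec_smul, dotProduct_add, add_dotProduct, add_dotProduct,
      dotProduct_smul, dotProduct_smul, smul_dotProduct, smul_dotProduct, PS_pow_symm V E n hB hA]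
    simp only [smul_eq_mul]; ring
  have k' : ∀ s : ℝ, ∑' n, (hA + s • hB) ⬝ᵥ ((PS V E) ^ n).mulVec (hA + s • hB) =
      ∑' n, hA ⬝ᵥ ((PS V E) ^ n).mulVec hA + s ^ 2 * ∑' n, (hB ⬝ᵥ ((PS V E) ^ n).mulVec hB) +
        2 * s * ∑' n, (hA ⬝ᵥ ((PS V E) ^ n).mulVec hB) := by
    intro s
    simp only [k]
    rw [((hsum hA hA).add ((hsum hB hB).mul_left (s ^ 2))).tsum_add ((hsum hA hB).mul_left (2 * s)),
      (hsum hA hA).tsum_add ((hsum hB hB).mul_left (s ^ 2)), tsum_mul_left, tsum_mul_left]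
  have k1 := k' 1
  have k2 := k' (-1)
  rw [one_smul] at k1
  rw [neg_one_smul, ← sub_eq_add_neg] at k2
  rw [h1, h2, k1, k2]
  have hc : (0 : ℝ) < (√(2 * Real.pi)) ^ (Fintype.card V) := by positivity
  rw [mul_div_mul_left _ _ hc.ne', ← Real.exp_sub]
  congr 1
  ring

open Filter Topology in
theorem gff_prob {V A B : Finset Lat} {E : Finset (Lat × Lat)} (hVA : Disjoint V A)
    (hVB : Disjoint V B) (hAB : Disjoint A B) (hE : goodE V (A ∪ B) E)
    (hfull : ∀ x ∈ V, ∀ y, y ∈ V ∨ y ∈ A ∪ B → Adj x y → adjS E x y) (u : ℝ≥0)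
    (F : Finset Item) :
    Real.exp (-2 * ∑' n : ℕ, hS V A E (fun _ => (u : ℝ)) ⬝ᵥ
      ((PS V E) ^ n).mulVec (hS V B E (fun _ => (u : ℝ)))) ≤
    Ex F (fun i => pm (mI V (A ∪ B) u i))
      (fun T => if Disc (A : Set Lat) B (edgesT E T) then 1 else 0) := by
  have hVC : Disjoint V (A ∪ B) := Finset.disjoint_union_right.2 ⟨hVA, hVB⟩
  rw [← gff_ratio hVA hVB hAB hE u]
  set Z := ∫ φ, zD V (fun _ => (u : ℝ)) E φ with hZ
  have hZ0 : 0 < Z := by rw [hZ, Zp_eq hVC hE u]; positivity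
  have h1 : ∀ T : Finset Item, (if Disc (A : Set Lat) B (edgesT E T) then (1 : ℝ) else 0) =
      ∑ S ∈ E.powerset with Disc (A : Set Lat) B S, if edgesT E T = S then 1 else 0 := by
    intro T
    rw [Finset.sum_ite_eq]
    have : edgesT E T ⊆ E := Finset.filter_subset _ _
    simp [this]
  have h2 : Tendsto (fun F : Finset Item => Ex F (fun i => pm (mI V (A ∪ B) u i))
      (fun T => if Disc (A : Set Lat) B (edgesT E T) then 1 else 0)) atTop
      (𝓝 (∑ S ∈ E.powerset with Disc (A : Set Lat) B S,
        (∫ φ, fkD V (fun _ => (u : ℝ)) S φ) / Z)) := by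
    simp only [h1, Ex_sum]
    apply tendsto_finsetSum
    intro S hS
    exact tend_eq hVC hE hfull u S (Finset.mem_powerset.1 (Finset.mem_filter.1 hS).1)
  have h3 := FKZ hVA hVB hAB hE u u.2
  have h4 : (∫ φ, zD V (fun x => if x ∈ B then -(u : ℝ) else u) E φ) / Z ≤
      ∑ S ∈ E.powerset with Disc (A : Set Lat) B S,
        (∫ φ, fkD V (fun _ => (u : ℝ)) S φ) / Z := by
    rw [← Finset.sum_div]
    exact div_le_div_of_nonneg_right h3 hZ0.le
  refine h4.trans (le_of_tendsto h2 ?_)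
  filter_upwards [eventually_ge_atTop F] with G hG
  refine Ex_anti_F hG (fun i => pm_bd (mI V (A ∪ B) u i).2) ?_
  intro T T' hT
  have := edgesT_mono (E := E) hT
  by_cases hd : Disc (A : Set Lat) B (edgesT E T')
  · have hd' := Disc_anti this hd
    simp only [hd, hd', if_true, le_refl]
  · simp only [hd, if_false]
    split_ifs <;> norm_num

theorem green_bound {V A B C : Finset Lat} {E : Finset (Lat × Lat)} (hE : goodE V C E)
    (u : ℝ≥0) (L : V → ℝ) (hL : ∀ x, 0 ≤ L x)
    (h : ∀ x, hS V B E (fun _ => (u : ℝ)) x + (PS V E).mulVec L x ≤ L x) :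
    ∑' n : ℕ, hS V A E (fun _ => (u : ℝ)) ⬝ᵥ
      ((PS V E) ^ n).mulVec (hS V B E (fun _ => (u : ℝ))) ≤
    ∑ x, hS V A E (fun _ => (u : ℝ)) x * L x := by
  have hsum := (gauss_main (PS V E) (PS_herm V E) (fun l v => PS_eig hE l v)).2.1
    (hS V A E (fun _ => (u : ℝ))) (hS V B E (fun _ => (u : ℝ)))
  set hA := hS V A E (fun _ => (u : ℝ)) with hhA
  set hB := hS V B E (fun _ => (u : ℝ)) with hhB
  have hps : ∀ N x, ∑ n ∈ Finset.range N, ((PS V E) ^ n).mulVec hB x ≤ L x := by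
    intro N
    induction N with
    | zero => intro x; simpa using hL x
    | succ N ih =>
      intro x
      rw [Finset.sum_range_succ']
      have e : ∑ n ∈ Finset.range N, ((PS V E) ^ (n + 1)).mulVec hB x =
          (PS V E).mulVec (fun y => ∑ n ∈ Finset.range N, ((PS V E) ^ n).mulVec hB y) x := by
        simp only [pow_succ', ← Matrix.mulVec_mulVec]
        simp only [Matrix.mulVec, dotProduct]
        rw [Finset.sum_comm]
        apply Finset.sum_congr rfl
        intro y _
        rw [Finset.mul_sum]
      rw [e]
      have e2 : (PS V E).mulVec (fun y => ∑ n ∈ Finset.range N, ((PS V E) ^ n).mulVec hB y) x ≤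
          (PS V E).mulVec L x := by
        apply Finset.sum_le_sum
        intro y _
        exact mul_le_mul_of_nonneg_left (ih y) (PS_nonneg V E x y)
      have := h x
      simp only [pow_zero, Matrix.one_mulVec]
      linarith
  refine hsum.tsum_le_of_sum_range_le ?_
  intro N
  have : ∑ n ∈ Finset.range N, hA ⬝ᵥ ((PS V E) ^ n).mulVec hB =
      ∑ x, hA x * ∑ n ∈ Finset.range N, ((PS V E) ^ n).mulVec hB x := by
    simp only [dotProduct]
    rw [Finset.sum_comm]
    apply Finset.sum_congr rfl
    intro y _
    rw [Finset.mul_sum]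
  rw [this]
  apply Finset.sum_le_sum
  intro x _
  exact mul_le_mul_of_nonneg_left (hps N x) (hS_nonneg V A E u u.2 x)




/-! ### Upper bounds for the mass of large loops -/

/-- Simple random walk on `ℤ`. -/
def qw : ℕ → ℤ → ℝ
  | 0, d => if d = 0 then 1 else 0
  | n + 1, d => (qw n (d - 1) + qw n (d + 1)) / 2

theorem qw_zero_of (n : ℕ) (d : ℤ) (h : ∀ k : ℕ, d ≠ 2 * k - n) : qw n d = 0 := by
  induction n generalizing d with
  | zero =>
    have := h 0
    simp only [qw]
    rw [if_neg]
    intro h'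
    apply this
    simp [h']
  | succ n ih =>
    simp only [qw]
    rw [ih (d - 1), ih (d + 1)]
    · simp
    · intro k hk; apply h k; push_cast; omega
    · intro k hk; apply h (k + 1); push_cast; omega

theorem qw_choose (n k : ℕ) : qw n (2 * k - n) = (n.choose k : ℝ) / 2 ^ n := by
  induction n generalizing k with
  | zero =>
    simp only [qw]
    cases k with
    | zero => simp
    | succ k => simp; omega
  | succ n ih =>
    simp only [qw]
    have e1 : (2 * (k : ℤ) - ((n + 1 : ℕ) : ℤ) + 1) = 2 * k - n := by push_cast; ring
    rw [e1, ih]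
    cases k with
    | zero =>
      rw [qw_zero_of]
      · simp [pow_succ]; ring
      · intro j; push_cast; omega
    | succ k =>
      have e2 : (2 * ((k + 1 : ℕ) : ℤ) - ((n + 1 : ℕ) : ℤ) - 1) = 2 * k - n := by push_cast; ring
      rw [e2, ih, Nat.choose_succ_succ]
      push_cast
      rw [pow_succ]; ring

theorem cb_bound (m : ℕ) : (Nat.centralBinom m) ^ 2 * (2 * m + 1) ≤ 16 ^ m := by
  induction m with
  | zero => simp
  | succ m ih =>
    have h := Nat.succ_mul_centralBinom_succ m
    have h2 : (m + 1) ^ 2 * ((Nat.centralBinom (m + 1)) ^ 2 * (2 * (m + 1) + 1)) ≤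
        (m + 1) ^ 2 * 16 ^ (m + 1) := by
      have e : (m + 1) ^ 2 * ((Nat.centralBinom (m + 1)) ^ 2 * (2 * (m + 1) + 1)) =
          (2 * (2 * m + 1) * m.centralBinom) ^ 2 * (2 * (m + 1) + 1) := by rw [← h]; ring
      rw [e]
      have e2 : (2 * (2 * m + 1) * m.centralBinom) ^ 2 * (2 * (m + 1) + 1) =
          (4 * (2 * m + 1) * (2 * m + 3)) * (m.centralBinom ^ 2 * (2 * m + 1)) := by ring
      rw [e2]
      calc _ ≤ (4 * (2 * m + 1) * (2 * m + 3)) * 16 ^ m := Nat.mul_le_mul_left _ ih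
        _ ≤ (16 * (m + 1) ^ 2) * 16 ^ m := Nat.mul_le_mul_right _ (by nlinarith)
        _ = _ := by ring
    exact Nat.le_of_mul_le_mul_left h2 (by positivity)

theorem mid_bound (n : ℕ) : (n.choose (n / 2)) ^ 2 * (n + 1) ≤ 4 ^ n := by
  rcases Nat.even_or_odd' n with ⟨m, rfl | rfl⟩
  · have := cb_bound m
    rw [Nat.mul_div_cancel_left _ (by norm_num : 0 < 2), pow_mul]
    simpa [Nat.centralBinom] using this
  · have := cb_bound (m + 1)
    have e : (2 * m + 1) / 2 = m := by omega
    rw [e]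
    have h : Nat.centralBinom (m + 1) = 2 * (2 * m + 1).choose m := by
      rw [Nat.centralBinom, show 2 * (m + 1) = (2 * m + 1) + 1 by ring, Nat.choose_succ_succ,
        ← Nat.choose_symm_half m]
      ring
    rw [h] at this
    have h4 : 4 ^ (2 * m + 1) = 4 * 16 ^ m := by rw [pow_succ, pow_mul]; ring
    rw [h4]
    have h5 : 16 ^ (m + 1) = 16 * 16 ^ m := by rw [pow_succ]; ring
    rw [h5] at this
    have h6 : (2 * (2 * m + 1).choose m) ^ 2 * (2 * (m + 1) + 1) =
      4 * ((2 * m + 1).choose m ^ 2 * (2 * m + 1 + 1)) + 4 * (2 * m + 1).choose m ^ 2 := by ring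
    rw [h6] at this
    omega

theorem qw_nonneg (n : ℕ) (d : ℤ) : 0 ≤ qw n d := by
  induction n generalizing d with
  | zero => simp only [qw]; split_ifs <;> norm_num
  | succ n ih => simp only [qw]; have := ih (d - 1); have := ih (d + 1); positivity

theorem qw_sq (n : ℕ) (d : ℤ) : qw n d ^ 2 ≤ 1 / (n + 1) := by
  by_cases h : ∀ k : ℕ, d ≠ 2 * k - n
  · rw [qw_zero_of n d h, zero_pow two_ne_zero]; positivity
  · push Not at h
    obtain ⟨k, rfl⟩ := h
    rw [qw_choose, div_pow, ← pow_mul, mul_comm n 2, pow_mul, div_le_div_iff₀ (by positivity)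
      (by positivity), one_mul]
    have h1 : (n.choose k : ℝ) ≤ n.choose (n / 2) := by exact_mod_cast Nat.choose_le_middle k n
    have h2 : ((n.choose (n / 2) : ℝ)) ^ 2 * (n + 1) ≤ 4 ^ n := by exact_mod_cast mid_bound n
    have h3 : (n.choose k : ℝ) ^ 2 ≤ (n.choose (n / 2) : ℝ) ^ 2 := by gcongr
    calc _ ≤ (n.choose (n / 2) : ℝ) ^ 2 * (n + 1) := by gcongr
      _ ≤ _ := by norm_num at h2 ⊢; exact h2

/-- `n`-step transition probabilities. -/
def kW (n : ℕ) (x y : Lat) : ℝ :=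
  ∑ l ∈ walkF n x, if l.getLast? = some y then (1 / 4 : ℝ) ^ n else 0

theorem walkF_ne {n : ℕ} {x : Lat} {l : List Lat} (h : l ∈ walkF n x) : l ≠ [] := by
  intro h'
  have := ((mem_walkF _ _ _).1 h).1
  simp [h'] at this

theorem last_cons {n : ℕ} {x z : Lat} {l : List Lat} (h : l ∈ walkF n x) :
    (z :: l).getLast? = l.getLast? := by
  obtain ⟨a, t, rfl⟩ := List.exists_cons_of_ne_nil (walkF_ne h)
  rw [List.getLast?_cons_cons]

theorem kW_succ (n : ℕ) (x y : Lat) : kW (n + 1) x y = (∑ z ∈ nb x, kW n z y) / 4 := by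
  unfold kW
  rw [sum_walkF_succ, Finset.sum_div]
  apply Finset.sum_congr rfl
  intro z _
  rw [Finset.sum_div]
  apply Finset.sum_congr rfl
  intro l hl
  rw [last_cons hl]
  split_ifs
  · rw [pow_succ]; ring
  · simp

theorem kW_eq (n : ℕ) (x y : Lat) :
    kW n x y = qw n ((y.1 - x.1) + (y.2 - x.2)) * qw n ((y.1 - x.1) - (y.2 - x.2)) := by
  induction n generalizing x with
  | zero =>
    simp only [kW, walkF, Finset.sum_singleton, qw, List.getLast?_singleton, Option.some.injEq,
      pow_zero]
    by_cases h : x = y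
    · simp [h]
    · rw [if_neg h]
      by_cases h1 : y.1 - x.1 + (y.2 - x.2) = 0
      · by_cases h2 : y.1 - x.1 - (y.2 - x.2) = 0
        · exact absurd (Prod.ext (by omega) (by omega)) h
        · simp [h2]
      · simp [h1]
  | succ n ih =>
    rw [kW_succ, sum_nb, ih, ih, ih, ih]
    simp only [qw]
    have e1 : y.1 - (x.1 + 1) + (y.2 - x.2) = y.1 - x.1 + (y.2 - x.2) - 1 := by ring
    have e2 : y.1 - (x.1 - 1) + (y.2 - x.2) = y.1 - x.1 + (y.2 - x.2) + 1 := by ring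
    have e3 : y.1 - x.1 + (y.2 - (x.2 + 1)) = y.1 - x.1 + (y.2 - x.2) - 1 := by ring
    have e4 : y.1 - x.1 + (y.2 - (x.2 - 1)) = y.1 - x.1 + (y.2 - x.2) + 1 := by ring
    have f1 : y.1 - (x.1 + 1) - (y.2 - x.2) = y.1 - x.1 - (y.2 - x.2) - 1 := by ring
    have f2 : y.1 - (x.1 - 1) - (y.2 - x.2) = y.1 - x.1 - (y.2 - x.2) + 1 := by ring
    have f3 : y.1 - x.1 - (y.2 - (x.2 + 1)) = y.1 - x.1 - (y.2 - x.2) + 1 := by ring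
    have f4 : y.1 - x.1 - (y.2 - (x.2 - 1)) = y.1 - x.1 - (y.2 - x.2) - 1 := by ring
    rw [e1, e2, e3, e4, f1, f2, f3, f4]
    ring

theorem kW_le (n : ℕ) (x y : Lat) : kW n x y ≤ 1 / (n + 1) := by
  rw [kW_eq]
  have h1 := qw_sq n ((y.1 - x.1) + (y.2 - x.2))
  have h2 := qw_sq n ((y.1 - x.1) - (y.2 - x.2))
  nlinarith [sq_nonneg (qw n ((y.1 - x.1) + (y.2 - x.2)) - qw n ((y.1 - x.1) - (y.2 - x.2)))]

theorem walkF_total (n : ℕ) (x : Lat) : ∑ l ∈ walkF n x, (1 / 4 : ℝ) ^ n = 1 := by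
  induction n generalizing x with
  | zero => simp [walkF]
  | succ n ih =>
    rw [sum_walkF_succ]
    have : ∀ y ∈ nb x, ∑ l ∈ walkF n y, (1 / 4 : ℝ) ^ (n + 1) = 1 / 4 := by
      intro y _
      have := ih y
      rw [pow_succ, ← Finset.sum_mul, this, one_mul]
    rw [Finset.sum_congr rfl this, sum_nb]; norm_num

/-- `v` is far from `c`. -/
def far (b : ℕ) (c v : Lat) : Prop := (b : ℤ) ≤ |v.1 - c.1| ∨ (b : ℤ) ≤ |v.2 - c.2|

theorem far_pow {b : ℕ} {c v : Lat} (h : far b c v) :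
    (b : ℝ) ^ 4 ≤ ((v.1 - c.1 : ℤ) : ℝ) ^ 4 + ((v.2 - c.2 : ℤ) : ℝ) ^ 4 := by
  have key : ∀ d : ℤ, (b : ℤ) ≤ |d| → (b : ℝ) ^ 4 ≤ (d : ℝ) ^ 4 := by
    intro d hd
    have h1 : (b : ℝ) ≤ |(d : ℝ)| := by exact_mod_cast hd
    have : (d : ℝ) ^ 4 = |(d : ℝ)| ^ 4 := by rw [← abs_pow, abs_of_nonneg (by positivity)]
    rw [this]; gcongr
  rcases h with h | h
  · have := key _ h
    have h2 : (0 : ℝ) ≤ ((v.2 - c.2 : ℤ) : ℝ) ^ 4 := by positivity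
    linarith
  · have := key _ h
    have h2 : (0 : ℝ) ≤ ((v.1 - c.1 : ℤ) : ℝ) ^ 4 := by positivity
    linarith

/-- Probability to go far. -/
def gR (b : ℕ) (c : Lat) (m : ℕ) (x : Lat) : ℝ :=
  ∑ l ∈ walkF m x, if ∃ v ∈ l, far b c v then (1 / 4 : ℝ) ^ m else 0

theorem gR_far (b : ℕ) (c : Lat) (m : ℕ) (x : Lat) (h : far b c x) : gR b c m x = 1 := by
  rw [← walkF_total m x]
  unfold gR
  apply Finset.sum_congr rfl
  intro l hl
  rw [if_pos]
  exact ⟨x, List.mem_of_mem_head? ((mem_walkF _ _ _).1 hl).2.1, h⟩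

theorem gR_succ (b : ℕ) (c : Lat) (m : ℕ) (x : Lat) (h : ¬ far b c x) :
    gR b c (m + 1) x = (∑ z ∈ nb x, gR b c m z) / 4 := by
  unfold gR
  rw [sum_walkF_succ, Finset.sum_div]
  apply Finset.sum_congr rfl
  intro z _
  rw [Finset.sum_div]
  apply Finset.sum_congr rfl
  intro l hl
  simp only [List.mem_cons, exists_eq_or_imp, h, false_or]
  split_ifs
  · rw [pow_succ]; ring
  · simp

theorem gR_le (b : ℕ) (c : Lat) (m : ℕ) (x : Lat) : (b : ℝ) ^ 4 * gR b c m x ≤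
    ((x.1 - c.1 : ℤ) : ℝ) ^ 4 + ((x.2 - c.2 : ℤ) : ℝ) ^ 4 +
      3 * m * (((x.1 - c.1 : ℤ) : ℝ) ^ 2 + ((x.2 - c.2 : ℤ) : ℝ) ^ 2) + 3 * m ^ 2 := by
  induction m generalizing x with
  | zero =>
    by_cases h : far b c x
    · rw [gR_far _ _ _ _ h]; have := far_pow h; simpa using this
    · have : gR b c 0 x = 0 := by
        simp only [gR, walkF, Finset.sum_singleton, List.mem_singleton, exists_eq_left]
        rw [if_neg h]
      rw [this]; simp; positivity
  | succ m ih =>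
    by_cases h : far b c x
    · rw [gR_far _ _ _ _ h, mul_one]
      have := far_pow h
      have h2 : (0 : ℝ) ≤ 3 * ((m + 1 : ℕ) : ℝ) * (((x.1 - c.1 : ℤ) : ℝ) ^ 2 +
        ((x.2 - c.2 : ℤ) : ℝ) ^ 2) := by positivity
      have h3 : (0 : ℝ) ≤ 3 * ((m + 1 : ℕ) : ℝ) ^ 2 := by positivity
      linarith
    · rw [gR_succ _ _ _ _ h, sum_nb]
      have h1 := ih (x.1 + 1, x.2)
      have h2 := ih (x.1 - 1, x.2)
      have h3 := ih (x.1, x.2 + 1)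
      have h4 := ih (x.1, x.2 - 1)
      push_cast at h1 h2 h3 h4 ⊢
      have hm : (0 : ℝ) ≤ m := by positivity
      nlinarith

/-- Reaching far in the first part of a bridge. -/
theorem first_half (b : ℕ) (c : Lat) (m k : ℕ) (x y : Lat) :
    ∑ l ∈ walkF (m + k) x, (if (∃ v ∈ l.take (m + 1), far b c v) ∧ l.getLast? = some y
      then (1 / 4 : ℝ) ^ (m + k) else 0) ≤ 1 / (k + 1) * gR b c m x := by
  induction m generalizing x with
  | zero =>
    rw [Nat.zero_add]
    by_cases h : far b c x
    · rw [gR_far _ _ _ _ h, mul_one]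
      refine le_trans ?_ (kW_le k x y)
      unfold kW
      apply Finset.sum_le_sum
      intro l _
      split_ifs with h1 h2 <;> first | exact le_rfl | positivity | exact absurd h1.2 h2
    · have h0 : gR b c 0 x = 0 := by
        simp only [gR, walkF, Finset.sum_singleton, List.mem_singleton, exists_eq_left]
        rw [if_neg h]
      rw [h0, mul_zero]
      apply le_of_eq
      apply Finset.sum_eq_zero
      intro l hl
      rw [if_neg]
      rintro ⟨⟨v, hv, hv'⟩, _⟩
      have := ((mem_walkF _ _ _).1 hl).2.1
      cases l with
      | nil => simp at hv
      | cons a t =>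
        simp at hv this
        subst hv; subst this
        exact h hv'
  | succ m ih =>
    by_cases h : far b c x
    · rw [gR_far _ _ _ _ h, mul_one]
      refine le_trans ?_ ((kW_le (m + 1 + k) x y).trans ?_)
      · unfold kW
        apply Finset.sum_le_sum
        intro l _
        split_ifs with h1 h2 <;> first | exact le_rfl | positivity | exact absurd h1.2 h2
      · apply one_div_le_one_div_of_le (by positivity)
        push_cast
        have : (0 : ℝ) ≤ m := by positivity
        linarith
    · rw [gR_succ _ _ _ _ h, show m + 1 + k = (m + k) + 1 by ring, sum_walkF_succ, mul_div_assoc',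
        Finset.mul_sum, Finset.sum_div]
      apply Finset.sum_le_sum
      intro z _
      have := ih z
      rw [le_div_iff₀ (by norm_num)]
      refine le_trans (le_of_eq ?_) this
      rw [Finset.sum_mul]
      apply Finset.sum_congr rfl
      intro l hl
      rw [last_cons hl]
      simp only [List.take_succ_cons, List.mem_cons, exists_eq_or_imp, h, false_or]
      split_ifs
      · rw [pow_succ]; ring
      · simp

/-- Far reaching bridges. -/
def cR (b n : ℕ) (x : Lat) : ℝ :=
  ∑ l ∈ walkF n x, if l.getLast? = some x ∧ ∃ v ∈ l, far b x v then (1 / 4 : ℝ) ^ n else 0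

theorem cR_le1 (b n : ℕ) (x : Lat) : cR b n x ≤ 1 / (n + 1) := by
  refine le_trans ?_ (kW_le n x x)
  unfold kW cR
  apply Finset.sum_le_sum
  intro l _
  split_ifs with h1 h2 <;> first | exact le_rfl | positivity | exact absurd h1.1 h2

theorem rev_walk {n : ℕ} {x : Lat} {l : List Lat} (h : l ∈ walkF n x) (h' : l.getLast? = some x) :
    l.reverse ∈ walkF n x ∧ l.reverse.getLast? = some x := by
  rw [mem_walkF] at h ⊢
  refine ⟨⟨by simpa using h.1, by simpa using h', ?_⟩, by simpa using h.2.1⟩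
  rw [List.isChain_reverse]
  exact h.2.2.imp fun a b hab => Adj_symm hab

theorem rev_sum (n : ℕ) (x : Lat) (P : List Lat → Prop) :
    ∑ l ∈ walkF n x, (if P l.reverse ∧ l.getLast? = some x then (1 / 4 : ℝ) ^ n else 0) =
    ∑ l ∈ walkF n x, (if P l ∧ l.getLast? = some x then (1 / 4 : ℝ) ^ n else 0) := by
  rw [← Finset.sum_filter, ← Finset.sum_filter]
  refine Finset.sum_nbij' (fun l => l.reverse) (fun l => l.reverse) ?_ ?_ ?_ ?_ ?_
  · intro l hl
    rw [Finset.mem_filter] at *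
    have := rev_walk hl.1 hl.2.2
    exact ⟨this.1, hl.2.1, this.2⟩
  · intro l hl
    rw [Finset.mem_filter] at *
    have := rev_walk hl.1 hl.2.2
    exact ⟨this.1, by simpa using hl.2.1, this.2⟩
  · intro l _; simp
  · intro l _; simp
  · intro l _; rfl

theorem cR_le2 (b n : ℕ) (hb : 0 < b) (x : Lat) : cR b n x ≤ 3 * (n + 1) / b ^ 4 := by
  obtain ⟨m, k, hn, hkm, hmk⟩ : ∃ m k, n = m + k ∧ k ≤ m ∧ m ≤ k + 1 :=
    ⟨n - n / 2, n / 2, by omega, by omega, by omega⟩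
  have h1 := first_half b x m k x x
  have h2 := rev_sum (m + k) x (fun l => ∃ v ∈ l.take (m + 1), far b x v)
  have h3 := gR_le b x m x
  have h4 : cR b n x ≤ 2 * (1 / (k + 1) * gR b x m x) := by
    refine le_trans ?_ (by linarith [h2.le.trans h1, h1] : (∑ l ∈ walkF (m + k) x,
      (if (∃ v ∈ l.take (m + 1), far b x v) ∧ l.getLast? = some x
      then (1 / 4 : ℝ) ^ (m + k) else 0)) + (∑ l ∈ walkF (m + k) x,
      (if (∃ v ∈ l.reverse.take (m + 1), far b x v) ∧ l.getLast? = some x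
      then (1 / 4 : ℝ) ^ (m + k) else 0)) ≤ _)
    rw [← Finset.sum_add_distrib]
    unfold cR
    rw [hn]
    apply Finset.sum_le_sum
    intro l hl
    by_cases hc : l.getLast? = some x ∧ ∃ v ∈ l, far b x v
    · rw [if_pos hc]
      obtain ⟨hl', v, hv, hf⟩ := hc
      have hlen := ((mem_walkF _ _ _).1 hl).1
      have hp : (0 : ℝ) ≤ (1 / 4) ^ (m + k) := by positivity
      rw [← List.take_append_drop (m + 1) l, List.mem_append] at hv
      rcases hv with hv | hv
      · rw [if_pos ⟨⟨v, hv, hf⟩, hl'⟩]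
        split_ifs <;> linarith
      · have : ∃ v ∈ l.reverse.take (m + 1), far b x v := by
          refine ⟨v, ?_, hf⟩
          rw [List.take_reverse, List.mem_reverse]
          have hd : l.drop (m + 1) = (l.drop (l.length - (m + 1))).drop ((m + 1) - (l.length - (m + 1))) := by
            rw [List.drop_drop]; congr 1; omega
          rw [hd] at hv
          exact List.mem_of_mem_drop hv
        rw [if_pos (⟨this, hl'⟩ : (∃ v ∈ l.reverse.take (m + 1), far b x v) ∧ _)]
        split_ifs <;> linarith
    · rw [if_neg hc]
      positivity
  have hb' : (0 : ℝ) < (b : ℝ) ^ 4 := by positivity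
  simp only [sub_self, Int.cast_zero] at h3
  have h5 : gR b x m x ≤ 3 * m ^ 2 / b ^ 4 := by
    rw [le_div_iff₀ hb']; nlinarith
  refine h4.trans ?_
  have hk : (0 : ℝ) < (k : ℝ) + 1 := by positivity
  have h6 : 2 * (1 / ((k : ℝ) + 1) * gR b x m x) ≤ 2 * (1 / ((k : ℝ) + 1) * (3 * m ^ 2 / b ^ 4)) := by
    gcongr
  refine h6.trans ?_
  have e : 2 * (1 / ((k : ℝ) + 1) * (3 * m ^ 2 / b ^ 4)) = (6 * m ^ 2 / (k + 1)) / b ^ 4 := by ring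
  rw [e]
  apply div_le_div_of_nonneg_right _ hb'.le
  rw [div_le_iff₀ hk, hn]
  have a1 : (k : ℝ) ≤ m := by exact_mod_cast hkm
  have a2 : (m : ℝ) ≤ k + 1 := by exact_mod_cast hmk
  have a3 : (0 : ℝ) ≤ k := by positivity
  push_cast
  nlinarith

theorem cR_nonneg (b n : ℕ) (x : Lat) : 0 ≤ cR b n x :=
  Finset.sum_nonneg fun l _ => by split_ifs <;> positivity

theorem sum_tel (a N : ℕ) : ∑ i ∈ Finset.range N, (1 : ℝ) / (((a + i : ℕ) + 1) * ((a + i : ℕ) + 2)) =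
    1 / ((a : ℝ) + 1) - 1 / ((a : ℝ) + N + 1) := by
  induction N with
  | zero => simp
  | succ N ih =>
    rw [Finset.sum_range_succ, ih]
    push_cast
    have : (a : ℝ) + N + 1 ≠ 0 := by positivity
    have : (a : ℝ) + N + 2 ≠ 0 := by positivity
    have : (a : ℝ) + (N + 1) + 1 ≠ 0 := by positivity
    have : (a : ℝ) + 1 ≠ 0 := by positivity
    field_simp
    ring

theorem cR_sum (b : ℕ) (hb : 0 < b) (x : Lat) (N : ℕ) :
    ∑ n ∈ Finset.range N, cR b (n + 1) x / (n + 1) ≤ 7 / b ^ 2 := by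
  have hb' : (0 : ℝ) < (b : ℝ) := by positivity
  have h0 : ∀ n : ℕ, 0 ≤ cR b (n + 1) x / (n + 1) :=
    fun n => div_nonneg (cR_nonneg _ _ _) (by positivity)
  have h1 : ∑ n ∈ Finset.range N, cR b (n + 1) x / (n + 1) ≤
      ∑ n ∈ Finset.range (b ^ 2 + N), cR b (n + 1) x / (n + 1) := by
    apply Finset.sum_le_sum_of_subset_of_nonneg
    · intro i hi; rw [Finset.mem_range] at *; omega
    · intro n _ _; exact h0 n
  refine h1.trans ?_
  rw [Finset.sum_range_add]
  have h2 : ∑ n ∈ Finset.range (b ^ 2), cR b (n + 1) x / (n + 1) ≤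
      ∑ n ∈ Finset.range (b ^ 2), (6 : ℝ) / b ^ 4 := by
    apply Finset.sum_le_sum
    intro n _
    have := cR_le2 b (n + 1) hb x
    rw [div_le_iff₀ (by positivity)]
    refine this.trans ?_
    rw [div_mul_eq_mul_div]
    apply div_le_div_of_nonneg_right _ (by positivity)
    push_cast
    have : (0 : ℝ) ≤ n := by positivity
    linarith
  have h3 : ∑ i ∈ Finset.range N, cR b (b ^ 2 + i + 1) x / ((b ^ 2 + i : ℕ) + 1) ≤
      ∑ i ∈ Finset.range N, (1 : ℝ) / (((b ^ 2 + i : ℕ) + 1) * ((b ^ 2 + i : ℕ) + 2)) := by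
    apply Finset.sum_le_sum
    intro i _
    have := cR_le1 b (b ^ 2 + i + 1) x
    rw [div_le_iff₀ (by positivity)]
    refine this.trans (le_of_eq ?_)
    push_cast
    field_simp
    ring
  rw [sum_tel] at h3
  have h4 : (0 : ℝ) ≤ 1 / (((b ^ 2 : ℕ) : ℝ) + N + 1) := by positivity
  have h5 : (1 : ℝ) / (((b ^ 2 : ℕ) : ℝ) + 1) ≤ 1 / b ^ 2 := by
    apply one_div_le_one_div_of_le (by positivity)
    push_cast; linarith
  have h6 : ∑ n ∈ Finset.range (b ^ 2), (6 : ℝ) / b ^ 4 = 6 / b ^ 2 := by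
    rw [Finset.sum_const, Finset.card_range, nsmul_eq_mul]
    push_cast
    field_simp
  have h7 : (7 : ℝ) / b ^ 2 = 6 / b ^ 2 + 1 / b ^ 2 := by ring
  rw [h7]
  linarith

/-- A loop with large extent. -/
def wide (b : ℕ) (γ : ULoop) : Prop := ∀ x ∈ ULoop.verts γ, ∃ v ∈ ULoop.verts γ, far b x v

theorem wide_mass (V : Finset Lat) (b : ℕ) (hb : 0 < b) :
    ∑' γ : ULoop, (loopWeight γ : ℝ≥0∞) *
      (if wide b γ ∧ ULoop.verts γ ⊆ (V : Set Lat) then 1 else 0) ≤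
      ENNReal.ofReal (7 * V.card / b ^ 2) := by
  rw [tsum_unrooted]
  set g : List Lat → ℝ≥0∞ := fun l =>
    ((4 : ℝ≥0∞)⁻¹ ^ (l.length - 1) / ((l.length - 1 : ℕ) : ℝ≥0∞)) *
      (if (∀ x ∈ l, x ∈ V) ∧ ∀ x ∈ l.head?, ∃ v ∈ l, far b x v then 1 else 0) with hg
  have h1 : ∀ r : RootedLoop, ((4 : ℝ≥0∞)⁻¹ ^ r.word.length / r.word.length) *
      (if wide b (umk r) ∧ ULoop.verts (umk r) ⊆ (V : Set Lat) then 1 else 0) ≤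
      g (r.word ++ r.word.take 1) := by
    intro r
    obtain ⟨a, t, ht⟩ := List.exists_cons_of_ne_nil r.ne
    have hlen : (r.word ++ r.word.take 1).length - 1 = r.word.length := by rw [ht]; simp
    simp only [hg, hlen]
    gcongr
    by_cases h : wide b (umk r) ∧ ULoop.verts (umk r) ⊆ (V : Set Lat)
    · rw [if_pos h, if_pos]
      rw [wide, verts_mk] at h
      constructor
      · intro x hx
        rcases List.mem_append.1 hx with hx | hx
        · exact h.2 hx
        · exact h.2 (List.mem_of_mem_take hx)
      · intro x hx
        have hx' : x ∈ r.word := by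
          rw [ht] at hx ⊢; simp at hx; simp [hx]
        obtain ⟨v, hv, hv'⟩ := h.1 x hx'
        exact ⟨v, List.mem_append.2 (Or.inl hv), hv'⟩
    · rw [if_neg h]; exact zero_le
  refine (ENNReal.tsum_le_tsum h1).trans ?_
  rw [tsum_rooted]
  have h2 : ∀ n : ℕ, (∑' x : Lat, ∑ l ∈ walkF (n + 1) x, if l.getLast? = some x then g l else 0) ≤
      ENNReal.ofReal (∑ x ∈ V, cR b (n + 1) x / (n + 1)) := by
    intro n
    have hn : (0 : ℝ) < (n : ℝ) + 1 := by positivity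
    rw [tsum_lat V]
    · rw [ENNReal.ofReal_sum_of_nonneg (fun x _ => div_nonneg (cR_nonneg _ _ _) hn.le)]
      apply Finset.sum_le_sum
      intro x _
      rw [cR, Finset.sum_div, ENNReal.ofReal_sum_of_nonneg
        (fun l _ => by split_ifs <;> positivity)]
      apply Finset.sum_le_sum
      intro l hl
      have hl1 := ((mem_walkF _ _ _).1 hl).1
      have hl2 : l.length - 1 = n + 1 := by omega
      have hl3 := ((mem_walkF _ _ _).1 hl).2.1
      simp only [hg, hl2]
      split_ifs with a1 a2 a3 a3
      · rw [mul_one, ENNReal.ofReal_div_of_pos hn, quarter_pow]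
        apply le_of_eq
        congr 1
        rw [ENNReal.ofReal_add (by positivity) (by positivity)]; simp
      · exact absurd ⟨a1, a2.2 x hl3⟩ a3
      all_goals simp
    · intro x hx
      apply Finset.sum_eq_zero
      intro l hl
      split_ifs with h
      · simp only [hg]
        rw [if_neg, mul_zero]
        rintro ⟨h', _⟩
        exact hx (h' x (List.mem_of_mem_head? ((mem_walkF _ _ _).1 hl).2.1))
      · rfl
  refine (ENNReal.tsum_le_tsum h2).trans ?_
  refine ENNReal.tsum_le_of_sum_range_le fun N => ?_
  rw [← ENNReal.ofReal_sum_of_nonneg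
    (fun n _ => Finset.sum_nonneg fun x _ => div_nonneg (cR_nonneg _ _ _) (by positivity))]
  apply ENNReal.ofReal_le_ofReal
  rw [Finset.sum_comm]
  calc _ ≤ ∑ x ∈ V, (7 : ℝ) / b ^ 2 := Finset.sum_le_sum fun x _ => cR_sum b hb x N
    _ = _ := by rw [Finset.sum_const, nsmul_eq_mul]; ring

/-- Finite version. -/
theorem wide_mass_fin (V : Finset Lat) (b : ℕ) (hb : 0 < b) (I : Finset ULoop)
    (hI : ∀ γ ∈ I, wide b γ ∧ ULoop.verts γ ⊆ (V : Set Lat)) :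
    ∑ γ ∈ I, (loopWeight γ : ℝ) ≤ 7 * V.card / b ^ 2 := by
  have h := wide_mass V b hb
  have h1 : ∑ γ ∈ I, (loopWeight γ : ℝ≥0∞) ≤ ENNReal.ofReal (7 * V.card / b ^ 2) := by
    refine le_trans ?_ ((ENNReal.sum_le_tsum I).trans h)
    apply Finset.sum_le_sum
    intro γ hγ
    rw [if_pos (hI γ hγ), mul_one]
  have h2 : ENNReal.ofReal (∑ γ ∈ I, (loopWeight γ : ℝ)) ≤ ENNReal.ofReal (7 * V.card / b ^ 2) := by
    rw [ENNReal.ofReal_sum_of_nonneg (f := fun γ => (loopWeight γ : ℝ))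
      (fun γ _ => (loopWeight γ).2)]
    refine le_trans (le_of_eq ?_) h1
    apply Finset.sum_congr rfl
    intro γ _
    simp
  exact (ENNReal.ofReal_le_ofReal_iff (by positivity)).1 h2




/-! ### Lower bounds for hitting probabilities in tubes -/

/-- A constant. -/
def Kc : ℝ := Real.cosh (12 * Real.pi)

theorem Kc_pos : 1 ≤ Kc := Real.one_le_cosh _

theorem sinh_lower (κ : ℝ) (hκ : 0 ≤ κ) (n : ℕ) : n * Real.sinh κ ≤ Real.sinh (n * κ) := by
  induction n with
  | zero => simp
  | succ n ih =>
    push_cast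
    rw [add_mul, one_mul, add_mul, one_mul, Real.sinh_add]
    have h1 := Real.one_le_cosh κ
    have h2 := Real.one_le_cosh (n * κ)
    have h3 := Real.sinh_nonneg_iff.2 hκ
    have h4 : 0 ≤ Real.sinh (n * κ) := Real.sinh_nonneg_iff.2 (by positivity)
    nlinarith

theorem sinh_upper (κ : ℝ) (hκ : 0 ≤ κ) (n : ℕ) :
    Real.sinh (n * κ) ≤ n * Real.sinh κ * Real.cosh (n * κ) := by
  induction n with
  | zero => simp
  | succ n ih =>
    push_cast
    have e : ((n : ℝ) + 1) * κ = n * κ + κ := by ring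
    rw [e]
    have h1 := Real.one_le_cosh κ
    have h2 := Real.one_le_cosh (n * κ)
    have h3 := Real.sinh_nonneg_iff.2 hκ
    have h4 : 0 ≤ Real.sinh (n * κ) := Real.sinh_nonneg_iff.2 (by positivity)
    have h5 : Real.cosh (n * κ) * Real.cosh κ ≤ Real.cosh (n * κ + κ) := by
      rw [Real.cosh_add]; nlinarith
    have h6 : Real.cosh (n * κ) ≤ Real.cosh (n * κ + κ) := by nlinarith
    rw [Real.sinh_add]
    calc Real.sinh (n * κ) * Real.cosh κ + Real.cosh (n * κ) * Real.sinh κ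
        ≤ (n * Real.sinh κ * Real.cosh (n * κ)) * Real.cosh κ +
          Real.cosh (n * κ + κ) * Real.sinh κ := by gcongr
      _ = n * Real.sinh κ * (Real.cosh (n * κ) * Real.cosh κ) +
          Real.cosh (n * κ + κ) * Real.sinh κ := by ring
      _ ≤ n * Real.sinh κ * Real.cosh (n * κ + κ) + Real.cosh (n * κ + κ) * Real.sinh κ := by
          gcongr
      _ = _ := by ring

theorem exists_kappa (w : ℕ) (hw : 0 < w) : ∃ κ : ℝ, 0 < κ ∧ κ * w ≤ Real.pi / 2 ∧
    Real.cosh κ + Real.cos (Real.pi / (2 * w)) = 2 := by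
  set θ := Real.pi / (2 * w) with hθ
  have hw' : (1 : ℝ) ≤ w := by exact_mod_cast hw
  have hθ0 : 0 < θ := by have := Real.pi_pos; positivity
  have hθ1 : θ ≤ Real.pi / 2 := by
    rw [hθ]
    apply div_le_div_of_nonneg_left Real.pi_pos.le (by norm_num)
    linarith
  have hc1 : Real.cos θ < 1 := by
    have := Real.cos_lt_cos_of_nonneg_of_le_pi_div_two (le_refl 0) hθ1 hθ0
    simpa using this
  have h0 : Real.cosh 0 ≤ 2 - Real.cos θ := by rw [Real.cosh_zero]; linarith
  have h1 : 2 - Real.cos θ ≤ Real.cosh θ := by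
    have h2 := Real.one_sub_sq_div_two_le_cos (x := θ)
    have h3 : 1 + θ ^ 2 / 2 ≤ Real.cosh θ := by
      have h4 := Real.cosh_two_mul (θ / 2)
      have h5 : θ / 2 ≤ Real.sinh (θ / 2) := Real.self_le_sinh_iff.2 (by positivity)
      have h6 := Real.cosh_sq (θ / 2)
      rw [show 2 * (θ / 2) = θ by ring] at h4
      nlinarith
    linarith
  obtain ⟨κ, hκ, hκ'⟩ := intermediate_value_Icc hθ0.le Real.continuous_cosh.continuousOn
    (⟨h0, h1⟩ : 2 - Real.cos θ ∈ Set.Icc (Real.cosh 0) (Real.cosh θ))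
  refine ⟨κ, ?_, ?_, by linarith⟩
  · rcases hκ.1.lt_or_eq with h | h
    · exact h
    · rw [← h, Real.cosh_zero] at hκ'; linarith
  · have : κ * w ≤ θ * w := by gcongr; exact hκ.2
    refine this.trans (le_of_eq ?_)
    rw [hθ]; field_simp

/-- Minimum principle in a rectangle. -/
theorem min_princ (D : ℤ → ℤ → ℝ) (N w : ℕ)
    (hsup : ∀ x y : ℤ, 0 < x → x < N → |y| < w →
      D (x + 1) y + D (x - 1) y + D x (y + 1) + D x (y - 1) ≤ 4 * D x y)
    (hb : ∀ x y : ℤ, 0 ≤ x → x ≤ N → |y| ≤ w → (x = 0 ∨ x = N ∧ |y| < w ∨ |y| = w ∧ x < N) → 0 ≤ D x y)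
    (x y : ℤ) (hx0 : 0 < x) (hxN : x < N) (hy : |y| < w) : 0 ≤ D x y := by
  by_contra hneg
  push Not at hneg
  set S : Finset (ℤ × ℤ) := (Finset.Ioo 0 (N : ℤ)) ×ˢ (Finset.Ioo (-(w : ℤ)) w) with hS
  have hmem : ∀ p : ℤ × ℤ, p ∈ S ↔ 0 < p.1 ∧ p.1 < N ∧ |p.2| < w := by
    intro p
    simp only [hS, Finset.mem_product, Finset.mem_Ioo, abs_lt]
    tauto
  have hne : S.Nonempty := ⟨(x, y), (hmem _).2 ⟨hx0, hxN, hy⟩⟩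
  obtain ⟨p, hp, hpmin⟩ := Finset.exists_min_image S (fun p => D p.1 p.2) hne
  have hpneg : D p.1 p.2 < 0 := (hpmin (x, y) ((hmem _).2 ⟨hx0, hxN, hy⟩)).trans_lt hneg
  set S' := S.filter (fun q => D q.1 q.2 ≤ D p.1 p.2) with hS'
  obtain ⟨q, hq, hqmax⟩ := Finset.exists_max_image S' (fun q => q.1)
    ⟨p, Finset.mem_filter.2 ⟨hp, le_rfl⟩⟩
  have hqS := (Finset.mem_filter.1 hq).1
  have hq2 := (Finset.mem_filter.1 hq).2
  obtain ⟨a1, a2, a3⟩ := (hmem q).1 hqS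
  have hge : ∀ x y : ℤ, 0 ≤ x → x ≤ N → |y| ≤ w → (x = N → |y| < w) → D p.1 p.2 ≤ D x y := by
    intro x y h1 h2 h3 h4
    by_cases hm : (x, y) ∈ S
    · exact hpmin _ hm
    · rw [hmem] at hm
      refine hpneg.le.trans (hb x y h1 h2 h3 ?_)
      by_cases hx : x = 0
      · exact Or.inl hx
      · by_cases hxN : x = N
        · exact Or.inr (Or.inl ⟨hxN, h4 hxN⟩)
        · right; right
          simp only at hm
          refine ⟨?_, by omega⟩
          by_contra hne
          exact hm ⟨by omega, by omega, by omega⟩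
  have a3' := abs_lt.1 a3
  have g1 := hge (q.1 + 1) q.2 (by omega) (by omega) (by omega) (fun _ => a3)
  have g2 := hge (q.1 - 1) q.2 (by omega) (by omega) (by omega) (fun _ => a3)
  have g3 := hge q.1 (q.2 + 1) (by omega) (by omega) (abs_le.2 ⟨by omega, by omega⟩) (fun h => by omega)
  have g4 := hge q.1 (q.2 - 1) (by omega) (by omega) (abs_le.2 ⟨by omega, by omega⟩) (fun h => by omega)
  have hs := hsup q.1 q.2 a1 a2 a3
  have hlast : D (q.1 + 1) q.2 ≤ D p.1 p.2 := by linarith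
  by_cases hN : q.1 + 1 = N
  · have := hb (q.1 + 1) q.2 (by omega) (by omega) a3.le (Or.inr (Or.inl ⟨hN, a3⟩))
    linarith
  · have hm : (q.1 + 1, q.2) ∈ S' := Finset.mem_filter.2 ⟨(hmem _).2 ⟨by simp; omega, by simp; omega, a3⟩, hlast⟩
    have := hqmax _ hm
    simp at this

theorem tube (m : ℤ → ℤ → ℝ) (hm0 : ∀ x y, 0 ≤ m x y) (N w : ℕ) (hw : 0 < w) (hN0 : 0 < N)
    (hN : N ≤ 24 * w)
    (c : ℝ) (hc : 0 ≤ c)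
    (hsup : ∀ x y : ℤ, 0 < x → x < N → |y| < w →
      m (x + 1) y + m (x - 1) y + m x (y + 1) + m x (y - 1) ≤ 4 * m x y)
    (hend : ∀ y : ℤ, |y| < w → c ≤ m N y) (n : ℕ) (hn0 : 0 < n) (hn : n < N) :
    c * (n / (N * Kc)) ≤ m n 0 := by
  obtain ⟨κ, hκ0, hκw, hκ⟩ := exists_kappa w hw
  set θ := Real.pi / (2 * w) with hθ
  have hw' : (0 : ℝ) < w := by exact_mod_cast hw
  have hN' : (0 : ℝ) < N := by exact_mod_cast hN0
  set s := Real.sinh (N * κ) with hs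
  have hs0 : 0 < s := Real.sinh_pos_iff.2 (by positivity)
  have hcos : ∀ y : ℤ, |y| ≤ w → 0 ≤ Real.cos (θ * y) := by
    intro y hy
    have h1 : |(y : ℝ)| ≤ w := by exact_mod_cast hy
    have h2 : |θ * y| ≤ Real.pi / 2 := by
      rw [abs_mul, abs_of_pos (by rw [hθ]; have := Real.pi_pos; positivity)]
      calc θ * |(y : ℝ)| ≤ θ * w := by
            gcongr
        _ = _ := by rw [hθ]; field_simp
    exact Real.cos_nonneg_of_mem_Icc (abs_le.1 h2)
  have key := min_princ (fun x y => m x y - c / s * (Real.sinh (κ * x) * Real.cos (θ * y))) N w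
    ?_ ?_ n 0 (by exact_mod_cast hn0) (by exact_mod_cast hn) (by simpa using hw)
  · simp only [Int.cast_natCast, Int.cast_zero, mul_zero, Real.cos_zero, mul_one] at key
    refine le_trans ?_ (sub_nonneg.1 key)
    rw [div_mul_eq_mul_div, mul_div_assoc]
    refine mul_le_mul_of_nonneg_left ?_ hc
    have hsh : 0 < Real.sinh κ := Real.sinh_pos_iff.2 hκ0
    have u1 := sinh_upper κ hκ0.le N
    have u2 := sinh_lower κ hκ0.le n
    have u3 : Real.cosh (N * κ) ≤ Kc := by
      unfold Kc
      rw [Real.cosh_le_cosh, abs_of_nonneg (by positivity),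
        abs_of_nonneg (by have := Real.pi_pos; positivity)]
      have : (N : ℝ) ≤ 24 * w := by exact_mod_cast hN
      calc (N : ℝ) * κ ≤ 24 * w * κ := by gcongr
        _ = 24 * (κ * w) := by ring
        _ ≤ _ := by linarith
    have hK := Kc_pos
    have u4 : s ≤ N * Real.sinh κ * Kc := u1.trans (by gcongr)
    rw [div_le_div_iff₀ (by positivity) hs0, mul_comm κ]
    calc (n : ℝ) * s ≤ n * (N * Real.sinh κ * Kc) := by gcongr
      _ = (n * Real.sinh κ) * (N * Kc) := by ring
      _ ≤ _ := by gcongr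
  · intro x y hx0 hxN hy
    have h := hsup x y hx0 hxN hy
    have e : (Real.sinh (κ * ((x + 1 : ℤ) : ℝ)) * Real.cos (θ * y) +
        Real.sinh (κ * ((x - 1 : ℤ) : ℝ)) * Real.cos (θ * y) +
        Real.sinh (κ * x) * Real.cos (θ * ((y + 1 : ℤ) : ℝ)) +
        Real.sinh (κ * x) * Real.cos (θ * ((y - 1 : ℤ) : ℝ))) =
        4 * (Real.sinh (κ * x) * Real.cos (θ * y)) := by
      push_cast
      rw [mul_add, mul_sub, mul_add, mul_sub, mul_one, mul_one, Real.sinh_add, Real.sinh_sub,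
        Real.cos_add, Real.cos_sub]
      linear_combination 2 * Real.sinh (κ * x) * Real.cos (θ * y) * hκ
    have e2 := congrArg (fun t => c / s * t) e
    linarith
  · intro x y hx0 hxN hy hb
    rcases hb with rfl | ⟨rfl, hy'⟩ | ⟨hy', hx'⟩
    · simpa using hm0 0 y
    · have h1 := hend y hy'
      have h2 : c / s * (Real.sinh (κ * (N : ℤ)) * Real.cos (θ * y)) ≤ c := by
        rw [Int.cast_natCast, mul_comm κ, ← hs]
        calc c / s * (s * Real.cos (θ * y)) = c * Real.cos (θ * y) := by field_simp
          _ ≤ c * 1 := by gcongr; exact Real.cos_le_one _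
          _ = c := mul_one c
      linarith
    · have : Real.cos (θ * y) = 0 := by
        have hy2 : |(y : ℝ)| = w := by exact_mod_cast hy'
        have hθw : θ * w = Real.pi / 2 := by rw [hθ]; field_simp
        rcases abs_choice (y : ℝ) with h | h
        · rw [h] at hy2; rw [hy2, hθw, Real.cos_pi_div_two]
        · rw [h] at hy2
          have : (y : ℝ) = -w := by linarith
          rw [this, mul_neg, Real.cos_neg, hθw, Real.cos_pi_div_two]
      rw [this]
      simpa using hm0 x y




/-! ### Arcs around a cell -/

/-- Paths through `Rg` stopped upon hitting `Tg`. -/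
def okA (Rg Tg : Lat → Prop) : List Lat → Prop
  | [] => False
  | [x] => Tg x
  | x :: y :: l => Rg x ∧ Adj x y ∧ okA Rg Tg (y :: l)

/-- Finite sets of such paths. -/
def arcsF (Rg Tg : Lat → Prop) : ℕ → Lat → Finset (List Lat)
  | 0, x => if Tg x then {[x]} else ∅
  | n + 1, x => if Tg x then {[x]} else if Rg x then
      (nb x).biUnion (fun y => (arcsF Rg Tg n y).image (List.cons x)) else ∅

theorem arcsF_ok (Rg Tg : Lat → Prop) (n : ℕ) (x : Lat) (l : List Lat)
    (h : l ∈ arcsF Rg Tg n x) : okA Rg Tg l ∧ l.head? = some x := by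
  induction n generalizing x l with
  | zero =>
    unfold arcsF at h
    split_ifs at h with h1
    · rw [Finset.mem_singleton] at h; subst h; exact ⟨h1, rfl⟩
    · simp at h
  | succ n ih =>
    unfold arcsF at h
    split_ifs at h with h1 h2
    · rw [Finset.mem_singleton] at h; subst h; exact ⟨h1, rfl⟩
    · simp only [Finset.mem_biUnion, Finset.mem_image] at h
      obtain ⟨y, hy, l', hl', rfl⟩ := h
      obtain ⟨a, b⟩ := ih y l' hl'
      match l', a, b with
      | z :: t, a, b =>
        simp only [List.head?_cons, Option.some.injEq] at b
        subst b
        exact ⟨⟨h2, (Adj_iff _ _).2 hy, a⟩, rfl⟩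
    · simp at h

/-- Mass of the arcs. -/
def gA (Rg Tg : Lat → Prop) (n : ℕ) (x : Lat) : ℝ := ∑ l ∈ arcsF Rg Tg n x, (1 / 4 : ℝ) ^ steps l

theorem gA_tg (Rg Tg : Lat → Prop) (n : ℕ) (x : Lat) (h : Tg x) : gA Rg Tg n x = 1 := by
  cases n <;> simp [gA, arcsF, h, steps]

theorem gA_succ (Rg Tg : Lat → Prop) (n : ℕ) (x : Lat) (h : ¬ Tg x) (h2 : Rg x) :
    gA Rg Tg (n + 1) x = (∑ y ∈ nb x, gA Rg Tg n y) / 4 := by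
  unfold gA
  rw [arcsF]
  simp only [if_neg h, if_pos h2]
  rw [Finset.sum_biUnion]
  · rw [Finset.sum_div]
    refine Finset.sum_congr rfl fun y _ => ?_
    rw [Finset.sum_image (fun a _ b _ hab => (List.cons.inj hab).2), Finset.sum_div]
    refine Finset.sum_congr rfl fun l hl => ?_
    obtain ⟨-, b⟩ := arcsF_ok Rg Tg n y l hl
    match l, b with
    | z :: t, _ =>
      simp only [steps, List.length_cons, Nat.add_sub_cancel]
      rw [pow_succ]; ring
  · intro y _ y' _ hne
    rw [Function.onFun, Finset.disjoint_left]
    intro l hl hl'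
    simp only [Finset.mem_image] at hl hl'
    obtain ⟨a, ha, rfl⟩ := hl
    obtain ⟨b, hb, hab⟩ := hl'
    have := (List.cons.inj hab).2
    subst this
    have h1 := (arcsF_ok Rg Tg n y b ha).2
    have h2 := (arcsF_ok Rg Tg n y' b hb).2
    rw [h1] at h2
    exact hne (Option.some.inj h2)

theorem gA_nonneg (Rg Tg : Lat → Prop) (n : ℕ) (x : Lat) : 0 ≤ gA Rg Tg n x :=
  Finset.sum_nonneg fun _ _ => by positivity

theorem gA_zero (Rg Tg : Lat → Prop) (n : ℕ) (x : Lat) (h : ¬ Tg x) (h2 : ¬ Rg x) :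
    gA Rg Tg n x = 0 := by
  cases n <;> simp [gA, arcsF, h, h2]

theorem gA_zero' (Rg Tg : Lat → Prop) (x : Lat) (h : ¬ Tg x) : gA Rg Tg 0 x = 0 := by
  simp [gA, arcsF, h]

theorem gA_mono_le (Rg Tg : Lat → Prop) (n : ℕ) (x : Lat) :
    gA Rg Tg n x ≤ gA Rg Tg (n + 1) x ∧ gA Rg Tg n x ≤ 1 := by
  induction n generalizing x with
  | zero =>
    by_cases h : Tg x
    · simp [gA_tg _ _ _ _ h]
    · rw [gA_zero' _ _ _ h]
      exact ⟨gA_nonneg _ _ _ _, zero_le_one⟩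
  | succ n ih =>
    by_cases h : Tg x
    · simp [gA_tg _ _ _ _ h]
    by_cases h2 : Rg x
    · rw [gA_succ _ _ _ _ h h2, gA_succ _ _ _ _ h h2]
      refine ⟨?_, ?_⟩
      · have := Finset.sum_le_sum fun y (_ : y ∈ nb x) => (ih y).1
        linarith
      · rw [sum_nb]
        have a1 := (ih (x.1 + 1, x.2)).2
        have a2 := (ih (x.1 - 1, x.2)).2
        have a3 := (ih (x.1, x.2 + 1)).2
        have a4 := (ih (x.1, x.2 - 1)).2
        linarith
    · simp [gA_zero _ _ _ _ h h2]

/-- Limiting mass of the arcs. -/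
def gInf (Rg Tg : Lat → Prop) (x : Lat) : ℝ := ⨆ n, gA Rg Tg n x

theorem gInf_tendsto (Rg Tg : Lat → Prop) (x : Lat) :
    Filter.Tendsto (fun n => gA Rg Tg n x) Filter.atTop (nhds (gInf Rg Tg x)) :=
  tendsto_atTop_ciSup (monotone_nat_of_le_succ fun n => (gA_mono_le Rg Tg n x).1)
    ⟨1, by rintro _ ⟨n, rfl⟩; exact (gA_mono_le Rg Tg n x).2⟩

theorem gInf_nonneg (Rg Tg : Lat → Prop) (x : Lat) : 0 ≤ gInf Rg Tg x :=
  ge_of_tendsto' (gInf_tendsto Rg Tg x) fun n => gA_nonneg _ _ _ _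

theorem gInf_tg (Rg Tg : Lat → Prop) (x : Lat) (h : Tg x) : gInf Rg Tg x = 1 :=
  tendsto_nhds_unique (gInf_tendsto Rg Tg x) (by simp [gA_tg _ _ _ _ h])

theorem gInf_rg (Rg Tg : Lat → Prop) (x : Lat) (h : ¬ Tg x) (h2 : Rg x) :
    4 * gInf Rg Tg x = ∑ y ∈ nb x, gInf Rg Tg y := by
  have h1 : Filter.Tendsto (fun n => 4 * gA Rg Tg (n + 1) x) Filter.atTop
      (nhds (4 * gInf Rg Tg x)) :=
    ((gInf_tendsto Rg Tg x).comp (Filter.tendsto_add_atTop_nat 1)).const_mul 4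
  have h3 : Filter.Tendsto (fun n => ∑ y ∈ nb x, gA Rg Tg n y) Filter.atTop
      (nhds (∑ y ∈ nb x, gInf Rg Tg y)) :=
    tendsto_finsetSum _ fun y _ => gInf_tendsto Rg Tg y
  refine tendsto_nhds_unique h1 (h3.congr fun n => ?_)
  rw [gA_succ _ _ _ _ h h2]; ring

/-- The region used by the arcs around the cell of size `ℓ` at height `a`. -/
def Rgn (ℓ a : ℤ) (v : Lat) : Prop :=
  0 < v.1 ∧ v.1 < 8 * ℓ ∧ |v.2 - a| ≤ 20 * ℓ ∧ ¬ (v.1 < 4 * ℓ ∧ a ≤ v.2 ∧ v.2 < a + 3 * ℓ)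

/-- The target of the arcs. -/
def Tgt (ℓ a : ℤ) (v : Lat) : Prop := v.1 = 0 ∧ a + 3 * ℓ ≤ v.2 ∧ v.2 ≤ a + 20 * ℓ

theorem gI_sup (ℓ a : ℤ) (v : Lat) (h : Rgn ℓ a v) :
    gInf (Rgn ℓ a) (Tgt ℓ a) (v.1 + 1, v.2) + gInf (Rgn ℓ a) (Tgt ℓ a) (v.1 - 1, v.2) +
      gInf (Rgn ℓ a) (Tgt ℓ a) (v.1, v.2 + 1) + gInf (Rgn ℓ a) (Tgt ℓ a) (v.1, v.2 - 1) =
      4 * gInf (Rgn ℓ a) (Tgt ℓ a) v := by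
  rw [gInf_rg _ _ v (fun ht => by have := h.1; have := ht.1; omega) h, sum_nb]
  ring

theorem gI_T3 (ℓ : ℕ) (hl : 0 < ℓ) (a : ℤ) (x y : ℤ) (hx : 5 * (ℓ : ℤ) < x) (hx2 : x < 7 * ℓ)
    (hy : a + 5 * ℓ < y) (hy2 : y < a + 8 * ℓ) :
    1 / (8 * Kc) ≤ gInf (Rgn ℓ a) (Tgt ℓ a) (x, y) := by
  obtain ⟨n, hn⟩ : ∃ n : ℕ, (n : ℤ) = 8 * ℓ - x := ⟨(8 * ℓ - x).toNat, by omega⟩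
  have h := tube (fun s t => gInf (Rgn ℓ a) (Tgt ℓ a) (8 * ℓ - s, y + t))
    (fun _ _ => gInf_nonneg _ _ _) (8 * ℓ) ℓ hl (by omega) (by omega) 1 zero_le_one ?_ ?_ n
    (by omega) (by omega)
  · have hK := Kc_pos
    have e : ((8 : ℤ) * ℓ - n, y + 0) = (x, y) := by ext <;> simp; omega
    simp only [e] at h
    refine le_trans ?_ h
    have hn' : (ℓ : ℝ) ≤ n := by exact_mod_cast (by omega : ℓ ≤ n)
    have hl' : (0 : ℝ) < ℓ := by exact_mod_cast hl
    push_cast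
    rw [one_mul, div_le_div_iff₀ (by positivity) (by positivity)]
    nlinarith
  · intro s t hs hs2 ht
    rw [abs_lt] at ht
    push_cast at hs2
    have := gI_sup ℓ a (8 * ℓ - s, y + t) ⟨by simp; omega, by simp; omega,
      by simp only [abs_le]; constructor <;> omega, by simp only; omega⟩
    rw [← this]
    apply le_of_eq
    rw [show (8 : ℤ) * ℓ - (s + 1) = 8 * ℓ - s - 1 by ring,
      show (8 : ℤ) * ℓ - (s - 1) = 8 * ℓ - s + 1 by ring,
      show y + (t + 1) = y + t + 1 by ring, show y + (t - 1) = y + t - 1 by ring]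
    ring
  · intro t ht
    rw [abs_lt] at ht
    rw [gInf_tg]
    refine ⟨by simp, ?_, ?_⟩ <;> simp only <;> omega

theorem gI_T2 (ℓ : ℕ) (hl : 0 < ℓ) (a : ℤ) (y : ℤ)
    (hy : a - 5 * ℓ < y) (hy2 : y < a - 2 * ℓ) :
    1 / (16 * Kc ^ 2) ≤ gInf (Rgn ℓ a) (Tgt ℓ a) (6 * ℓ, y) := by
  have hK := Kc_pos
  have h := tube (fun s t => gInf (Rgn ℓ a) (Tgt ℓ a) (6 * ℓ + t, y - 10 * ℓ + s))
    (fun _ _ => gInf_nonneg _ _ _) (20 * ℓ) ℓ hl (by omega) (by omega) (1 / (8 * Kc))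
    (by positivity) ?_ ?_ (10 * ℓ) (by omega) (by omega)
  · have e : ((6 : ℤ) * ℓ + 0, y - 10 * ℓ + ((10 * ℓ : ℕ) : ℤ)) = (6 * (ℓ : ℤ), y) := by
      ext <;> simp
    simp only [e] at h
    refine le_trans (le_of_eq ?_) h
    have hl' : (0 : ℝ) < ℓ := by exact_mod_cast hl
    push_cast
    field_simp
    norm_num
  · intro s t hs hs2 ht
    rw [abs_lt] at ht
    push_cast at hs2
    have := gI_sup ℓ a (6 * ℓ + t, y - 10 * ℓ + s) ⟨by simp; omega, by simp; omega,
      by simp only [abs_le]; constructor <;> omega, by simp only; omega⟩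
    rw [← this]
    apply le_of_eq
    rw [show (6 : ℤ) * ℓ + (t + 1) = 6 * ℓ + t + 1 by ring,
      show (6 : ℤ) * ℓ + (t - 1) = 6 * ℓ + t - 1 by ring,
      show y - 10 * ℓ + (s + 1) = y - 10 * ℓ + s + 1 by ring,
      show y - 10 * ℓ + (s - 1) = y - 10 * ℓ + s - 1 by ring]
    ring
  · intro t ht
    rw [abs_lt] at ht
    apply gI_T3 ℓ hl a <;> push_cast <;> omega

theorem gI_T1 (ℓ : ℕ) (hl : 0 < ℓ) (a : ℤ) (y : ℤ)
    (hy : a - 4 * ℓ ≤ y) (hy2 : y < a - 3 * ℓ) :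
    1 / (96 * Kc ^ 3 * ℓ) ≤ gInf (Rgn ℓ a) (Tgt ℓ a) (1, y) := by
  have hK := Kc_pos
  have h := tube (fun s t => gInf (Rgn ℓ a) (Tgt ℓ a) (s, y + t))
    (fun _ _ => gInf_nonneg _ _ _) (6 * ℓ) ℓ hl (by omega) (by omega) (1 / (16 * Kc ^ 2))
    (by positivity) ?_ ?_ 1 (by omega) (by omega)
  · simp only [Nat.cast_one, add_zero] at h
    refine le_trans (le_of_eq ?_) h
    have hl' : (0 : ℝ) < ℓ := by exact_mod_cast hl
    push_cast
    field_simp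
    norm_num
  · intro s t hs hs2 ht
    rw [abs_lt] at ht
    push_cast at hs2
    have := gI_sup ℓ a (s, y + t) ⟨by simp; omega, by simp; omega,
      by simp only [abs_le]; constructor <;> omega, by simp only; omega⟩
    rw [← this]
    apply le_of_eq
    rw [show y + (t + 1) = y + t + 1 by ring,
      show y + (t - 1) = y + t - 1 by ring]
  · intro t ht
    rw [abs_lt] at ht
    push_cast
    apply gI_T2 ℓ hl a <;> omega

/-- An arc around the cell. -/
def isArcQ (ℓ a : ℤ) (Q : List Lat) : Prop :=
  ∃ y l, Q = (0, y) :: l ∧ a - 4 * ℓ ≤ y ∧ y < a - 3 * ℓ ∧ okA (Rgn ℓ a) (Tgt ℓ a) l ∧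
    l.head? = some (1, y)

/-- A constant. -/
def c2 : ℝ := 1 / (768 * Kc ^ 3)

theorem c2_pos : 0 < c2 := by have := Kc_pos; unfold c2; positivity

theorem arcs_exist (ℓ : ℕ) (hl : 0 < ℓ) (a : ℤ) : ∃ S : Finset (List Lat),
    (∀ Q ∈ S, isArcQ ℓ a Q) ∧ c2 ≤ ∑ Q ∈ S, (1 / 4 : ℝ) ^ steps Q := by
  have hK := Kc_pos
  have hl' : (0 : ℝ) < ℓ := by exact_mod_cast hl
  set I : Finset ℤ := Finset.Ico (a - 4 * ℓ) (a - 3 * ℓ) with hI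
  have hcard : I.card = ℓ := by rw [hI, Int.card_Ico]; omega
  have ht : Filter.Tendsto (fun n => ∑ y ∈ I, gA (Rgn ℓ a) (Tgt ℓ a) n (1, y)) Filter.atTop
      (nhds (∑ y ∈ I, gInf (Rgn ℓ a) (Tgt ℓ a) (1, y))) :=
    tendsto_finsetSum _ fun y _ => gInf_tendsto _ _ _
  have hge : 8 * c2 ≤ ∑ y ∈ I, gInf (Rgn ℓ a) (Tgt ℓ a) (1, y) := by
    calc 8 * c2 = I.card • (1 / (96 * Kc ^ 3 * ℓ)) := by
          rw [hcard, c2, nsmul_eq_mul]; field_simp; norm_num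
      _ ≤ _ := Finset.card_nsmul_le_sum _ _ _ fun y hy => by
          rw [hI, Finset.mem_Ico] at hy
          exact gI_T1 ℓ hl a y hy.1 hy.2
  have hlt : 4 * c2 < ∑ y ∈ I, gInf (Rgn ℓ a) (Tgt ℓ a) (1, y) := by
    have := c2_pos; linarith
  obtain ⟨n, hn⟩ := (ht.eventually (lt_mem_nhds hlt)).exists
  refine ⟨I.biUnion fun y => (arcsF (Rgn ℓ a) (Tgt ℓ a) n (1, y)).image (List.cons (0, y)), ?_, ?_⟩
  · intro Q hQ
    simp only [Finset.mem_biUnion, Finset.mem_image] at hQ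
    obtain ⟨y, hy, l, hll, rfl⟩ := hQ
    rw [hI, Finset.mem_Ico] at hy
    obtain ⟨h1, h2⟩ := arcsF_ok _ _ _ _ _ hll
    exact ⟨y, l, rfl, hy.1, hy.2, h1, h2⟩
  · rw [Finset.sum_biUnion]
    · have : ∑ y ∈ I, gA (Rgn ℓ a) (Tgt ℓ a) n (1, y) / 4 ≤ ∑ y ∈ I, ∑ Q ∈
          (arcsF (Rgn ℓ a) (Tgt ℓ a) n (1, y)).image (List.cons (0, y)), (1 / 4 : ℝ) ^ steps Q := by
        refine Finset.sum_le_sum fun y _ => le_of_eq ?_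
        rw [Finset.sum_image (fun a _ b _ hab => (List.cons.inj hab).2), gA, Finset.sum_div]
        refine Finset.sum_congr rfl fun l hl => ?_
        obtain ⟨-, b⟩ := arcsF_ok _ _ n _ l hl
        match l, b with
        | z :: t, _ =>
          simp only [steps, List.length_cons, Nat.add_sub_cancel]
          rw [pow_succ]; ring
      rw [← Finset.sum_div] at this
      linarith
    · intro y _ y' _ hne
      rw [Function.onFun, Finset.disjoint_left]
      intro l hl hl'
      simp only [Finset.mem_image] at hl hl'
      obtain ⟨a, ha, rfl⟩ := hl
      obtain ⟨b, hb, hab⟩ := hl'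
      have := (List.cons.inj hab).1
      rw [Prod.mk.injEq] at this
      exact hne this.2.symm




/-! ### Topology of the arcs -/

theorem Adj_cases {p q : Lat} (h : Adj p q) :
    (q.1 = p.1 + 1 ∧ q.2 = p.2) ∨ (q.1 = p.1 - 1 ∧ q.2 = p.2) ∨ (q.1 = p.1 ∧ q.2 = p.2 + 1) ∨
      (q.1 = p.1 ∧ q.2 = p.2 - 1) := by
  rw [Adj_iff] at h
  simp only [nb, Finset.mem_insert, Finset.mem_singleton, Prod.ext_iff] at h
  exact h

/-- Indicator that the step from `p` to `q` crosses the ray issued from `v`. -/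
def eC (v p q : Lat) : ZMod 2 :=
  if ((p.1 = v.1 - 1 ∧ q.1 = v.1) ∨ (p.1 = v.1 ∧ q.1 = v.1 - 1)) ∧ p.2 ≤ v.2 then 1 else 0

/-- Parity of the number of crossings. -/
def crC (v : Lat) : List Lat → ZMod 2
  | [] => 0
  | [_] => 0
  | p :: q :: l => eC v p q + crC v (q :: l)

theorem crC_vert (v v' : Lat) (h1 : v'.1 = v.1) (h2 : v'.2 = v.2 + 1) (Q : List Lat)
    (hQ : Q.IsChain Adj) (hv : v' ∉ Q) : crC v Q = crC v' Q := by
  match Q, hQ, hv with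
  | [], _, _ => rfl
  | [_], _, _ => rfl
  | p :: q :: l, hQ, hv =>
    rw [List.isChain_cons_cons] at hQ
    simp only [List.mem_cons, not_or] at hv
    rw [crC, crC, crC_vert v v' h1 h2 (q :: l) hQ.2 (by simp only [List.mem_cons, not_or]; exact hv.2)]
    congr 1
    have hp := hv.1
    have hq := hv.2.1
    rw [Prod.ext_iff] at hp hq
    unfold eC
    rcases Adj_cases hQ.1 with h | h | h | h <;> split_ifs <;> first | rfl | (exfalso; omega)

/-- Indicator of the ray below `v`. -/
def sC (v p : Lat) : ZMod 2 := if p.1 = v.1 ∧ p.2 ≤ v.2 then 1 else 0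

theorem crC_horiz (v v' : Lat) (h1 : v'.1 = v.1 + 1) (h2 : v'.2 = v.2) (p : Lat) (l : List Lat)
    (hQ : (p :: l).IsChain Adj) (hv : v ∉ p :: l) :
    crC v (p :: l) + crC v' (p :: l) = sC v p + sC v ((p :: l).getLast (by simp)) := by
  induction l generalizing p with
  | nil =>
    simp only [crC, List.getLast_singleton]
    unfold sC
    split_ifs <;> decide
  | cons q l ih =>
    rw [List.isChain_cons_cons] at hQ
    simp only [List.mem_cons, not_or] at hv
    have := ih q hQ.2 (by simp only [List.mem_cons, not_or]; exact hv.2)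
    rw [crC, crC, List.getLast_cons (by simp)]
    have hp := hv.1
    have hq := hv.2.1
    rw [Prod.ext_iff] at hp hq
    have key : eC v p q + eC v' p q = sC v p + sC v q := by
      unfold eC sC
      rcases Adj_cases hQ.1 with h | h | h | h <;> split_ifs <;> first | decide | (exfalso; omega)
    have h2 : ∀ a : ZMod 2, a + a = 0 := by decide
    linear_combination key + this + h2 (sC v q)

theorem okA_chain {Rg Tg : Lat → Prop} {l : List Lat} (h : okA Rg Tg l) : l.IsChain Adj := by
  match l, h with
  | [x], _ => simp
  | x :: y :: t, h => exact List.isChain_cons_cons.2 ⟨h.2.1, okA_chain h.2.2⟩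

theorem okA_mem {Rg Tg : Lat → Prop} {l : List Lat} (h : okA Rg Tg l) : ∀ v ∈ l, Rg v ∨ Tg v := by
  match l, h with
  | [x], h => intro v hv; rw [List.mem_singleton] at hv; subst hv; exact Or.inr h
  | x :: y :: t, h =>
    intro v hv
    rcases List.mem_cons.1 hv with rfl | hv
    · exact Or.inl h.1
    · exact okA_mem h.2.2 v hv

theorem okA_last {Rg Tg : Lat → Prop} {l : List Lat} (h : okA Rg Tg l) (hl : l ≠ []) :
    Tg (l.getLast hl) := by
  match l, h with
  | [x], h => exact h
  | x :: y :: t, h =>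
    rw [List.getLast_cons (by simp)]
    exact okA_last h.2.2 _

theorem okA_bex {Rg Tg : Lat → Prop} {l : List Lat} (h : okA Rg Tg l) (hl : 2 ≤ l.length)
    (f : Lat → Lat) (V C : Finset Lat) (hV : ∀ x ∈ l, Rg x → f x ∈ V)
    (hC : ∀ x ∈ l, Tg x → f x ∈ C) : bex V C (l.map f) := by
  match l, h, hl with
  | [x, y], h, _ => exact ⟨hV _ (by simp) h.1, hC _ (by simp) h.2.2⟩
  | x :: y :: z :: t, h, _ =>
    exact ⟨hV _ (by simp) h.1, okA_bex h.2.2 (by simp) f V C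
      (fun x hx => hV x (List.mem_cons_of_mem _ hx)) (fun x hx => hC x (List.mem_cons_of_mem _ hx))⟩

theorem isArcQ_chain {ℓ a : ℤ} {Q : List Lat} (h : isArcQ ℓ a Q) : Q.IsChain Adj := by
  obtain ⟨y, l, rfl, -, -, h1, h2⟩ := h
  match l, h1, h2 with
  | z :: t, h1, h2 =>
    simp only [List.head?_cons, Option.some.injEq] at h2
    subst h2
    exact List.isChain_cons_cons.2 ⟨by simp [Adj], okA_chain h1⟩

theorem isArcQ_mem {ℓ a : ℤ} {Q : List Lat} (h : isArcQ ℓ a Q) (hl : 0 < ℓ) :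
    ∀ v ∈ Q, Rgn ℓ a v ∨ (v.1 = 0 ∧ |v.2 - a| ≤ 20 * ℓ) := by
  obtain ⟨y, l, rfl, h3, h4, h1, h2⟩ := h
  intro v hv
  rcases List.mem_cons.1 hv with rfl | hv
  · right
    simp only [abs_le]
    exact ⟨trivial, by omega, by omega⟩
  · rcases okA_mem h1 v hv with h | h
    · exact Or.inl h
    · right
      rw [abs_le]
      exact ⟨h.1, by have := h.2.1; omega, by have := h.2.2; omega⟩

theorem okA_high {ℓ a : ℤ} (hl : 0 < ℓ) {l : List Lat} (h : okA (Rgn ℓ a) (Tgt ℓ a) l) (x : Lat)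
    (hx : l.head? = some x) (hxa : x.2 < a) : ∃ v ∈ l, 4 * ℓ ≤ v.1 := by
  match l, h, hx with
  | [z], h, hx =>
    simp only [List.head?_cons, Option.some.injEq] at hx
    subst hx
    have := h.2.1
    omega
  | z :: y :: t, h, hx =>
    simp only [List.head?_cons, Option.some.injEq] at hx
    subst hx
    by_cases hy : y.2 < a
    · obtain ⟨v, hv, hv2⟩ := okA_high hl h.2.2 y rfl hy
      exact ⟨v, List.mem_cons_of_mem _ hv, hv2⟩
    · have hy2 : y.2 = a := by rcases Adj_cases h.2.1 with h | h | h | h <;> omega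
      refine ⟨y, by simp, ?_⟩
      rcases okA_mem h.2.2 y (by simp) with h' | h'
      · have := h'.2.2.2
        omega
      · have := h'.2.1
        omega

theorem isArcQ_unique {k k' : ℕ} {j j' : ℤ} {Q : List Lat}
    (h : isArcQ ((2 ^ k : ℕ) : ℤ) (j * (2 ^ k : ℕ)) Q)
    (h' : isArcQ ((2 ^ k' : ℕ) : ℤ) (j' * (2 ^ k' : ℕ)) Q) : k = k' ∧ j = j' := by
  have aux : ∀ (k k' : ℕ) (j j' : ℤ), isArcQ ((2 ^ k : ℕ) : ℤ) (j * (2 ^ k : ℕ)) Q →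
      isArcQ ((2 ^ k' : ℕ) : ℤ) (j' * (2 ^ k' : ℕ)) Q → ¬ k < k' := by
    intro k k' j j' h h' hk
    have h0 := isArcQ_mem h (by positivity)
    have hp : (0 : ℤ) < ((2 ^ k : ℕ) : ℤ) := by positivity
    have hle : 2 * ((2 ^ k : ℕ) : ℤ) ≤ ((2 ^ k' : ℕ) : ℤ) := by
      have : 2 ^ (k + 1) ≤ 2 ^ k' := Nat.pow_le_pow_right (by norm_num) hk
      rw [pow_succ] at this
      omega
    obtain ⟨y, l, rfl, h3, h4, h1, h2⟩ := h'
    obtain ⟨v, hv, hv2⟩ := okA_high (by positivity) h1 _ h2 (by simp only; omega)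
    rcases h0 v (List.mem_cons_of_mem _ hv) with h5 | h5
    · have := h5.2.1
      omega
    · have := h5.1
      omega
  have hk : k = k' := le_antisymm (not_lt.1 (aux k' k j' j h' h)) (not_lt.1 (aux k k' j j' h h'))
  subst hk
  refine ⟨rfl, ?_⟩
  obtain ⟨y, l, rfl, h3, h4, -, -⟩ := h
  obtain ⟨y', l', he, h3', h4', -, -⟩ := h'
  have : y = y' := by
    have := (List.cons.inj he).1
    rw [Prod.mk.injEq] at this
    exact this.2
  subst this
  have hp : (0 : ℤ) < ((2 ^ k : ℕ) : ℤ) := by positivity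
  set ℓ : ℤ := ((2 ^ k : ℕ) : ℤ)
  rcases lt_trichotomy j j' with hj | hj | hj
  · nlinarith
  · exact hj
  · nlinarith

theorem crC_inv {ℓ a : ℤ} {Q : List Lat} (h : isArcQ ℓ a Q) {v v' : Lat} (hadj : Adj v v')
    (hv : 0 < v.1) (hv' : 0 < v'.1) (hq : v ∉ Q) (hq' : v' ∉ Q) : crC v Q = crC v' Q := by
  have hch := isArcQ_chain h
  have z : ∀ a b : ZMod 2, a + b = 0 → a = b := by decide
  have hz : ∀ v v' : Lat, v'.1 = v.1 + 1 → v'.2 = v.2 → 0 < v.1 → v ∉ Q → crC v Q = crC v' Q := by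
    intro v v' h1 h2 h3 h4
    apply z
    obtain ⟨y, l, rfl, -, -, h5, h6⟩ := h
    have hl : l ≠ [] := by rintro rfl; simp at h6
    rw [crC_horiz v v' h1 h2 _ _ hch h4, List.getLast_cons hl]
    have h7 := (okA_last h5 hl).1
    unfold sC
    rw [if_neg (by simp; omega), if_neg (by omega), add_zero]
  rcases Adj_cases hadj with h | h | h | h
  · exact hz _ _ h.1 h.2 hv hq
  · exact (hz _ _ (by omega) (by omega) hv' hq').symm
  · exact crC_vert v v' h.1 h.2 Q hch hq'
  · exact (crC_vert v' v h.1.symm (by omega) Q hch hq).symm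

theorem crC_far {ℓ a : ℤ} {Q : List Lat} (hl : 0 < ℓ) (h : isArcQ ℓ a Q) (v : Lat)
    (hv : 8 * ℓ ≤ v.1) : crC v Q = 0 := by
  have h0 : ∀ w ∈ Q, w.1 < 8 * ℓ := by
    intro w hw
    rcases isArcQ_mem h hl w hw with h5 | h5
    · exact h5.2.1
    · have := h5.1; omega
  clear h
  match Q, h0 with
  | [], _ => rfl
  | [_], _ => rfl
  | p :: q :: l, h0 =>
    have aux : ∀ l : List Lat, (∀ w ∈ l, w.1 < 8 * ℓ) → crC v l = 0 := by
      intro l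
      induction l with
      | nil => intro _; rfl
      | cons p l ih =>
        intro h
        match l, ih, h with
        | [], _, _ => rfl
        | q :: t, ih, h =>
          rw [crC, ih (fun w hw => h w (List.mem_cons_of_mem _ hw)), add_zero, eC, if_neg]
          have := h p (by simp)
          have := h q (by simp)
          omega
    exact aux _ h0

theorem crC_zone {ℓ a : ℤ} {Q : List Lat} (hl : 0 < ℓ) (h : isArcQ ℓ a Q) (v : Lat)
    (hv0 : 0 < v.1) (hv : v.1 < 4 * ℓ) (hy : a ≤ v.2) (hy2 : v.2 < a + 3 * ℓ) :
    v ∉ Q ∧ crC v Q = 1 := by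
  have hnot : ∀ v : Lat, 0 < v.1 → v.1 < 4 * ℓ → a ≤ v.2 → v.2 < a + 3 * ℓ → v ∉ Q := by
    intro v h1 h2 h3 h4 h5
    rcases isArcQ_mem h hl v h5 with h6 | h6
    · have := h6.2.2.2
      omega
    · have := h6.1
      omega
  refine ⟨hnot v hv0 hv hy hy2, ?_⟩
  obtain ⟨n, hn⟩ : ∃ n : ℕ, v.1 = n + 1 := ⟨(v.1 - 1).toNat, by omega⟩
  induction n generalizing v with
  | zero =>
    obtain ⟨y, l, rfl, h3, h4, h1, h2⟩ := h
    have hl0 : crC v l = 0 := by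
      clear h2 hnot
      induction l with
      | nil => rfl
      | cons p l ih =>
        match l, ih, h1 with
        | [], _, _ => rfl
        | q :: t, ih, h1 =>
          rw [crC, ih h1.2.2, add_zero, eC, if_neg]
          have hp := h1.1.1
          rcases okA_mem h1.2.2 q (by simp) with hq | hq
          · have := hq.1; omega
          · have := hq.1; have := hq.2.1
            rcases Adj_cases h1.2.1 with h | h | h | h <;> omega
    match l, h2, hl0 with
    | z :: t, h2, hl0 =>
      simp only [List.head?_cons, Option.some.injEq] at h2
      subst h2
      rw [crC, hl0, add_zero, eC, if_pos]
      constructor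
      · left; simp; omega
      · simp only; omega
  | succ n ih =>
    rw [← ih (n + 1, v.2) (by simp) (by simp; push_cast at hn; omega) hy hy2 rfl]
    refine (crC_inv h (v := (n + 1, v.2)) ?_ ?_ hv0 ?_ ?_).symm
    · simp only [Adj, hn]; push_cast; ring
    · simp only; omega
    · exact hnot _ (by simp) (by simp; push_cast at hn; omega) hy hy2
    · exact hnot _ hv0 hv hy hy2

theorem arc_hit {ℓ a : ℤ} {Q : List Lat} (hl : 0 < ℓ) (h : isArcQ ℓ a Q) {r : Lat → Lat → Prop}
    (hr : ∀ x y, r x y → Adj x y ∧ 0 < x.1 ∧ 0 < y.1) {v v' : Lat}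
    (hv0 : 0 < v.1) (hv : v.1 < 4 * ℓ) (hy : a ≤ v.2) (hy2 : v.2 < a + 3 * ℓ)
    (hv' : 8 * ℓ ≤ v'.1) (hvv : Relation.ReflTransGen r v v') :
    ∃ q ∈ Q, Relation.ReflTransGen r v q := by
  by_contra hcon
  push Not at hcon
  obtain ⟨z1, z2⟩ := crC_zone hl h v hv0 hv hy hy2
  have : ∀ w, Relation.ReflTransGen r v w → crC w Q = 1 := by
    intro w hw
    induction hw with
    | refl => exact z2
    | tail hb hbc ih =>
      obtain ⟨h1, h2, h3⟩ := hr _ _ hbc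
      rw [← ih]
      exact (crC_inv h h1 h2 h3 (fun hq => hcon _ hq hb) (fun hq => hcon _ hq (hb.tail hbc))).symm
  have h1 := this v' hvv
  rw [crC_far hl h v' hv'] at h1
  exact absurd h1 (by decide)




/-! ### Frames -/

/-- A symmetry of the lattice. -/
structure Frame where
  e : Lat ≃ Lat
  adj : ∀ x y, Adj (e x) (e y) ↔ Adj x y
  fr : ∀ b x y, far b (e x) (e y) ↔ far b x y

/-- Translation of the first coordinate. -/
def frame0 (t : ℤ) : Frame where
  e := ⟨fun v => (v.1 - t, v.2), fun v => (v.1 + t, v.2), fun v => by simp, fun v => by simp⟩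
  adj x y := by
    simp only [Adj, Equiv.coe_fn_mk]
    rw [show x.1 - t - (y.1 - t) = x.1 - y.1 by ring]
  fr b x y := by
    simp only [far, Equiv.coe_fn_mk]
    rw [show y.1 - t - (x.1 - t) = y.1 - x.1 by ring]

/-- Exchange of the coordinates, and translation. -/
def frame1 (t : ℤ) : Frame where
  e := ⟨fun v => (v.2 - t, v.1), fun v => (v.2, v.1 + t), fun v => by simp, fun v => by simp⟩
  adj x y := by
    simp only [Adj, Equiv.coe_fn_mk]
    rw [show x.2 - t - (y.2 - t) = x.2 - y.2 by ring, add_comm]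
  fr b x y := by
    simp only [far, Equiv.coe_fn_mk]
    rw [show y.2 - t - (x.2 - t) = y.2 - x.2 by ring, or_comm]

/-- Mirror image of a frame. -/
def Frame.mir (φ : Frame) (w : ℤ) : Frame where
  e := ⟨fun v => (w - (φ.e v).1, (φ.e v).2), fun v => φ.e.symm (w - v.1, v.2),
    fun v => by simp, fun v => by simp⟩
  adj x y := by
    rw [← φ.adj x y]
    simp only [Adj, Equiv.coe_fn_mk]
    rw [show w - (φ.e x).1 - (w - (φ.e y).1) = -((φ.e x).1 - (φ.e y).1) by ring, neg_sq]
  fr b x y := by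
    rw [← φ.fr b x y]
    simp only [far, Equiv.coe_fn_mk]
    rw [show w - (φ.e y).1 - (w - (φ.e x).1) = -((φ.e y).1 - (φ.e x).1) by ring, abs_neg]

theorem Frame.sum_nb (φ : Frame) (x : Lat) (f : Lat → ℝ) :
    ∑ y ∈ nb x, f (φ.e y) = ∑ z ∈ nb (φ.e x), f z := by
  refine Finset.sum_equiv φ.e (fun y => ?_) (fun y _ => rfl)
  rw [← Adj_iff, ← Adj_iff, φ.adj]

/-! ### Connectivity of loops -/

/-- The edge `{x, y}` is used by the list. -/
def usesL (l : List Lat) (x y : Lat) : Prop :=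
  ¬ l.IsChain (fun a b => (a, b) ≠ (x, y) ∧ (b, a) ≠ (x, y))

theorem usesL_symm (l : List Lat) (x y : Lat) (h : usesL l x y) : usesL l y x := by
  refine fun hc => h (hc.imp fun a b hab => ⟨fun h1 => hab.2 ?_, fun h1 => hab.1 ?_⟩)
  · rw [Prod.mk.injEq] at h1 ⊢; exact h1.symm
  · rw [Prod.mk.injEq] at h1 ⊢; exact h1.symm

theorem usesL_chain (l : List Lat) : l.IsChain (usesL l) := by
  rw [List.isChain_iff_getElem]
  intro i hi hc
  rw [List.isChain_iff_getElem] at hc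
  exact (hc i hi).1 rfl

theorem usesL_adj {l : List Lat} (hl : l.IsChain Adj) {x y : Lat} (h : usesL l x y) :
    Adj x y ∧ x ∈ l ∧ y ∈ l := by
  by_contra hcon
  apply h
  rw [List.isChain_iff_getElem] at hl ⊢
  intro i hi
  refine ⟨fun he => hcon ?_, fun he => hcon ?_⟩
  · rw [Prod.mk.injEq] at he
    rw [← he.1, ← he.2]
    exact ⟨hl i hi, List.getElem_mem _, List.getElem_mem _⟩
  · rw [Prod.mk.injEq] at he
    rw [← he.1, ← he.2]
    exact ⟨Adj_symm (hl i hi), List.getElem_mem _, List.getElem_mem _⟩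

theorem chain_conn {r : Lat → Lat → Prop} (hs : ∀ x y, r x y → r y x) {l : List Lat}
    (h : l.IsChain r) {x y : Lat} (hx : x ∈ l) (hy : y ∈ l) : Relation.ReflTransGen r x y := by
  have sym : ∀ x y, Relation.ReflTransGen r x y → Relation.ReflTransGen r y x := by
    intro x y hxy
    induction hxy with
    | refl => exact .refl
    | tail _ hbc ih => exact .head (hs _ _ hbc) ih
  have aux : ∀ l : List Lat, l.IsChain r → ∀ a, l.head? = some a → ∀ x ∈ l,
      Relation.ReflTransGen r a x := by
    intro l
    induction l with
    | nil => simp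
    | cons p l ih =>
      intro hc a ha x hx
      simp only [List.head?_cons, Option.some.injEq] at ha
      subst ha
      rcases List.mem_cons.1 hx with rfl | hx
      · exact .refl
      · match l, ih, hc, hx with
        | q :: t, ih, hc, hx =>
          rw [List.isChain_cons_cons] at hc
          exact .head hc.1 (ih hc.2 q rfl x hx)
  match l, h, hx, hy with
  | p :: t, h, hx, hy =>
    exact (sym _ _ (aux _ h p rfl x hx)).trans (aux _ h p rfl y hy)

/-- The edge is used by a loop. -/
def usesU (γ : ULoop) (x y : Lat) : Prop := usesL (γ.out.word ++ γ.out.word.take 1) x y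

theorem mem_verts_word {γ : ULoop} {x : Lat} :
    x ∈ γ.out.word ++ γ.out.word.take 1 ↔ x ∈ ULoop.verts γ := by
  rw [List.mem_append]
  exact ⟨fun h => h.elim id fun h => List.mem_of_mem_take h, Or.inl⟩

theorem usesU_adj {γ : ULoop} {x y : Lat} (h : usesU γ x y) :
    Adj x y ∧ x ∈ ULoop.verts γ ∧ y ∈ ULoop.verts γ := by
  have := usesL_adj γ.out.adj h
  rwa [mem_verts_word, mem_verts_word] at this

theorem usesU_conn {γ : ULoop} {x y : Lat} (hx : x ∈ ULoop.verts γ) (hy : y ∈ ULoop.verts γ) :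
    Relation.ReflTransGen (usesU γ) x y :=
  chain_conn (usesL_symm _) (usesL_chain _) (mem_verts_word.2 hx) (mem_verts_word.2 hy)

theorem verts_finite (γ : ULoop) : (ULoop.verts γ).Finite := List.finite_toSet _

theorem verts_nonempty (γ : ULoop) : (ULoop.verts γ).Nonempty :=
  List.exists_mem_of_ne_nil _ γ.out.ne

/-! ### Sizes of loops -/

/-- The loop has two vertices at distance at least `b`. -/
def hp (b : ℕ) (γ : ULoop) : Prop := ∃ x ∈ ULoop.verts γ, ∃ y ∈ ULoop.verts γ, far b x y

theorem hp_one (γ : ULoop) : hp 1 γ := by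
  obtain ⟨x, hx⟩ := verts_nonempty γ
  have hadj := γ.out.adj
  have : ∃ y ∈ ULoop.verts γ, ∃ z ∈ ULoop.verts γ, Adj y z := by
    match hw : γ.out.word, γ.out.ne with
    | [p], _ =>
      rw [hw] at hadj
      have : Adj p p := (List.isChain_cons_cons.1 hadj).1
      simp [Adj] at this
    | p :: q :: t, _ =>
      rw [hw] at hadj
      refine ⟨p, ?_, q, ?_, (List.isChain_cons_cons.1 hadj).1⟩
      · change p ∈ γ.out.word; rw [hw]; simp
      · change q ∈ γ.out.word; rw [hw]; simp
  obtain ⟨y, hy, z, hz, h⟩ := this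
  refine ⟨y, hy, z, hz, ?_⟩
  unfold far
  rcases Adj_cases h with h | h | h | h
  · left; rw [h.1]; simp
  · left; rw [h.1]; simp
  · right; rw [h.2]; simp
  · right; rw [h.2]; simp

theorem hp_mono {a b : ℕ} (hab : a ≤ b) {γ : ULoop} (h : hp b γ) : hp a γ := by
  obtain ⟨x, hx, y, hy, h⟩ := h
  refine ⟨x, hx, y, hy, h.imp (fun h => le_trans ?_ h) (fun h => le_trans ?_ h)⟩ <;> exact_mod_cast hab

theorem hp_wide {b c : ℕ} (hbc : 2 * c ≤ b + 1) {γ : ULoop} (h : hp b γ) : wide c γ := by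
  obtain ⟨x, hx, y, hy, h⟩ := h
  intro z hz
  by_contra hcon
  push Not at hcon
  have h1 := hcon x hx
  have h2 := hcon y hy
  unfold far at *
  push Not at h1 h2
  simp only [abs_lt, le_abs] at *
  omega

theorem not_hp {b : ℕ} {γ : ULoop} (h : ¬ hp b γ) (φ : Frame) {x y : Lat}
    (hx : x ∈ ULoop.verts γ) (hy : y ∈ ULoop.verts γ) :
    |(φ.e y).1 - (φ.e x).1| < b ∧ |(φ.e y).2 - (φ.e x).2| < b := by
  have : ¬ far b (φ.e x) (φ.e y) := by
    rw [φ.fr]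
    exact fun hf => h ⟨x, hx, y, hy, hf⟩
  unfold far at this
  push Not at this
  exact this

/-- Straddling the axis of a frame. -/
def strd (φ : Frame) (γ : ULoop) : Prop :=
  (∃ v ∈ ULoop.verts γ, (φ.e v).1 ≤ 0) ∧ ∃ v ∈ ULoop.verts γ, 0 < (φ.e v).1

/-- The cell of a loop. -/
def isCell (φ : Frame) (γ : ULoop) (k : ℕ) (j : ℤ) : Prop :=
  hp (2 ^ k) γ ∧ ¬ hp (2 ^ (k + 1)) γ ∧ (∀ v ∈ ULoop.verts γ, j * (2 ^ k : ℕ) ≤ (φ.e v).2) ∧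
    ∃ v ∈ ULoop.verts γ, (φ.e v).2 < (j + 1) * (2 ^ k : ℕ)

theorem cell_exists (φ : Frame) (γ : ULoop) {τ : ℕ} (h : ¬ hp τ γ) : ∃ k j, isCell φ γ k j := by
  have hex : ∃ K, ¬ hp (2 ^ K) γ := ⟨τ, fun h' => h (hp_mono Nat.lt_two_pow_self.le h')⟩
  have hK := Nat.find_spec hex
  obtain ⟨k, hk⟩ : ∃ k, Nat.find hex = k + 1 := by
    apply Nat.exists_eq_succ_of_ne_zero
    intro h0
    rw [h0] at hK
    exact hK (hp_one γ)
  have hk2 : hp (2 ^ k) γ := by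
    have := Nat.find_min hex (m := k) (by omega)
    push Not at this
    exact this
  rw [hk] at hK
  obtain ⟨v, hv, hmin⟩ := (verts_finite γ).exists_minimalFor (fun v => (φ.e v).2) _
    (verts_nonempty γ)
  have hp2 : (0 : ℤ) < ((2 ^ k : ℕ) : ℤ) := by positivity
  refine ⟨k, (φ.e v).2 / (2 ^ k : ℕ), hk2, hK, ?_, v, hv, ?_⟩
  · intro v' hv'
    have h1 : (φ.e v).2 ≤ (φ.e v').2 := by
      rcases le_total ((φ.e v).2) ((φ.e v').2) with h | h
      · exact h
      · exact hmin hv' h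
    exact (Int.ediv_mul_le _ hp2.ne').trans h1
  · exact Int.lt_ediv_add_one_mul_self _ hp2

theorem cell_bd {φ : Frame} {γ : ULoop} {k : ℕ} {j : ℤ} (h : isCell φ γ k j) (hs : strd φ γ)
    {v : Lat} (hv : v ∈ ULoop.verts γ) :
    -(2 * ((2 ^ k : ℕ) : ℤ)) < (φ.e v).1 ∧ (φ.e v).1 < 2 * ((2 ^ k : ℕ) : ℤ) ∧
      j * (2 ^ k : ℕ) ≤ (φ.e v).2 ∧ (φ.e v).2 < j * (2 ^ k : ℕ) + 3 * ((2 ^ k : ℕ) : ℤ) := by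
  obtain ⟨-, h2, h3, v1, hv1, h4⟩ := h
  obtain ⟨⟨a, ha, ha1⟩, b, hb, hb1⟩ := hs
  have e1 := (not_hp h2 φ ha hv).1
  have e2 := (not_hp h2 φ hb hv).1
  have e3 := (not_hp h2 φ hv1 hv).2
  rw [abs_lt] at e1 e2 e3
  rw [pow_succ] at e1 e2 e3
  push_cast at *
  rw [add_mul, one_mul] at h4
  have := h3 v hv
  exact ⟨by linarith, by linarith, this, by linarith⟩

theorem cell_mass (φ : Frame) (k : ℕ) (j : ℤ) (I : Finset ULoop)
    (hI : ∀ γ ∈ I, strd φ γ ∧ isCell φ γ k j) : ∑ γ ∈ I, (loopWeight γ : ℝ) ≤ 336 := by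
  set ℓ : ℕ := 2 ^ k with hℓ
  have hl : 0 < ℓ := by positivity
  set W : Finset Lat := ((Finset.Ioo (-(2 * (ℓ : ℤ))) (2 * ℓ)) ×ˢ
    (Finset.Ico (j * ℓ) (j * ℓ + 3 * ℓ))).image φ.e.symm with hW
  have hc : W.card ≤ 12 * ℓ ^ 2 := by
    refine Finset.card_image_le.trans ?_
    rw [Finset.card_product, Int.card_Ioo, Int.card_Ico]
    have e1 : (2 * (ℓ : ℤ) - -(2 * ℓ) - 1).toNat ≤ 4 * ℓ := by omega
    have e2 : (j * ℓ + 3 * ℓ - j * ℓ).toNat = 3 * ℓ := by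
      rw [add_sub_cancel_left]; omega
    rw [e2]
    calc _ ≤ 4 * ℓ * (3 * ℓ) := Nat.mul_le_mul_right _ e1
      _ = _ := by ring
  have hb : 0 < (ℓ + 1) / 2 := by omega
  refine (wide_mass_fin W ((ℓ + 1) / 2) hb I ?_).trans ?_
  · intro γ hγ
    obtain ⟨h1, h2⟩ := hI γ hγ
    refine ⟨hp_wide (by omega) h2.1, fun v hv => ?_⟩
    obtain ⟨a1, a2, a3, a4⟩ := cell_bd h2 h1 hv
    rw [hW, Finset.mem_coe, Finset.mem_image]
    refine ⟨φ.e v, ?_, by simp⟩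
    rw [Finset.mem_product, Finset.mem_Ioo, Finset.mem_Ico]
    exact ⟨⟨a1, a2⟩, a3, a4⟩
  · have h1 : (ℓ : ℝ) / 2 ≤ (((ℓ + 1) / 2 : ℕ) : ℝ) := by
      have : ℓ ≤ 2 * ((ℓ + 1) / 2) := by omega
      have : (ℓ : ℝ) ≤ 2 * (((ℓ + 1) / 2 : ℕ) : ℝ) := by exact_mod_cast this
      linarith
    have h2 : (W.card : ℝ) ≤ 12 * ℓ ^ 2 := by exact_mod_cast hc
    have h3 : (0 : ℝ) < ℓ := by exact_mod_cast hl
    rw [div_le_iff₀ (by positivity)]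
    nlinarith




/-! ### The strip -/

/-- Interior of the strip. -/
def sV (φ : Frame) (w M : ℕ) : Finset Lat :=
  ((Finset.Ioo (0 : ℤ) w) ×ˢ (Finset.Ioo (-(M : ℤ)) M)).image φ.e.symm

/-- A vertical segment. -/
def sA (φ : Frame) (t : ℤ) (M : ℕ) : Finset Lat :=
  (({t} : Finset ℤ) ×ˢ (Finset.Ioo (-(M : ℤ)) M)).image φ.e.symm

theorem mem_sV {φ : Frame} {w M : ℕ} {v : Lat} :
    v ∈ sV φ w M ↔ 0 < (φ.e v).1 ∧ (φ.e v).1 < w ∧ -(M : ℤ) < (φ.e v).2 ∧ (φ.e v).2 < M := by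
  unfold sV
  rw [Finset.mem_image]
  constructor
  · rintro ⟨x, hx, rfl⟩
    rw [Finset.mem_product, Finset.mem_Ioo, Finset.mem_Ioo] at hx
    simpa [and_assoc] using hx
  · intro h
    refine ⟨φ.e v, ?_, by simp⟩
    rw [Finset.mem_product, Finset.mem_Ioo, Finset.mem_Ioo]
    exact ⟨⟨h.1, h.2.1⟩, h.2.2⟩

theorem mem_sA {φ : Frame} {t : ℤ} {M : ℕ} {v : Lat} :
    v ∈ sA φ t M ↔ (φ.e v).1 = t ∧ -(M : ℤ) < (φ.e v).2 ∧ (φ.e v).2 < M := by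
  unfold sA
  rw [Finset.mem_image]
  constructor
  · rintro ⟨x, hx, rfl⟩
    rw [Finset.mem_product, Finset.mem_singleton, Finset.mem_Ioo] at hx
    simpa using hx
  · intro h
    refine ⟨φ.e v, ?_, by simp⟩
    rw [Finset.mem_product, Finset.mem_singleton, Finset.mem_Ioo]
    exact h

/-- Both sides of the strip. -/
def sC2 (φ : Frame) (w M : ℕ) : Finset Lat := sA φ 0 M ∪ sA φ w M

/-- Edges of the strip. -/
def sE (φ : Frame) (w M : ℕ) : Finset (Lat × Lat) :=
  ((sV φ w M ∪ sC2 φ w M) ×ˢ (sV φ w M ∪ sC2 φ w M)).filter fun e =>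
    (e.2 = (e.1.1 + 1, e.1.2) ∨ e.2 = (e.1.1, e.1.2 + 1)) ∧ (e.1 ∈ sV φ w M ∨ e.2 ∈ sV φ w M)

theorem sE_good (φ : Frame) (w M : ℕ) : goodE (sV φ w M) (sC2 φ w M) (sE φ w M) := by
  rintro ⟨x, y⟩ he
  unfold sE at he
  rw [Finset.mem_filter, Finset.mem_product, Finset.mem_union, Finset.mem_union] at he
  obtain ⟨⟨h1, h2⟩, h3, h4⟩ := he
  simp only [Prod.ext_iff] at h3
  refine ⟨?_, ?_, ?_⟩
  · unfold Adj
    simp only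
    rcases h3 with h | h
    · rw [h.1, h.2]; ring
    · rw [h.1, h.2]; ring
  · intro h
    unfold sE at h
    rw [Finset.mem_filter] at h
    have := h.2.1
    simp only [Prod.ext_iff] at this
    omega
  · rcases h4 with h4 | h4
    · exact Or.inl ⟨h4, h2⟩
    · rcases h1 with h1 | h1
      · exact Or.inl ⟨h1, Or.inl h4⟩
      · exact Or.inr ⟨h1, h4⟩

theorem sE_full (φ : Frame) (w M : ℕ) : ∀ x ∈ sV φ w M, ∀ y, y ∈ sV φ w M ∨ y ∈ sC2 φ w M →
    Adj x y → adjS (sE φ w M) x y := by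
  intro x hx y hy h
  unfold adjS sE
  simp only [Finset.mem_filter, Finset.mem_product, Finset.mem_union, Prod.ext_iff]
  rcases Adj_cases h with h | h | h | h
  · left; exact ⟨⟨Or.inl hx, hy⟩, Or.inl h, Or.inl hx⟩
  · right; exact ⟨⟨hy, Or.inl hx⟩, Or.inl ⟨by omega, by omega⟩, Or.inr hx⟩
  · left; exact ⟨⟨Or.inl hx, hy⟩, Or.inr h, Or.inl hx⟩
  · right; exact ⟨⟨hy, Or.inl hx⟩, Or.inr ⟨by omega, by omega⟩, Or.inr hx⟩

theorem sA_card (φ : Frame) (t : ℤ) (M : ℕ) : ((sA φ t M).card : ℝ) ≤ 2 * M := by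
  have : (sA φ t M).card ≤ 2 * M := by
    unfold sA
    refine Finset.card_image_le.trans ?_
    rw [Finset.card_product, Int.card_Ioo, Finset.card_singleton]
    omega
  exact_mod_cast this

theorem strip_gff (φ : Frame) (w M : ℕ) (hw : 0 < w) (u : ℝ≥0) (F : Finset Item) :
    Real.exp (-(4 * M * u ^ 2 / w)) ≤
    Ex F (fun i => pm (mI (sV φ w M) (sC2 φ w M) u i))
      (fun T => if Disc (sA φ 0 M : Set Lat) (sA φ w M) (edgesT (sE φ w M) T) then 1 else 0) := by
  have hw' : (0 : ℝ) < w := by exact_mod_cast hw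
  have hVA : Disjoint (sV φ w M) (sA φ 0 M) := Finset.disjoint_left.2 fun x h1 h2 => by
    rw [mem_sV] at h1; rw [mem_sA] at h2; omega
  have hVB : Disjoint (sV φ w M) (sA φ w M) := Finset.disjoint_left.2 fun x h1 h2 => by
    rw [mem_sV] at h1; rw [mem_sA] at h2; omega
  have hAB : Disjoint (sA φ 0 M) (sA φ w M) := Finset.disjoint_left.2 fun x h1 h2 => by
    rw [mem_sA] at h1; rw [mem_sA] at h2; omega
  refine le_trans ?_ (gff_prob hVA hVB hAB (sE_good φ w M) (sE_full φ w M) u F)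
  rw [Real.exp_le_exp]
  have hE := sE_good φ w M
  set V := sV φ w M with hV
  set E := sE φ w M with hEd
  set f : Lat → ℝ := fun y => u * (φ.e y).1 / w with hf
  have hg := green_bound (A := sA φ 0 M) (B := sA φ w M) hE u (fun x : V => f x) ?_ ?_
  · have h2 : ∑ x : V, hS V (sA φ 0 M) E (fun _ => (u : ℝ)) x * f x ≤ 2 * M * u ^ 2 / w := by
      have e1 : ∑ x : V, hS V (sA φ 0 M) E (fun _ => (u : ℝ)) x * f x =
          ∑ β ∈ sA φ 0 M, ∑ x ∈ V, if adjS E β x then (u * f x) / 4 else 0 := by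
        rw [Finset.sum_comm]
        rw [← Finset.sum_coe_sort V]
        refine Finset.sum_congr rfl fun x _ => ?_
        unfold hS
        rw [Finset.sum_mul]
        refine Finset.sum_congr rfl fun β _ => ?_
        by_cases h : adjS E β x
        · rw [if_pos h, if_pos (adjS_symm.1 h)]; ring
        · rw [if_neg h, if_neg (fun h' => h (adjS_symm.1 h')), zero_mul]
      rw [e1]
      calc _ ≤ ∑ β ∈ sA φ 0 M, (u ^ 2 / w : ℝ) := by
            refine Finset.sum_le_sum fun β hβ => ?_
            rw [mem_sA] at hβ
            calc _ ≤ ∑ x ∈ V, if adjS E β x then (u * (u / w) : ℝ) / 4 else 0 := by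
                  refine Finset.sum_le_sum fun x hx => ?_
                  by_cases h : adjS E β x
                  · rw [if_pos h, if_pos h]
                    have hadj := (φ.adj _ _).2 (goodE_adj hE h)
                    have : (φ.e x).1 ≤ 1 := by
                      rcases Adj_cases hadj with h | h | h | h <;> omega
                    have : ((φ.e x).1 : ℝ) ≤ 1 := by exact_mod_cast this
                    have : f x ≤ u / w := by
                      rw [hf]
                      simp only
                      gcongr
                      calc (u : ℝ) * (φ.e x).1 ≤ u * 1 := by gcongr
                        _ = u := mul_one _
                    gcongr
                  · rw [if_neg h, if_neg h]
              _ ≤ ∑ y ∈ nb β, (u * (u / w) : ℝ) / 4 :=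
                  PS_sum_le hE β (fun _ => (u * (u / w) : ℝ)) V (fun _ _ => by positivity)
              _ = u ^ 2 / w := by
                  rw [sum_nb]; ring
        _ = (sA φ 0 M).card * (u ^ 2 / w : ℝ) := by rw [Finset.sum_const, nsmul_eq_mul]
        _ ≤ 2 * M * (u ^ 2 / w : ℝ) := by
            gcongr
            exact sA_card φ 0 M
        _ = _ := by ring
    have h3 := hg.trans h2
    have h4 : (4 * M * u ^ 2 / w : ℝ) = 2 * (2 * M * u ^ 2 / w) := by ring
    rw [h4]
    linarith
  · intro x
    have := (mem_sV.1 x.2).1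
    have : (0 : ℝ) ≤ (φ.e x).1 := by exact_mod_cast this.le
    rw [hf]
    positivity
  · intro x
    have hx := mem_sV.1 x.2
    have h1 : hS V (sA φ w M) E (fun _ => (u : ℝ)) x + (PS V E).mulVec (fun x : V => f x) x =
        ∑ y ∈ sA φ w M ∪ V, if adjS E x y then f y / 4 else 0 := by
      rw [Finset.sum_union hVB.symm]
      congr 1
      · unfold hS
        refine Finset.sum_congr rfl fun β hβ => ?_
        rw [mem_sA] at hβ
        rw [hf]
        simp only [hβ.1]
        congr 2
        push_cast
        field_simp
      · unfold PS Matrix.mulVec dotProduct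
        rw [← Finset.sum_coe_sort V]
        refine Finset.sum_congr rfl fun y _ => ?_
        simp only [Matrix.of_apply]
        split_ifs <;> ring
    rw [h1]
    refine (PS_sum_le hE x f _ ?_).trans (le_of_eq ?_)
    · intro y hy
      have hadj := (φ.adj _ _).2 ((Adj_iff _ _).2 hy)
      have : 0 ≤ (φ.e y).1 := by
        rcases Adj_cases hadj with h | h | h | h <;> omega
      have : (0 : ℝ) ≤ (φ.e y).1 := by exact_mod_cast this
      rw [hf]
      positivity
    · have := φ.sum_nb x (fun z => u * (z.1 : ℝ) / w / 4)
      rw [hf]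
      simp only at this ⊢
      rw [this, sum_nb]
      push_cast
      field_simp
      ring




/-! ### Labels, and the two domination steps -/

theorem usesL_rel {R : Lat → Lat → Prop} (hs : ∀ x y, R x y → R y x) {l : List Lat}
    (hl : l.IsChain R) {x y : Lat} (h : usesL l x y) : R x y ∧ x ∈ l ∧ y ∈ l := by
  by_contra hcon
  apply h
  rw [List.isChain_iff_getElem] at hl ⊢
  intro i hi
  refine ⟨fun he => hcon ?_, fun he => hcon ?_⟩
  · rw [Prod.mk.injEq] at he
    rw [← he.1, ← he.2]
    exact ⟨hl i hi, List.getElem_mem _, List.getElem_mem _⟩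
  · rw [Prod.mk.injEq] at he
    rw [← he.1, ← he.2]
    exact ⟨hs _ _ (hl i hi), List.getElem_mem _, List.getElem_mem _⟩

theorem okA_chain2 {Rg Tg : Lat → Prop} {l : List Lat} (h : okA Rg Tg l) :
    l.IsChain (fun a b => Adj a b ∧ (Rg a ∨ Rg b)) := by
  match l, h with
  | [x], _ => simp
  | x :: y :: t, h => exact List.isChain_cons_cons.2 ⟨⟨h.2.1, Or.inl h.1⟩, okA_chain2 h.2.2⟩

theorem isArcQ_chain2 {ℓ a : ℤ} {Q : List Lat} (h : isArcQ ℓ a Q) :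
    Q.IsChain (fun p q => Adj p q ∧ (Rgn ℓ a p ∨ Rgn ℓ a q)) := by
  obtain ⟨y, l, rfl, -, -, h1, h2⟩ := h
  match l, h1, h2 with
  | [z], h1, h2 =>
    simp only [List.head?_cons, Option.some.injEq] at h2
    subst h2
    have := h1.1
    simp at this
  | z :: z' :: t, h1, h2 =>
    simp only [List.head?_cons, Option.some.injEq] at h2
    subst h2
    exact List.isChain_cons_cons.2 ⟨⟨by simp [Adj], Or.inr h1.1⟩, okA_chain2 h1⟩

/-- The frame of a side of the strip. -/
def frS (φ : Frame) (w : ℕ) : Bool → Frame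
  | false => φ
  | true => φ.mir w

/-- A side of the strip. -/
def sideA (φ : Frame) (w M : ℕ) : Bool → Finset Lat
  | false => sA φ 0 M
  | true => sA φ w M

theorem frS_1 (φ : Frame) (w : ℕ) (v : Lat) : ((frS φ w true).e v).1 = w - (φ.e v).1 := rfl
theorem frS_2 (φ : Frame) (w : ℕ) (v : Lat) : ((frS φ w true).e v).2 = (φ.e v).2 := rfl

/-- Labels. -/
abbrev Lb : Type := ULoop ⊕ (Bool × ℕ × ℤ)

/-- The loop belongs to the cell. -/
def cellP (φ : Frame) (w : ℕ) (γ : ULoop) (p : Bool × ℕ × ℤ) : Prop :=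
  strd (frS φ w p.1) γ ∧ isCell (frS φ w p.1) γ p.2.1 p.2.2

/-- Label of a loop. -/
def labL (φ : Frame) (w : ℕ) (γ : ULoop) : Lb :=
  if h : ∃ p, cellP φ w γ p then Sum.inr h.choose else Sum.inl γ

/-- The path is an arc around the cell. -/
def arcOf (φ : Frame) (w M τ : ℕ) (p : Bool × ℕ × ℤ) (Q : List Lat) : Prop :=
  2 ^ p.2.1 < τ ∧ |p.2.2 * (2 ^ p.2.1 : ℕ)| + 20 * ((2 ^ p.2.1 : ℕ) : ℤ) < M ∧
    isArcQ ((2 ^ p.2.1 : ℕ) : ℤ) (p.2.2 * (2 ^ p.2.1 : ℕ)) (Q.map (frS φ w p.1).e)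

/-- Label of an item. -/
def labI (φ : Frame) (w M τ : ℕ) : Item → Lb
  | Item.lp γ => Sum.inl γ
  | Item.ex Q => if h : ∃ p, arcOf φ w M τ p Q then Sum.inr h.choose else Sum.inr (false, 0, 0)

/-- Zone of a cell. -/
def zoneS (φ : Frame) (w : ℕ) (p : Bool × ℕ × ℤ) (v : Lat) : Prop :=
  0 < ((frS φ w p.1).e v).1 ∧ ((frS φ w p.1).e v).1 < 2 * ((2 ^ p.2.1 : ℕ) : ℤ) ∧
    p.2.2 * (2 ^ p.2.1 : ℕ) ≤ ((frS φ w p.1).e v).2 ∧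
    ((frS φ w p.1).e v).2 < p.2.2 * (2 ^ p.2.1 : ℕ) + 3 * ((2 ^ p.2.1 : ℕ) : ℤ)

/-- Steps of interior loops. -/
def rY (φ : Frame) (w M : ℕ) (Y : Finset Lb) (x y : Lat) : Prop :=
  ∃ γ, Sum.inl γ ∈ Y ∧ ULoop.verts γ ⊆ (sV φ w M : Set Lat) ∧ usesU γ x y

/-- The labels contain a crossing. -/
def NB (φ : Frame) (w M : ℕ) (Y : Finset Lb) : Prop :=
  ∃ p p' v v', Sum.inr p ∈ Y ∧ Sum.inr p' ∈ Y ∧ p.1 = false ∧ p'.1 = true ∧ zoneS φ w p v ∧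
    zoneS φ w p' v' ∧ Relation.ReflTransGen (rY φ w M Y) v v'

theorem NB_mono {φ : Frame} {w M : ℕ} {Y Y' : Finset Lb} (h : Y ⊆ Y') (hN : NB φ w M Y) :
    NB φ w M Y' := by
  obtain ⟨p, p', v, v', h1, h2, h3, h4, h5, h6, h7⟩ := hN
  refine ⟨p, p', v, v', h h1, h h2, h3, h4, h5, h6, ?_⟩
  refine Relation.ReflTransGen.mono ?_ _ _ h7
  rintro x y ⟨γ, g1, g2⟩
  exact ⟨γ, h g1, g2⟩

theorem arc_in {φ : Frame} {w M τ : ℕ} {p : Bool × ℕ × ℤ} {Q : List Lat} (hτ : 16 * τ ≤ w)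
    (h : arcOf φ w M τ p Q) : ∀ v ∈ Q,
    (Rgn ((2 ^ p.2.1 : ℕ) : ℤ) (p.2.2 * (2 ^ p.2.1 : ℕ)) ((frS φ w p.1).e v) → v ∈ sV φ w M) ∧
    (((frS φ w p.1).e v).1 = 0 → v ∈ sideA φ w M p.1) := by
  obtain ⟨s, k, j⟩ := p
  obtain ⟨h1, h2, h3⟩ := h
  intro v hv
  simp only at *
  have hk : (0 : ℤ) < ((2 ^ k : ℕ) : ℤ) := by positivity
  have h1' : ((2 ^ k : ℕ) : ℤ) < τ := by exact_mod_cast h1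
  set ℓ : ℤ := ((2 ^ k : ℕ) : ℤ)
  set a : ℤ := j * ℓ
  have hm := isArcQ_mem h3 hk ((frS φ w s).e v) (List.mem_map_of_mem hv)
  have hy : |((frS φ w s).e v).2 - a| ≤ 20 * ℓ := by
    rcases hm with h | h
    · exact h.2.2.1
    · exact h.2
  have hyM : -(M : ℤ) < ((frS φ w s).e v).2 ∧ ((frS φ w s).e v).2 < M := by
    rw [abs_le] at hy
    have := le_abs_self a
    have := neg_abs_le a
    constructor <;> linarith
  constructor
  · intro h
    have h5 := h.1
    have h6 := h.2.1
    rw [mem_sV]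
    cases s
    · exact ⟨h5, by simp only [frS] at h6; omega, hyM⟩
    · rw [frS_1] at h5 h6
      rw [frS_2] at hyM
      exact ⟨by omega, by omega, hyM⟩
  · intro h
    cases s
    · exact mem_sA.2 ⟨h, hyM⟩
    · rw [frS_1] at h
      exact mem_sA.2 ⟨by omega, hyM⟩

theorem sideA_sub (φ : Frame) (w M : ℕ) (s : Bool) : sideA φ w M s ⊆ sC2 φ w M := by
  cases s
  · exact Finset.subset_union_left
  · exact Finset.subset_union_right

theorem mem_edgesT {φ : Frame} {w M : ℕ} {T : Finset Item} {x y : Lat} {i : Item} (hi : i ∈ T)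
    (hE : adjS (sE φ w M) x y)
    (hx : ¬ itemChain (fun a b => (a, b) ≠ (x, y) ∧ (b, a) ≠ (x, y)) i)
    (hy : ¬ itemChain (fun a b => (a, b) ≠ (y, x) ∧ (b, a) ≠ (y, x)) i) :
    (x, y) ∈ edgesT (sE φ w M) T ∨ (y, x) ∈ edgesT (sE φ w M) T := by
  unfold edgesT
  rcases hE with h | h
  · left; exact Finset.mem_filter.2 ⟨h, i, hi, hx⟩
  · right; exact Finset.mem_filter.2 ⟨h, i, hi, hy⟩

theorem rY_edges {φ : Frame} {w M τ : ℕ} {T : Finset Item} {x y : Lat}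
    (h : rY φ w M (T.image (labI φ w M τ)) x y) :
    (x, y) ∈ edgesT (sE φ w M) T ∨ (y, x) ∈ edgesT (sE φ w M) T := by
  obtain ⟨γ, h1, h2, h3⟩ := h
  rw [Finset.mem_image] at h1
  obtain ⟨i, hi, he⟩ := h1
  have hi2 : Item.lp γ ∈ T := by
    match i, hi, he with
    | Item.lp γ', hi, he =>
      simp only [labI, Sum.inl.injEq] at he
      rwa [← he]
    | Item.ex Q, hi, he =>
      simp only [labI] at he
      split_ifs at he
  obtain ⟨a1, a2, a3⟩ := usesU_adj h3
  exact mem_edgesT hi2 (sE_full φ w M x (h2 a2) y (Or.inl (h2 a3)) a1) h3 (usesL_symm _ _ _ h3)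

theorem arc_edges {φ : Frame} {w M τ : ℕ} {T : Finset Item} {Q : List Lat} {p : Bool × ℕ × ℤ}
    (hτ : 16 * τ ≤ w) (hQ : Item.ex Q ∈ T) (h : arcOf φ w M τ p Q) {x y : Lat} (hxy : usesL Q x y) :
    (x, y) ∈ edgesT (sE φ w M) T ∨ (y, x) ∈ edgesT (sE φ w M) T := by
  have hc := isArcQ_chain2 h.2.2
  rw [List.isChain_map] at hc
  obtain ⟨⟨r1, r2⟩, hx, hy⟩ := usesL_rel (fun x y h => ⟨Adj_symm h.1, h.2.symm⟩) hc hxy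
  rw [(frS φ w p.1).adj] at r1
  have mem : ∀ v ∈ Q, v ∈ sV φ w M ∨ v ∈ sC2 φ w M := by
    intro v hv
    rcases isArcQ_mem h.2.2 (by positivity) _ (List.mem_map_of_mem hv) with h' | h'
    · exact Or.inl ((arc_in hτ h v hv).1 h')
    · exact Or.inr (sideA_sub _ _ _ _ ((arc_in hτ h v hv).2 h'.1))
  refine mem_edgesT hQ ?_ hxy (usesL_symm _ _ _ hxy)
  rcases r2 with r2 | r2
  · exact sE_full φ w M x ((arc_in hτ h x hx).1 r2) y (mem y hy) r1
  · exact adjS_symm.1 (sE_full φ w M y ((arc_in hτ h y hy).1 r2) x (mem x hx) (Adj_symm r1))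

theorem hitA {φ : Frame} {w M τ : ℕ} {T : Finset Item} {Q : List Lat} {p : Bool × ℕ × ℤ}
    (hτ : 16 * τ ≤ w) (hQ : Item.ex Q ∈ T) (h : arcOf φ w M τ p Q) {v v' : Lat}
    (hz : zoneS φ w p v) (hv' : 8 * ((2 ^ p.2.1 : ℕ) : ℤ) ≤ ((frS φ w p.1).e v').1)
    (hvv : Relation.ReflTransGen (rY φ w M (T.image (labI φ w M τ))) v v') :
    ∃ a ∈ sideA φ w M p.1, eReach (edgesT (sE φ w M) T) a v := by
  set ψ := frS φ w p.1 with hψ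
  set r := rY φ w M (T.image (labI φ w M τ)) with hr
  have hpos : (0 : ℤ) < ((2 ^ p.2.1 : ℕ) : ℤ) := by positivity
  have hV : ∀ x ∈ sV φ w M, 0 < (ψ.e x).1 := by
    intro x hx
    rw [mem_sV] at hx
    rw [hψ]
    obtain ⟨s, k, j⟩ := p
    cases s
    · exact hx.1
    · simp only; rw [frS_1]; omega
  have h1 := arc_hit (r := fun a b => r (ψ.e.symm a) (ψ.e.symm b)) hpos h.2.2 ?_ hz.1
    (by have := hz.2.1; omega) hz.2.2.1 hz.2.2.2 hv' ?_
  · obtain ⟨q, hq, hvq⟩ := h1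
    rw [List.mem_map] at hq
    obtain ⟨q, hq, rfl⟩ := hq
    have h2 : Relation.ReflTransGen r (ψ.e.symm (ψ.e v)) (ψ.e.symm (ψ.e q)) :=
      Relation.ReflTransGen.lift ψ.e.symm (fun a b hab => hab) _ _ hvq
    rw [Equiv.symm_apply_apply, Equiv.symm_apply_apply] at h2
    obtain ⟨a, ha, ha2⟩ : ∃ a ∈ Q, (ψ.e a).1 = 0 := by
      obtain ⟨y, l, hl, -⟩ := h.2.2
      have : ((0, y) : Lat) ∈ Q.map ψ.e := by rw [hl]; simp
      rw [List.mem_map] at this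
      obtain ⟨a, ha, ha2⟩ := this
      exact ⟨a, ha, by rw [ha2]⟩
    refine ⟨a, (arc_in hτ h a ha).2 ha2, ?_⟩
    have h3 : Relation.ReflTransGen (usesL Q) a q := chain_conn (usesL_symm _) (usesL_chain _) ha hq
    have h4 : eReach (edgesT (sE φ w M) T) a q :=
      Relation.ReflTransGen.mono (fun x y hxy => arc_edges hτ hQ h hxy) _ _ h3
    have h5 : Relation.ReflTransGen r q v := by
      have : ∀ x y, r x y → r y x := by
        rintro x y ⟨γ, g1, g2, g3⟩
        exact ⟨γ, g1, g2, usesL_symm _ _ _ g3⟩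
      clear h4 h3 hq
      induction h2 with
      | refl => exact .refl
      | tail _ hbc ih => exact .head (this _ _ hbc) (ih (by
          rename_i hb
          exact Relation.ReflTransGen.lift ψ.e (fun a b hab => by simpa [Function.onFun] using hab) _ _ hb))
    exact h4.trans (Relation.ReflTransGen.mono (fun x y hxy => rY_edges hxy) _ _ h5)
  · rintro x y ⟨γ, g1, g2, g3⟩
    obtain ⟨a1, a2, a3⟩ := usesU_adj g3
    have e1 := hV _ (g2 a2)
    have e2 := hV _ (g2 a3)
    rw [← ψ.adj] at a1
    rw [Equiv.apply_symm_apply] at e1 e2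
    rw [Equiv.apply_symm_apply, Equiv.apply_symm_apply] at a1
    exact ⟨a1, e1, e2⟩
  · exact Relation.ReflTransGen.lift ψ.e (fun a b hab => by simpa [Function.onFun] using hab) _ _ hvv

theorem disc_NB {φ : Frame} {w M τ : ℕ} {T : Finset Item} (hτ : 16 * τ ≤ w)
    (hT : ∀ Q, Item.ex Q ∈ T → ∃ p, arcOf φ w M τ p Q)
    (hD : Disc (sA φ 0 M : Set Lat) (sA φ w M) (edgesT (sE φ w M) T)) :
    ¬ NB φ w M (T.image (labI φ w M τ)) := by
  rintro ⟨p, p', v, v', h1, h2, h3, h4, h5, h6, h7⟩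
  have get : ∀ p : Bool × ℕ × ℤ, (Sum.inr p : Lb) ∈ T.image (labI φ w M τ) →
      ∃ Q, Item.ex Q ∈ T ∧ arcOf φ w M τ p Q := by
    intro p hp
    rw [Finset.mem_image] at hp
    obtain ⟨i, hi, he⟩ := hp
    match i, hi, he with
    | Item.lp γ', hi, he => simp [labI] at he
    | Item.ex Q, hi, he =>
      have hex := hT Q hi
      simp only [labI, dif_pos hex, Sum.inr.injEq] at he
      exact ⟨Q, hi, he ▸ hex.choose_spec⟩
  obtain ⟨Q, hQ, ha⟩ := get p h1
  obtain ⟨Q', hQ', ha'⟩ := get p' h2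
  obtain ⟨s, k, j⟩ := p
  obtain ⟨s', k', j'⟩ := p'
  simp only at h3 h4
  subst h3 h4
  have l1 : ((2 ^ k : ℕ) : ℤ) < τ := by exact_mod_cast ha.1
  have l2 : ((2 ^ k' : ℕ) : ℤ) < τ := by exact_mod_cast ha'.1
  have z1 := h5.2.1
  have z2 := h6.2.1
  simp only [frS_1] at z1 z2
  have sym : Relation.ReflTransGen (rY φ w M (T.image (labI φ w M τ))) v' v := by
    clear z1 z2 h5 h6
    induction h7 with
    | refl => exact .refl
    | tail _ hbc ih =>
      obtain ⟨γ, g1, g2, g3⟩ := hbc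
      exact .head ⟨γ, g1, g2, usesL_symm _ _ _ g3⟩ ih
  obtain ⟨a, haA, har⟩ := hitA hτ hQ ha h5 (v' := v') (by simp only [frS]; omega) h7
  obtain ⟨b, hbA, hbr⟩ := hitA hτ hQ' ha' h6 (v' := v)
    (by simp only [frS_1]; simp only [frS] at z1; omega) sym
  refine hD a haA b hbA ?_
  have h8 : eReach (edgesT (sE φ w M) T) v v' :=
    Relation.ReflTransGen.mono (fun x y hxy => rY_edges hxy) _ _ h7
  refine (har.trans h8).trans ?_
  clear h8 sym z2 h6 h7 hbA
  induction hbr with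
  | refl => exact .refl
  | tail _ hbc ih => exact .head hbc.symm ih




/-! ### Crossings of a strip -/

/-- The family of loops contains a crossing of the strip. -/
def Crossed (φ : Frame) (w : ℕ) (L : Set ULoop) : Prop :=
  ∃ γ ∈ L, ∃ γ' ∈ L, linkedL L γ γ' ∧ (∃ v ∈ ULoop.verts γ, (φ.e v).1 ≤ 0) ∧
    ∃ v ∈ ULoop.verts γ', (w : ℤ) ≤ (φ.e v).1

/-- The relevant loops. -/
def bsel (φ : Frame) (w M τ : ℕ) (γ : ULoop) : Prop :=
  ¬ hp τ γ ∧ ((∃ p, cellP φ w γ p) ∨ ULoop.verts γ ⊆ (sV φ w M : Set Lat))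

theorem labL_cell {φ : Frame} {w : ℕ} {γ : ULoop} (h : ∃ p, cellP φ w γ p) :
    ∃ p, labL φ w γ = Sum.inr p ∧ cellP φ w γ p :=
  ⟨h.choose, by simp only [labL, dif_pos h], h.choose_spec⟩

theorem cell_side {φ : Frame} {w τ : ℕ} {γ : ULoop} (hw : τ ≤ w) (hs : ¬ hp τ γ)
    {v : Lat} (hv : v ∈ ULoop.verts γ) {p : Bool × ℕ × ℤ} (hp : cellP φ w γ p) :
    ((φ.e v).1 ≤ 0 → p.1 = false) ∧ ((w : ℤ) ≤ (φ.e v).1 → p.1 = true) := by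
  obtain ⟨s, k, j⟩ := p
  constructor
  · intro h
    cases s
    · rfl
    · obtain ⟨⟨⟨a, ha, ha1⟩, -⟩, -⟩ := hp
      simp only [frS_1] at ha1
      have := (not_hp hs φ hv ha).1
      rw [abs_lt] at this
      omega
  · intro h
    cases s
    · obtain ⟨⟨⟨a, ha, ha1⟩, -⟩, -⟩ := hp
      simp only [frS] at ha1
      have := (not_hp hs φ hv ha).1
      rw [abs_lt] at this
      omega
    · rfl

theorem cell_zone {φ : Frame} {w : ℕ} {γ : ULoop} {p : Bool × ℕ × ℤ} (hp : cellP φ w γ p)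
    {v : Lat} (hv : v ∈ ULoop.verts γ) (h0 : 0 < ((frS φ w p.1).e v).1) : zoneS φ w p v := by
  have := cell_bd hp.2 hp.1 hv
  exact ⟨h0, this.2⟩

theorem crossed_NB {φ : Frame} {w M τ R : ℕ} (hτ : τ ≤ w) (hRM : R < M)
    {T : Finset ULoop} (hT : ∀ γ ∈ T, ∀ v ∈ ULoop.verts γ, |(φ.e v).2| ≤ R)
    (hC : Crossed φ w {γ | γ ∈ T ∧ ¬ hp τ γ}) :
    NB φ w M ((T.filter (bsel φ w M τ)).image (labL φ w)) := by
  by_contra hN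
  set Y := (T.filter (bsel φ w M τ)).image (labL φ w) with hY
  have hcellY : ∀ γ ∈ T, ¬ hp τ γ → (∃ p, cellP φ w γ p) →
      ∃ p, Sum.inr p ∈ Y ∧ cellP φ w γ p := by
    intro γ hγ hs hc
    obtain ⟨p, h1, h2⟩ := labL_cell hc
    refine ⟨p, ?_, h2⟩
    rw [hY, Finset.mem_image]
    exact ⟨γ, Finset.mem_filter.2 ⟨hγ, hs, Or.inl hc⟩, h1⟩
  let Lft : Lat → Prop := fun v => ∃ p v0, p.1 = false ∧ Sum.inr p ∈ Y ∧ zoneS φ w p v0 ∧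
    Relation.ReflTransGen (rY φ w M Y) v0 v
  let Inv : ULoop → Prop := fun γ => ∀ v ∈ ULoop.verts γ, (φ.e v).1 < w ∧ (0 < (φ.e v).1 → Lft v)
  have L1 : ∀ γ ∈ T, ¬ hp τ γ → (∃ v ∈ ULoop.verts γ, (φ.e v).1 ≤ 0) → Inv γ := by
    rintro γ hγ hs ⟨a, ha, ha1⟩ v hv
    have h1 := (not_hp hs φ ha hv).1
    rw [abs_lt] at h1
    refine ⟨by omega, fun h0 => ?_⟩
    obtain ⟨k, j, hkj⟩ := cell_exists φ γ hs
    obtain ⟨p, hp1, hp2⟩ := hcellY γ hγ hs ⟨(false, k, j), ⟨⟨a, ha, ha1⟩, v, hv, h0⟩, hkj⟩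
    have hside := (cell_side hτ hs ha hp2).1 ha1
    refine ⟨p, v, hside, hp1, cell_zone hp2 hv ?_, .refl⟩
    rw [hside]
    exact h0
  obtain ⟨γ, hγ, γ', hγ', hl, h0, v', hv', hw'⟩ := hC
  have key : Inv γ' := by
    clear hγ' hw' hv'
    induction hl with
    | refl => exact L1 γ hγ.1 hγ.2 h0
    | tail _ hbc ih =>
      rename_i β β' hpath
      obtain ⟨hb, hb', x, hx, hx'⟩ := hbc
      by_cases hz : ∃ v ∈ ULoop.verts β', (φ.e v).1 ≤ 0
      · exact L1 β' hb'.1 hb'.2 hz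
      push Not at hz
      obtain ⟨hxw, hxL⟩ := ih x hx
      have hLx := hxL (hz x hx')
      have hlt : ∀ v ∈ ULoop.verts β', (φ.e v).1 < w := by
        intro v hv
        by_contra hcon
        push Not at hcon
        apply hN
        obtain ⟨k, j, hkj⟩ := cell_exists (φ.mir w) β' hb'.2
        obtain ⟨p, hp1, hp2⟩ := hcellY β' hb'.1 hb'.2 ⟨(true, k, j), ⟨⟨v, hv, by
          simp only [frS_1]; omega⟩, x, hx', by simp only [frS_1]; omega⟩, hkj⟩
        have hside := (cell_side hτ hb'.2 hv hp2).2 hcon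
        obtain ⟨p0, v0, g1, g2, g3, g4⟩ := hLx
        refine ⟨p0, p, v0, x, g2, hp1, g1, hside, g3, cell_zone hp2 hx' ?_, g4⟩
        rw [hside, frS_1]
        omega
      intro v hv
      refine ⟨hlt v hv, fun _ => ?_⟩
      have hsub : ULoop.verts β' ⊆ (sV φ w M : Set Lat) := by
        intro z hz'
        rw [Finset.mem_coe, mem_sV]
        have := hT β' hb'.1 z hz'
        rw [abs_le] at this
        refine ⟨hz z hz', hlt z hz', ?_, ?_⟩ <;> omega
      have hno : ¬ ∃ p, cellP φ w β' p := by
        rintro ⟨⟨s, k, j⟩, ⟨⟨a, ha, ha1⟩, -⟩, -⟩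
        cases s
        · exact absurd (hz a ha) (not_lt.2 ha1)
        · simp only [frS_1] at ha1
          have := hlt a ha
          omega
      have hin : Sum.inl β' ∈ Y := by
        rw [hY, Finset.mem_image]
        exact ⟨β', Finset.mem_filter.2 ⟨hb'.1, hb'.2, Or.inr hsub⟩, by simp only [labL, dif_neg hno]⟩
      obtain ⟨p0, v0, g1, g2, g3, g4⟩ := hLx
      refine ⟨p0, v0, g1, g2, g3, g4.trans ?_⟩
      exact Relation.ReflTransGen.mono (fun a b hab => ⟨β', hin, hsub, hab⟩) _ _ (usesU_conn hx' hv)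
  have := (key v' hv').1
  omega

theorem Crossed_mono {φ : Frame} {w : ℕ} {L L' : Set ULoop} (h : L ⊆ L') (hC : Crossed φ w L) :
    Crossed φ w L' := by
  obtain ⟨γ, h1, γ', h2, h3, h4⟩ := hC
  refine ⟨γ, h h1, γ', h h2, ?_, h4⟩
  exact Relation.ReflTransGen.mono (fun a b hab => ⟨h hab.1, h hab.2.1, hab.2.2⟩) _ _ h3




/-! ### The strip estimate -/

theorem Ex_dom' {ι ι' κ : Type*} [DecidableEq κ] (I : Finset ι) (I' : Finset ι') (m : ι → ℝ)
    (m' : ι' → ℝ) (hm : ∀ i, 0 ≤ m i) (hm' : ∀ i, 0 ≤ m' i)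
    (lab : ι → κ) (lab' : ι' → κ)
    (h : ∀ c, ∑ i ∈ I with lab i = c, m i ≤ ∑ i ∈ I' with lab' i = c, m' i)
    {f : Finset κ → ℝ} (hf : Antitone f) :
    Ex I' (fun i => pm (m' i)) (fun T => f (T.image lab')) ≤
      Ex I (fun i => pm (m i)) (fun T => f (T.image lab)) := by
  have := Ex_dom I I' m m' hm hm' lab lab' (fun c => by convert h c) hf
  convert this

theorem arcOf_unique {φ : Frame} {w M τ : ℕ} (hw : 0 < w)
    {p p' : Bool × ℕ × ℤ} {Q : List Lat}
    (h : arcOf φ w M τ p Q) (h' : arcOf φ w M τ p' Q) : p = p' := by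
  obtain ⟨s, k, j⟩ := p
  obtain ⟨s', k', j'⟩ := p'
  have hs : s = s' := by
    obtain ⟨y, l, hl, -⟩ := h.2.2
    obtain ⟨y', l', hl', -⟩ := h'.2.2
    match Q, hl, hl' with
    | q :: Q, hl, hl' =>
      simp only [List.map_cons, List.cons.injEq] at hl hl'
      have h1 : ((frS φ w s).e q).1 = 0 := by rw [hl.1]
      have h2 : ((frS φ w s').e q).1 = 0 := by rw [hl'.1]
      cases s <;> cases s' <;> simp only [frS_1] at * <;> simp only [frS] at * <;> omega
  subst hs
  obtain ⟨rfl, rfl⟩ := isArcQ_unique h.2.2 h'.2.2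
  rfl

theorem arc_exc {φ : Frame} {w M τ : ℕ} (h16 : 16 * τ ≤ w) {p : Bool × ℕ × ℤ} {Q : List Lat}
    (h : arcOf φ w M τ p Q) : excOK (sV φ w M) (sC2 φ w M) Q ∧ Q.IsChain Adj := by
  constructor
  · have hin := arc_in h16 h
    obtain ⟨y, l, hl, -, -, h1, h2⟩ := h.2.2
    match Q, hl with
    | q :: Q, hl =>
      simp only [List.map_cons, List.cons.injEq] at hl
      obtain ⟨hq, rfl⟩ := hl
      refine ⟨sideA_sub _ _ _ p.1 ((hin q (by simp)).2 (by rw [hq])), ?_⟩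
      have := okA_bex h1 ?_ (frS φ w p.1).e.symm (sV φ w M) (sC2 φ w M) ?_ ?_
      · simpa [List.map_map] using this
      · match Q, h1, h2 with
        | [z], h1, h2 =>
          simp only [List.map_cons, List.map_nil, List.head?_cons, Option.some.injEq] at h2
          have := h1.1
          rw [h2] at this
          simp at this
        | z :: z' :: t, h1, h2 => simp
      · intro x hx hR
        rw [List.mem_map] at hx
        obtain ⟨z, hz, rfl⟩ := hx
        rw [Equiv.symm_apply_apply]
        exact (hin z (List.mem_cons_of_mem _ hz)).1 hR
      · intro x hx hR
        rw [List.mem_map] at hx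
        obtain ⟨z, hz, rfl⟩ := hx
        rw [Equiv.symm_apply_apply]
        exact sideA_sub _ _ _ p.1 ((hin z (List.mem_cons_of_mem _ hz)).2 hR.1)
  · have hc := isArcQ_chain h.2.2
    rw [List.isChain_map] at hc
    exact hc.imp fun a b hab => ((frS φ w p.1).adj a b).1 hab

theorem labI_ex {φ : Frame} {w M τ : ℕ} (hw : 0 < w) {p : Bool × ℕ × ℤ}
    {Q : List Lat} (h : arcOf φ w M τ p Q) : labI φ w M τ (Item.ex Q) = Sum.inr p := by
  have hex : ∃ p, arcOf φ w M τ p Q := ⟨p, h⟩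
  simp only [labI, dif_pos hex]
  rw [arcOf_unique hw hex.choose_spec h]

theorem strip (φ : Frame) {w R τ : ℕ} (hτ : 0 < τ) (h16 : 16 * τ ≤ w) (hwR : w ≤ R) (u : ℝ≥0)
    (hu : 336 ≤ (u : ℝ) ^ 2 * c2) (F : Finset ULoop)
    (hF : ∀ γ ∈ F, ∀ v ∈ ULoop.verts γ, |(φ.e v).2| ≤ R) :
    Real.exp (-(12 * R * u ^ 2 / w)) ≤ Ex F (fun γ => pm ((loopWeight γ : ℝ) / 2))
      (fun T => if Crossed φ w {γ | γ ∈ T ∧ ¬ hp τ γ} then 0 else 1) := by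
  have hw : 0 < w := by omega
  set M := 3 * R with hM
  have hRM : R < M := by omega
  set I := F.filter (bsel φ w M τ) with hI
  let f : Finset Lb → ℝ := fun Y => if NB φ w M Y then 0 else 1
  have hf : Antitone f := by
    intro Y Y' h
    simp only [f]
    by_cases h1 : NB φ w M Y
    · rw [if_pos h1, if_pos (NB_mono h h1)]
    · rw [if_neg h1]; split_ifs <;> norm_num
  have hpb : ∀ γ : ULoop, 0 ≤ pm ((loopWeight γ : ℝ) / 2) ∧ pm ((loopWeight γ : ℝ) / 2) ≤ 1 :=
    fun γ => pm_bd (by positivity)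
  -- first reduction
  have s1 : Ex I (fun γ => pm ((loopWeight γ : ℝ) / 2)) (fun T => f (T.image (labL φ w))) ≤
      Ex F (fun γ => pm ((loopWeight γ : ℝ) / 2))
      (fun T => if Crossed φ w {γ | γ ∈ T ∧ ¬ hp τ γ} then 0 else 1) := by
    rw [hI, ← Ex_filter F _ (bsel φ w M τ) (fun T => f (T.image (labL φ w)))]
    refine Ex_mono hpb fun T hT => ?_
    by_cases hc : Crossed φ w {γ | γ ∈ T ∧ ¬ hp τ γ}
    · have := crossed_NB (M := M) (by omega) hRM (fun γ hγ => hF γ (hT hγ)) hc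
      simp only [f]
      rw [if_pos hc, if_pos this]
    · rw [if_neg hc]
      simp only [f]
      split_ifs <;> norm_num
  refine le_trans ?_ s1
  choose S hS1 hS2 using fun p : Bool × ℕ × ℤ =>
    arcs_exist (2 ^ p.2.1) (by positivity) (p.2.2 * (2 ^ p.2.1 : ℕ))
  let A : Bool × ℕ × ℤ → Finset Item := fun p =>
    (S p).image (fun Q => Item.ex (Q.map (frS φ w p.1).e.symm))
  set Pc : Finset (Bool × ℕ × ℤ) :=
    (I.image (labL φ w)).preimage Sum.inr (Sum.inr_injective.injOn) with hPc
  have hlabcell : ∀ γ p, labL φ w γ = Sum.inr p → cellP φ w γ p := by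
    intro γ p h
    unfold labL at h
    split_ifs at h with h'
    rw [Sum.inr.injEq] at h
    exact h ▸ h'.choose_spec
  have hAp : ∀ p ∈ Pc, ∀ Q ∈ S p, arcOf φ w M τ p (Q.map (frS φ w p.1).e.symm) := by
    intro p hp Q hQ
    rw [hPc, Finset.mem_preimage, Finset.mem_image] at hp
    obtain ⟨γ, hγ, hl⟩ := hp
    have hc := hlabcell γ p hl
    rw [hI, Finset.mem_filter] at hγ
    obtain ⟨s, k, j⟩ := p
    have hk : 2 ^ k < τ := by
      by_contra hcon
      exact hγ.2.1 (hp_mono (not_lt.1 hcon) hc.2.1)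
    have hkz : ((2 ^ k : ℕ) : ℤ) < τ := by exact_mod_cast hk
    refine ⟨hk, ?_, ?_⟩
    · obtain ⟨v, hv, hv2⟩ := hc.2.2.2.2
      have hv1 := hc.2.2.2.1 v hv
      have hb := hF γ hγ.1 v hv
      have hy : ((frS φ w s).e v).2 = (φ.e v).2 := by cases s <;> rfl
      simp only at hv1 hv2 ⊢
      rw [hy] at hv1 hv2
      rw [add_mul, one_mul] at hv2
      rw [abs_le] at hb
      have : |j * ((2 ^ k : ℕ) : ℤ)| ≤ R + ((2 ^ k : ℕ) : ℤ) := by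
        rw [abs_le]; constructor <;> linarith
      omega
    · rw [List.map_map]
      simpa using hS1 _ Q hQ
  set I' : Finset Item := (I.filter fun γ => ULoop.verts γ ⊆ (sV φ w M : Set Lat)).image Item.lp ∪
    Pc.biUnion A with hI'
  have hex : ∀ Q, Item.ex Q ∈ I' → ∃ p, arcOf φ w M τ p Q := by
    intro Q hQ
    rw [hI', Finset.mem_union] at hQ
    rcases hQ with hQ | hQ
    · rw [Finset.mem_image] at hQ
      obtain ⟨γ, -, h⟩ := hQ
      simp at h
    · rw [Finset.mem_biUnion] at hQ
      obtain ⟨p, hp, hQ⟩ := hQ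
      simp only [A, Finset.mem_image] at hQ
      obtain ⟨Q', hQ', h⟩ := hQ
      rw [Item.ex.injEq] at h
      exact ⟨p, h ▸ hAp p hp Q' hQ'⟩
  have s2 := Ex_dom' I I' (fun γ => (loopWeight γ : ℝ) / 2)
    (fun i => (mI (sV φ w M) (sC2 φ w M) u i : ℝ)) (fun _ => by positivity) (fun _ => by positivity)
    (labL φ w) (labI φ w M τ) ?_ hf
  · refine le_trans ?_ s2
    refine le_trans ?_ ((strip_gff φ w M hw u I').trans (Ex_mono (fun i => pm_bd (by positivity)) ?_))
    · rw [hM]; push_cast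
      apply le_of_eq; congr 2; ring
    · intro T hT
      by_cases hD : Disc (sA φ 0 M : Set Lat) (sA φ w M) (edgesT (sE φ w M) T)
      · have := disc_NB h16 (fun Q hQ => hex Q (hT hQ)) hD
        simp only [f]
        rw [if_pos hD, if_neg this]
      · rw [if_neg hD]
        simp only [f]
        split_ifs <;> norm_num
  · intro c
    have hnn : ∀ G : Finset Item, 0 ≤ ∑ i ∈ G, (mI (sV φ w M) (sC2 φ w M) u i : ℝ) :=
      fun G => Finset.sum_nonneg fun i _ => by positivity
    rcases c with γ | p
    · by_cases hγ : γ ∈ I ∧ labL φ w γ = Sum.inl γ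
      · have hsub : ULoop.verts γ ⊆ (sV φ w M : Set Lat) := by
          rcases (Finset.mem_filter.1 hγ.1).2.2 with h | h
          · have := hγ.2
            unfold labL at this
            rw [dif_pos h] at this
            cases this
          · exact h
        calc ∑ i ∈ I with labL φ w i = Sum.inl γ, (loopWeight i : ℝ) / 2
            ≤ ∑ i ∈ {γ}, (loopWeight i : ℝ) / 2 := by
              refine Finset.sum_le_sum_of_subset_of_nonneg ?_ (fun _ _ _ => by positivity)
              intro i hi
              rw [Finset.mem_filter] at hi
              have := hi.2
              unfold labL at this
              split_ifs at this
              rw [Sum.inl.injEq] at this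
              exact Finset.mem_singleton.2 this
          _ = ∑ i ∈ {Item.lp γ}, (mI (sV φ w M) (sC2 φ w M) u i : ℝ) := by
              rw [Finset.sum_singleton, Finset.sum_singleton, mI, if_pos hsub]
              push_cast; rfl
          _ ≤ _ := by
              refine Finset.sum_le_sum_of_subset_of_nonneg ?_ (fun _ _ _ => by positivity)
              intro i hi
              rw [Finset.mem_singleton] at hi
              subst hi
              refine Finset.mem_filter.2 ⟨Finset.mem_union_left _ (Finset.mem_image_of_mem _ ?_), rfl⟩
              exact Finset.mem_filter.2 ⟨hγ.1, hsub⟩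
      · rw [Finset.sum_eq_zero]
        · exact hnn _
        · intro i hi
          exfalso
          rw [Finset.mem_filter] at hi
          have := hi.2
          have h0 := this
          unfold labL at this
          split_ifs at this
          rw [Sum.inl.injEq] at this
          exact hγ ⟨this ▸ hi.1, by rw [← this] at h0 ⊢; exact h0⟩
    · by_cases hp : p ∈ Pc
      · calc ∑ i ∈ I with labL φ w i = Sum.inr p, (loopWeight i : ℝ) / 2
            = (∑ i ∈ I with labL φ w i = Sum.inr p, (loopWeight i : ℝ)) / 2 := by
              rw [Finset.sum_div]
          _ ≤ 336 / 2 := by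
              apply div_le_div_of_nonneg_right _ (by norm_num)
              refine cell_mass (frS φ w p.1) p.2.1 p.2.2 _ fun γ hγ => ?_
              exact hlabcell γ p (Finset.mem_filter.1 hγ).2
          _ ≤ (u : ℝ) ^ 2 / 2 * ∑ Q ∈ S p, (1 / 4 : ℝ) ^ steps Q := by
              have := hS2 p
              have h2 : (u : ℝ) ^ 2 * c2 ≤ (u : ℝ) ^ 2 * ∑ Q ∈ S p, (1 / 4 : ℝ) ^ steps Q :=
                mul_le_mul_of_nonneg_left this (by positivity)
              linarith
          _ = ∑ i ∈ A p, (mI (sV φ w M) (sC2 φ w M) u i : ℝ) := by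
              simp only [A]
              rw [Finset.sum_image]
              · rw [Finset.mul_sum]
                refine Finset.sum_congr rfl fun Q hQ => ?_
                rw [mI, if_pos (arc_exc h16 (hAp p hp Q hQ))]
                push_cast
                simp [steps]
              · intro Q _ Q' _ h
                simp only [Item.ex.injEq] at h
                exact List.map_injective_iff.2 (Equiv.injective _) h
          _ ≤ _ := by
              refine Finset.sum_le_sum_of_subset_of_nonneg ?_ (fun _ _ _ => by positivity)
              intro i hi
              refine Finset.mem_filter.2 ⟨Finset.mem_union_right _
                (Finset.mem_biUnion.2 ⟨p, hp, hi⟩), ?_⟩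
              simp only [A, Finset.mem_image] at hi
              obtain ⟨Q, hQ, rfl⟩ := hi
              exact labI_ex hw (hAp p hp Q hQ)
      · rw [Finset.sum_eq_zero]
        · exact hnn _
        · intro i hi
          exfalso
          apply hp
          rw [hPc, Finset.mem_preimage, Finset.mem_image]
          rw [Finset.mem_filter] at hi
          exact ⟨i, hi⟩




/-! ### All strips together -/

/-- All clusters have small extent. -/
def Good (w : ℕ) (L : Set ULoop) : Prop :=
  ∀ γ ∈ L, ∀ γ' ∈ L, linkedL L γ γ' → ∀ v ∈ ULoop.verts γ, ∀ v' ∈ ULoop.verts γ',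
    |v'.1 - v.1| < 2 * w ∧ |v'.2 - v.2| < 2 * w

theorem linkedL_symm {L : Set ULoop} {γ γ' : ULoop} (h : linkedL L γ γ') : linkedL L γ' γ := by
  induction h with
  | refl => exact .refl
  | tail _ hbc ih =>
    exact Relation.ReflTransGen.head ⟨hbc.2.1, hbc.1, by
      have := hbc.2.2; unfold Touches at *; rwa [Set.inter_comm]⟩ ih

theorem mem_box0 {R : ℤ} {v : Lat} : v ∈ box 0 R ↔ |v.1| ≤ R ∧ |v.2| ≤ R := by
  simp [box, linf]

theorem Good_mono {w : ℕ} {L L' : Set ULoop} (h : L ⊆ L') (hG : Good w L') : Good w L := by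
  intro γ h1 γ' h2 h3
  refine hG γ (h h1) γ' (h h2) ?_
  exact Relation.ReflTransGen.mono (fun a b hab => ⟨h hab.1, h hab.2.1, hab.2.2⟩) _ _ h3

theorem index_exists {w R N : ℕ} (hw : 0 < w) (hN : R ≤ N * w) {x x' : ℤ} (hx : |x| ≤ R)
    (hx' : |x'| ≤ R) (h : x + 2 * w ≤ x') :
    ∃ i ∈ Finset.Icc (-(N : ℤ)) N, x - i * w ≤ 0 ∧ (w : ℤ) ≤ x' - i * w := by
  have hw' : (0 : ℤ) < w := by exact_mod_cast hw
  have hN' : (R : ℤ) ≤ N * w := by exact_mod_cast hN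
  rw [abs_le] at hx hx'
  refine ⟨x / w + 1, ?_, ?_, ?_⟩
  · have h1 : x / w * w ≤ x := Int.ediv_mul_le _ hw'.ne'
    have h2 : x < (x / w + 1) * w := Int.lt_ediv_add_one_mul_self _ hw'
    rw [Finset.mem_Icc]
    constructor
    · by_contra hcon
      push Not at hcon
      have : (x / w + 1) * w ≤ (-(N : ℤ)) * w := by gcongr
      linarith
    · by_contra hcon
      push Not at hcon
      have : (N : ℤ) * w ≤ (x / w) * w := by gcongr; omega
      linarith
  · have h2 : x < (x / w + 1) * w := Int.lt_ediv_add_one_mul_self _ hw'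
    linarith
  · have h1 : x / w * w ≤ x := Int.ediv_mul_le _ hw'.ne'
    linarith

/-- The frames of the strips. -/
def frB (w : ℕ) : ℤ × Bool → Frame
  | (i, false) => frame0 (i * w)
  | (i, true) => frame1 (i * w)

theorem good_of {w R N : ℕ} (hw : 0 < w) (hN : R ≤ N * w) {L : Set ULoop}
    (hL : ∀ γ ∈ L, ULoop.verts γ ⊆ box 0 R)
    (h : ∀ q ∈ (Finset.Icc (-(N : ℤ)) N) ×ˢ (Finset.univ : Finset Bool), ¬ Crossed (frB w q) w L) :
    Good w L := by
  have one : ∀ γ ∈ L, ∀ γ' ∈ L, linkedL L γ γ' → ∀ v ∈ ULoop.verts γ, ∀ v' ∈ ULoop.verts γ',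
      v'.1 - v.1 < 2 * w ∧ v'.2 - v.2 < 2 * w := by
    intro γ hγ γ' hγ' hl v hv v' hv'
    have b1 := mem_box0.1 (hL γ hγ hv)
    have b2 := mem_box0.1 (hL γ' hγ' hv')
    constructor
    · by_contra hcon
      obtain ⟨i, hi, h1, h2⟩ := index_exists hw hN b1.1 b2.1 (by linarith)
      exact h (i, false) (Finset.mem_product.2 ⟨hi, Finset.mem_univ _⟩)
        ⟨γ, hγ, γ', hγ', hl, ⟨v, hv, h1⟩, v', hv', h2⟩
    · by_contra hcon
      obtain ⟨i, hi, h1, h2⟩ := index_exists hw hN b1.2 b2.2 (by linarith)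
      exact h (i, true) (Finset.mem_product.2 ⟨hi, Finset.mem_univ _⟩)
        ⟨γ, hγ, γ', hγ', hl, ⟨v, hv, h1⟩, v', hv', h2⟩
  intro γ hγ γ' hγ' hl v hv v' hv'
  have e1 := one γ hγ γ' hγ' hl v hv v' hv'
  have e2 := one γ' hγ' γ hγ (linkedL_symm hl) v' hv' v hv
  simp only [abs_lt]
  omega

/-- The square box as a finset. -/
def bxF (R : ℕ) : Finset Lat := Finset.Icc (-(R : ℤ)) R ×ˢ Finset.Icc (-(R : ℤ)) R

theorem bxF_eq (R : ℕ) : (bxF R : Set Lat) = box 0 R := by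
  ext v
  rw [mem_box0, bxF, Finset.mem_coe, Finset.mem_product, Finset.mem_Icc, Finset.mem_Icc, abs_le,
    abs_le]

theorem bxF_card (R : ℕ) : (bxF R).card = (2 * R + 1) ^ 2 := by
  rw [bxF, Finset.card_product, Int.card_Icc, sq]
  congr 1 <;> omega

theorem combo (K : ℕ) : ∃ c : ℝ, 0 < c ∧ ∀ w R : ℕ, 16 ≤ w → w ≤ R → R ≤ K * w →
    ∀ F : Finset ULoop, (∀ γ ∈ F, ULoop.verts γ ⊆ box 0 R) →
    c ≤ Ex F (fun γ => pm ((loopWeight γ : ℝ) / 2))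
      (fun T => if Good w (T : Set ULoop) then 1 else 0) := by
  obtain ⟨u, hu⟩ : ∃ u : ℝ≥0, 336 ≤ (u : ℝ) ^ 2 * c2 := by
    have := c2_pos
    refine ⟨⟨Real.sqrt (336 / c2), Real.sqrt_nonneg _⟩, ?_⟩
    change 336 ≤ (Real.sqrt (336 / c2)) ^ 2 * c2
    rw [Real.sq_sqrt (by positivity), div_mul_cancel₀ _ this.ne']
  set Q : Finset (ℤ × Bool) := (Finset.Icc (-(K : ℤ)) K) ×ˢ (Finset.univ : Finset Bool) with hQ
  refine ⟨Real.exp (-(7 * 9 * 2048 * K ^ 2)) * ∏ q ∈ Q, Real.exp (-(12 * K * u ^ 2)), ?_, ?_⟩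
  · have : 0 < ∏ q ∈ Q, Real.exp (-(12 * K * (u : ℝ) ^ 2)) :=
      Finset.prod_pos fun _ _ => Real.exp_pos _
    have := Real.exp_pos (-(7 * 9 * 2048 * (K : ℝ) ^ 2))
    positivity
  intro w R hw hwR hK F hF
  set τ := w / 16 with hτ
  have hτ0 : 0 < τ := by omega
  have hw0 : (0 : ℝ) < w := by exact_mod_cast (by omega : 0 < w)
  have hKr : (R : ℝ) ≤ K * w := by exact_mod_cast hK
  have hpb : ∀ γ : ULoop, 0 ≤ pm ((loopWeight γ : ℝ) / 2) ∧ pm ((loopWeight γ : ℝ) / 2) ≤ 1 :=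
    fun γ => pm_bd (by positivity)
  let f : Option (ℤ × Bool) → Finset ULoop → ℝ := fun o T => match o with
    | none => if ∀ γ ∈ T, ¬ hp τ γ then 1 else 0
    | some q => if Crossed (frB w q) w {γ | γ ∈ T ∧ ¬ hp τ γ} then 0 else 1
  have hf : ∀ o, Antitone (f o) := by
    intro o T T' h
    match o with
    | none =>
      simp only [f]
      by_cases h1 : ∀ γ ∈ T', ¬ hp τ γ
      · rw [if_pos h1, if_pos fun γ hγ => h1 γ (h hγ)]
      · rw [if_neg h1]; split_ifs <;> norm_num
    | some q =>
      simp only [f]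
      by_cases h1 : Crossed (frB w q) w {γ | γ ∈ T ∧ ¬ hp τ γ}
      · have h2 : Crossed (frB w q) w {γ | γ ∈ T' ∧ ¬ hp τ γ} :=
          Crossed_mono (fun γ hγ => ⟨h hγ.1, hγ.2⟩) h1
        rw [if_pos h1, if_pos h2]
      · rw [if_neg h1]; split_ifs <;> norm_num
  have hf0 : ∀ o T, 0 ≤ f o T := by
    intro o T
    match o with
    | none => simp only [f]; split_ifs <;> norm_num
    | some q => simp only [f]; split_ifs <;> norm_num
  have hh := Ex_harris_prod hpb (Finset.insertNone Q) f hf hf0 (F := F)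
  have hlast : Ex F (fun γ => pm ((loopWeight γ : ℝ) / 2))
      (fun T => ∏ k ∈ Finset.insertNone Q, f k T) ≤
      Ex F (fun γ => pm ((loopWeight γ : ℝ) / 2))
      (fun T => if Good w (T : Set ULoop) then 1 else 0) := by
    refine Ex_mono hpb fun T hT => ?_
    by_cases hz : ∃ k ∈ Finset.insertNone Q, f k T = 0
    · obtain ⟨k, hk, hk0⟩ := hz
      rw [Finset.prod_eq_zero hk hk0]
      split_ifs <;> norm_num
    · push Not at hz
      have hs : ∀ γ ∈ T, ¬ hp τ γ := by
        have := hz none (Finset.none_mem_insertNone)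
        simp only [f] at this
        by_contra hcon
        exact this (if_neg hcon)
      have hset : {γ | γ ∈ T ∧ ¬ hp τ γ} = (T : Set ULoop) := by
        ext γ
        exact ⟨fun h => h.1, fun h => ⟨h, hs γ h⟩⟩
      have hG : Good w (T : Set ULoop) := by
        refine good_of (by omega) hK (fun γ hγ => hF γ (hT hγ)) fun q hq => ?_
        have := hz (some q) (Finset.some_mem_insertNone.2 hq)
        simp only [f] at this
        rw [hset] at this
        by_contra hcon
        exact this (if_pos hcon)
      rw [if_pos hG]
      refine Finset.prod_le_one (fun k _ => hf0 k T) fun k _ => ?_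
      match k with
      | none => simp only [f]; split_ifs <;> norm_num
      | some q => simp only [f]; split_ifs <;> norm_num
  refine le_trans ?_ (hh.trans hlast)
  rw [Finset.prod_insertNone]
  refine mul_le_mul ?_ ?_ (Finset.prod_nonneg fun _ _ => (Real.exp_pos _).le)
    (Ex_nonneg hpb fun T _ => hf0 none T)
  · have e1 := Ex_void F (fun γ => pm ((loopWeight γ : ℝ) / 2)) (hp τ)
    have e2 : Ex F (fun γ => pm ((loopWeight γ : ℝ) / 2)) (f none) =
        ∏ i ∈ F with hp τ i, (1 - pm ((loopWeight i : ℝ) / 2)) := e1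
    rw [e2]
    have e3 : ∏ i ∈ F with hp τ i, (1 - pm ((loopWeight i : ℝ) / 2)) =
        Real.exp (-((∑ i ∈ F with hp τ i, (loopWeight i : ℝ)) / 2)) := by
      rw [Finset.sum_div, ← Finset.sum_neg_distrib, Real.exp_sum]
      refine Finset.prod_congr rfl fun i _ => ?_
      unfold pm; ring
    rw [e3]
    apply Real.exp_le_exp.2
    have hm := wide_mass_fin (bxF R) ((τ + 1) / 2) (by omega) (F.filter (hp τ)) (fun γ hγ => by
      rw [Finset.mem_filter] at hγ
      exact ⟨hp_wide (by omega) hγ.2, by rw [bxF_eq]; exact hF γ hγ.1⟩)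
    rw [bxF_card] at hm
    have hb : (w : ℝ) ≤ 64 * (((τ + 1) / 2 : ℕ) : ℝ) := by
      have : w ≤ 64 * ((τ + 1) / 2) := by omega
      exact_mod_cast this
    set b : ℝ := (((τ + 1) / 2 : ℕ) : ℝ)
    have hb0 : 0 < b := by linarith
    have hR1 : (1 : ℝ) ≤ R := by exact_mod_cast (by omega : 1 ≤ R)
    have hm2 : 7 * (((2 * R + 1) ^ 2 : ℕ) : ℝ) / b ^ 2 ≤ 7 * 9 * 4096 * K ^ 2 := by
      rw [div_le_iff₀ (by positivity)]
      push_cast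
      have h1 : (R : ℝ) ≤ K * (64 * b) := hKr.trans (by gcongr)
      have h2 : (2 * (R : ℝ) + 1) ^ 2 ≤ (3 * (K * (64 * b))) ^ 2 := by
        apply pow_le_pow_left₀ (by positivity); linarith
      nlinarith
    linarith
  · refine Finset.prod_le_prod (fun _ _ => (Real.exp_pos _).le) fun q hq => ?_
    have := strip (frB w q) hτ0 (by omega) hwR u hu F (by
      intro γ hγ v hv
      have := mem_box0.1 (hF γ hγ hv)
      obtain ⟨i, b⟩ := q
      cases b
      · exact this.2
      · exact this.1)
    refine le_trans ?_ this
    apply Real.exp_le_exp.2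
    rw [neg_le_neg_iff, div_le_iff₀ hw0]
    have h2 : (0 : ℝ) ≤ (u : ℝ) ^ 2 := by positivity
    nlinarith




/-! ### Probabilities for the loop soup -/

instance instCountableRL : Countable RootedLoop :=
  Function.Injective.countable (f := RootedLoop.word) (by
    rintro ⟨a, _, _⟩ ⟨b, _, _⟩ h; simp only at h; subst h; rfl)

instance instCountableUL : Countable ULoop :=
  Function.Surjective.countable (f := Quot.mk loopRot) Quot.mk_surjective

/-- Zero on `S`, nonzero on `T`. -/
def evB (T S : Set ULoop) : Set Config := {ω | (∀ γ ∈ T, ω γ ≠ 0) ∧ ∀ γ ∈ S, ω γ = 0}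

theorem evB_meas (T S : Set ULoop) : MeasurableSet (evB T S) := by
  have h0 : ∀ γ : ULoop, MeasurableSet {ω : Config | ω γ = 0} := fun γ =>
    measurableSet_eq_fun (measurable_pi_apply γ) measurable_const
  have : evB T S = (⋂ γ ∈ T, {ω : Config | ω γ = 0}ᶜ) ∩ ⋂ γ ∈ S, {ω : Config | ω γ = 0} := by
    ext ω; simp [evB]
  rw [this]
  exact (MeasurableSet.biInter (Set.to_countable _) fun γ _ => (h0 γ).compl).inter
    (MeasurableSet.biInter (Set.to_countable _) fun γ _ => h0 γ)

theorem evB_prob {D : Set Lat} {α : ℝ} {P : Measure Config} (hP : IsLoopSoup D α P) (hα : 0 < α)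
    (T S : Finset ULoop) (hTS : Disjoint T S) :
    P.real (evB T S) = (∏ γ ∈ T, pm (α * nuD D γ)) * ∏ γ ∈ S, Real.exp (-(α * nuD D γ)) := by
  haveI := hP.1
  induction T using Finset.induction_on generalizing S with
  | empty =>
    have h := hP.2 S (fun _ => 0)
    have he : evB ((∅ : Finset ULoop) : Set ULoop) S = {ω | ∀ γ ∈ S, ω γ = 0} := by
      ext ω; simp [evB]
    rw [he, Measure.real, h, ENNReal.toReal_prod]
    simp only [Finset.prod_empty, one_mul]
    refine Finset.prod_congr rfl fun γ _ => ?_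
    unfold poissonProb
    rw [ENNReal.toReal_ofReal (by positivity)]
    simp [Real.coe_toNNReal _ hα.le]
  | insert a T ha ih =>
    rw [Finset.disjoint_insert_left] at hTS
    have h1 := ih S hTS.2
    have h2 := ih (insert a S) (by
      rw [Finset.disjoint_insert_right]; exact ⟨ha, hTS.2⟩)
    have hdis : Disjoint (evB (insert a T : Finset ULoop) S) (evB T (insert a S : Finset ULoop)) := by
      rw [Set.disjoint_left]
      intro ω hω hω'
      exact hω.1 a (by simp) (hω'.2 a (by simp))
    have hun : evB (insert a T : Finset ULoop) S ∪ evB T (insert a S : Finset ULoop) = evB T S := by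
      ext ω
      simp only [evB, Set.mem_union, Set.mem_setOf_eq, Finset.coe_insert, Set.forall_mem_insert]
      tauto
    have h3 := measureReal_union (μ := P) hdis (evB_meas _ _)
    rw [hun, h1, h2, Finset.prod_insert hTS.1] at h3
    rw [Finset.prod_insert ha]
    have : pm (α * nuD D a) = 1 - Real.exp (-(α * nuD D a)) := rfl
    rw [this]
    linarith

theorem nuD_tsum (R : ℕ) : ∑' γ : ULoop, (nuD (box 0 R) γ : ℝ≥0∞) ≠ ⊤ := by
  have h := wide_mass (bxF R) 1 one_pos
  refine ne_top_of_le_ne_top ENNReal.ofReal_ne_top (le_trans (ENNReal.tsum_le_tsum fun γ => ?_) h)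
  unfold nuD
  by_cases hγ : ULoop.verts γ ⊆ box 0 R
  · rw [if_pos hγ, if_pos ⟨hp_wide (by norm_num) (hp_one γ), by rw [bxF_eq]; exact hγ⟩, mul_one]
  · rw [if_neg hγ]; simp

theorem soup_ge {R : ℕ} {α : ℝ} {P : Measure Config} (hP : IsLoopSoup (box 0 R) α P) (hα : 0 < α)
    (hα2 : α ≤ 1 / 2) {g : Set ULoop → Prop} (hg : ∀ L L', L ⊆ L' → g L' → g L) {c : ℝ}
    (hc : ∀ F : Finset ULoop, (∀ γ ∈ F, ULoop.verts γ ⊆ box 0 R) →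
      c ≤ Ex F (fun γ => pm ((loopWeight γ : ℝ) / 2)) (fun T => if g (T : Set ULoop) then 1 else 0)) :
    Real.exp (-1) * c ≤ P.real {ω | g (Config.loops ω)} := by
  haveI := hP.1
  set D := box 0 (R : ℤ) with hD
  obtain ⟨F0, hF0⟩ : ∃ F0 : Finset ULoop, ∀ G : Finset ULoop, Disjoint G F0 →
      ∑ γ ∈ G, (nuD D γ : ℝ) ≤ 1 := by
    have hs : Summable (fun γ : ULoop => (nuD D γ : ℝ)) :=
      NNReal.summable_coe.2 (ENNReal.tsum_coe_ne_top_iff_summable.1 (nuD_tsum R))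
    have := (summable_iff_vanishing_norm.1 hs) 1 one_pos
    obtain ⟨s, hs⟩ := this
    exact ⟨s, fun G hG => (le_abs_self _).trans (hs G hG).le⟩
  set F := F0.filter (fun γ => ULoop.verts γ ⊆ D) with hF
  have hFG : ∀ G : Finset ULoop, Disjoint G F → ∑ γ ∈ G, (nuD D γ : ℝ) ≤ 1 := by
    intro G hG
    rw [← Finset.sum_filter_add_sum_filter_not G (fun γ => ULoop.verts γ ⊆ D)]
    rw [Finset.sum_eq_zero (s := G.filter (fun γ => ¬ ULoop.verts γ ⊆ D)), add_zero]
    · refine hF0 _ (Finset.disjoint_left.2 fun γ h1 h2 => ?_)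
      rw [Finset.mem_filter] at h1
      exact Finset.disjoint_left.1 hG h1.1 (Finset.mem_filter.2 ⟨h2, h1.2⟩)
    · intro γ hγ
      rw [Finset.mem_filter] at hγ
      simp [nuD, if_neg hγ.2]
  have hνF : ∀ γ ∈ F, (nuD D γ : ℝ) = loopWeight γ := by
    intro γ hγ
    rw [hF, Finset.mem_filter] at hγ
    rw [nuD, if_pos hγ.2]
  let q : ULoop → ℝ := fun γ => pm (α * nuD D γ)
  have hpb : ∀ γ : ULoop, 0 ≤ pm ((loopWeight γ : ℝ) / 2) ∧ pm ((loopWeight γ : ℝ) / 2) ≤ 1 :=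
    fun γ => pm_bd (by positivity)
  have hqb : ∀ γ : ULoop, 0 ≤ q γ ∧ q γ ≤ 1 := fun γ => pm_bd (by positivity)
  -- the atoms
  have hA : ∀ T ∈ F.powerset, Real.exp (-1) * ((∏ i ∈ T, q i) * ∏ i ∈ F \ T, (1 - q i)) ≤
      P.real (evB T (T : Set ULoop)ᶜ) := by
    intro T hT
    rw [Finset.mem_powerset] at hT
    set c0 := Real.exp (-1) * ((∏ i ∈ T, q i) * ∏ i ∈ F \ T, (1 - q i)) with hc0
    have hI : evB T (T : Set ULoop)ᶜ = ⋂ G : Finset ULoop, evB T (G \ T : Finset ULoop) := by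
      ext ω
      simp only [evB, Set.mem_iInter, Set.mem_setOf_eq]
      constructor
      · intro h G
        refine ⟨h.1, fun γ hγ => h.2 γ fun h' => ?_⟩
        exact (Finset.mem_sdiff.1 hγ).2 h'
      · intro h
        refine ⟨(h ∅).1, fun γ hγ => (h {γ}).2 γ ?_⟩
        rw [Finset.mem_coe, Finset.mem_sdiff]
        exact ⟨by simp, hγ⟩
    have hdir : Directed (· ⊇ ·) (fun G : Finset ULoop => evB (T : Set ULoop) (G \ T : Finset ULoop)) := by
      intro G G'
      refine ⟨G ∪ G', ?_, ?_⟩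
      · intro ω hω
        refine ⟨hω.1, fun γ hγ => hω.2 γ ?_⟩
        rw [Finset.mem_coe, Finset.mem_sdiff] at *
        exact ⟨Finset.mem_union_left _ hγ.1, hγ.2⟩
      · intro ω hω
        refine ⟨hω.1, fun γ hγ => hω.2 γ ?_⟩
        rw [Finset.mem_coe, Finset.mem_sdiff] at *
        exact ⟨Finset.mem_union_right _ hγ.1, hγ.2⟩
    have hm := hdir.measure_iInter (μ := P) (fun G => (evB_meas _ _).nullMeasurableSet)
      ⟨∅, measure_ne_top _ _⟩
    rw [← hI] at hm
    have hge : ENNReal.ofReal c0 ≤ P (evB T (T : Set ULoop)ᶜ) := by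
      rw [hm]
      refine le_iInf fun G => ?_
      have hsub : evB (T : Set ULoop) ((F \ T ∪ (G \ F)) : Finset ULoop) ⊆
          evB (T : Set ULoop) (G \ T : Finset ULoop) := by
        intro ω hω
        refine ⟨hω.1, fun γ hγ => hω.2 γ ?_⟩
        rw [Finset.mem_coe, Finset.mem_sdiff] at hγ
        rw [Finset.mem_coe, Finset.mem_union, Finset.mem_sdiff, Finset.mem_sdiff]
        by_cases h : γ ∈ F
        · exact Or.inl ⟨h, hγ.2⟩
        · exact Or.inr ⟨hγ.1, h⟩
      refine le_trans ?_ (measure_mono hsub)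
      rw [← ofReal_measureReal (measure_ne_top _ _)]
      apply ENNReal.ofReal_le_ofReal
      have hd : Disjoint (F \ T) (G \ F) := Finset.disjoint_left.2 fun γ h1 h2 =>
        (Finset.mem_sdiff.1 h2).2 (Finset.mem_sdiff.1 h1).1
      rw [evB_prob hP hα T (F \ T ∪ (G \ F)) (Finset.disjoint_left.2 fun γ h1 h2 => by
        rcases Finset.mem_union.1 h2 with h | h
        · exact (Finset.mem_sdiff.1 h).2 h1
        · exact (Finset.mem_sdiff.1 h).2 (hT h1)), Finset.prod_union hd, hc0]
      have e1 : ∏ i ∈ F \ T, (1 - q i) = ∏ γ ∈ F \ T, Real.exp (-(α * nuD D γ)) :=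
        Finset.prod_congr rfl fun i _ => by simp only [q, pm]; ring
      have e2 : Real.exp (-1) ≤ ∏ γ ∈ G \ F, Real.exp (-(α * nuD D γ)) := by
        rw [← Real.exp_sum]
        apply Real.exp_le_exp.2
        rw [Finset.sum_neg_distrib, ← Finset.mul_sum]
        have h1 := hFG (G \ F) Finset.sdiff_disjoint
        have h2 : 0 ≤ ∑ γ ∈ G \ F, (nuD D γ : ℝ) := Finset.sum_nonneg fun _ _ => by positivity
        nlinarith
      rw [e1]
      have h3 : 0 ≤ ∏ i ∈ T, q i := Finset.prod_nonneg fun i _ => (hqb i).1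
      have h4 : 0 ≤ ∏ γ ∈ F \ T, Real.exp (-(α * nuD D γ)) :=
        Finset.prod_nonneg fun i _ => (Real.exp_pos _).le
      calc _ = (∏ i ∈ T, q i) * ((∏ γ ∈ F \ T, Real.exp (-(α * nuD D γ))) * Real.exp (-1)) := by ring
        _ ≤ _ := by gcongr
    exact (ENNReal.ofReal_le_iff_le_toReal (measure_ne_top _ _)).1 hge
  have hcF := hc F (fun γ hγ => (Finset.mem_filter.1 hγ).2)
  have hanti : Antitone (fun T : Finset ULoop => if g (T : Set ULoop) then (1 : ℝ) else 0) := by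
    intro T T' h
    by_cases h1 : g (T' : Set ULoop)
    · have h2 := hg _ _ (Finset.coe_subset.2 h) h1
      simp only [if_pos h1, if_pos h2]; exact le_rfl
    · simp only [if_neg h1]; split_ifs <;> norm_num
  have hq : Ex F (fun γ => pm ((loopWeight γ : ℝ) / 2)) (fun T => if g (T : Set ULoop) then 1 else 0) ≤
      Ex F q (fun T => if g (T : Set ULoop) then 1 else 0) := by
    refine Ex_anti_p hqb hpb (fun γ hγ => pm_mono ?_) hanti
    rw [hνF γ hγ]
    have : (0 : ℝ) ≤ loopWeight γ := by positivity
    nlinarith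
  have hU : P.real (⋃ T ∈ F.powerset.filter (fun T : Finset ULoop => g (T : Set ULoop)),
      evB (T : Set ULoop) (T : Set ULoop)ᶜ) ≤
      P.real {ω | g (Config.loops ω)} := by
    refine measureReal_mono ?_ (measure_ne_top _ _)
    intro ω hω
    rw [Set.mem_iUnion₂] at hω
    obtain ⟨T, hT, hω⟩ := hω
    have : Config.loops ω = (T : Set ULoop) := by
      ext γ
      constructor
      · intro h
        by_contra hcon
        exact h (hω.2 γ hcon)
      · exact hω.1 γ
    rw [Set.mem_setOf_eq, this]
    exact (Finset.mem_filter.1 hT).2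
  refine le_trans ?_ hU
  rw [measureReal_biUnion_finset]
  · rw [Finset.sum_filter]
    calc Real.exp (-1) * c ≤ Real.exp (-1) *
          Ex F q (fun T => if g (T : Set ULoop) then 1 else 0) :=
          mul_le_mul_of_nonneg_left (hcF.trans hq) (Real.exp_pos _).le
      _ ≤ _ := by
          unfold Ex
          rw [Finset.mul_sum]
          refine Finset.sum_le_sum fun T hT => ?_
          split_ifs with h
          · simp only [if_pos h, one_mul]; exact hA T hT
          · simp only [if_neg h, zero_mul, mul_zero]; exact le_rfl
  · intro T _ T' _ hne
    rw [Function.onFun, Set.disjoint_left]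
    intro ω h1 h2
    apply hne
    ext γ
    constructor
    · intro h; by_contra hcon; exact h1.1 γ h (h2.2 γ hcon)
    · intro h; by_contra hcon; exact h2.1 γ h (h1.2 γ hcon)
  · intro T _; exact evB_meas _ _



/-! ### The final assembly -/

theorem seg_near {a b : Lat} (h : Adj a b) {p : Plane} (hp : p ∈ segment ℝ (emb a) (emb b)) :
    |p 0 - (a.1 : ℝ)| ≤ 1 ∧ |p 1 - (a.2 : ℝ)| ≤ 1 := by
  obtain ⟨s, t, hs, ht, hst, rfl⟩ := hp
  have h1 : |((b.1 : ℝ) - a.1)| ≤ 1 := by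
    have : ((b.1 : ℝ) - a.1) ^ 2 ≤ 1 := by
      have h' : ((a.1 : ℝ) - b.1) ^ 2 + ((a.2 : ℝ) - b.2) ^ 2 = 1 := by exact_mod_cast h
      nlinarith [sq_nonneg ((a.2 : ℝ) - b.2)]
    exact abs_le_one_iff_mul_self_le_one.2 (by nlinarith)
  have h2 : |((b.2 : ℝ) - a.2)| ≤ 1 := by
    have : ((b.2 : ℝ) - a.2) ^ 2 ≤ 1 := by
      have h' : ((a.1 : ℝ) - b.1) ^ 2 + ((a.2 : ℝ) - b.2) ^ 2 = 1 := by exact_mod_cast h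
      nlinarith [sq_nonneg ((a.1 : ℝ) - b.1)]
    exact abs_le_one_iff_mul_self_le_one.2 (by nlinarith)
  have hs' : s = 1 - t := by linarith
  have ht1 : t ≤ 1 := by linarith
  have e0 : (s • emb a + t • emb b : Plane) 0 - (a.1 : ℝ) = t * ((b.1 : ℝ) - a.1) := by
    simp [emb, hs']; ring
  have e1 : (s • emb a + t • emb b : Plane) 1 - (a.2 : ℝ) = t * ((b.2 : ℝ) - a.2) := by
    simp [emb, hs']; ring
  rw [e0, e1, abs_mul, abs_mul, abs_of_nonneg ht]
  constructor
  · nlinarith [abs_nonneg ((b.1 : ℝ) - a.1)]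
  · nlinarith [abs_nonneg ((b.2 : ℝ) - a.2)]

theorem zip_tail_adj : ∀ {l : List Lat}, l.IsChain Adj → ∀ p ∈ l.zip l.tail, Adj p.1 p.2 ∧ p.1 ∈ l
  | [], _ => by simp
  | [a], _ => by simp
  | a :: b :: l, h => by
    intro p hp
    rw [List.isChain_cons_cons] at h
    simp only [List.tail_cons, List.zip_cons_cons, List.mem_cons] at hp
    rcases hp with rfl | hp
    · exact ⟨h.1, by simp⟩
    · have := zip_tail_adj h.2 p (by simpa using hp)
      exact ⟨this.1, List.mem_cons_of_mem _ this.2⟩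

theorem trace_near {γ : ULoop} {p : Plane} (hp : p ∈ ULoop.trace γ) :
    ∃ v ∈ ULoop.verts γ, |p 0 - (v.1 : ℝ)| ≤ 1 ∧ |p 1 - (v.2 : ℝ)| ≤ 1 := by
  unfold ULoop.trace traceL at hp
  rcases hp with hp | hp
  · rw [Set.mem_iUnion₂] at hp
    obtain ⟨z, hz, hp⟩ := hp
    rw [Set.mem_singleton_iff] at hp
    refine ⟨z, mem_verts_word.1 hz, ?_⟩
    subst hp
    simp [emb]
  · rw [Set.mem_iUnion₂] at hp
    obtain ⟨z, hz, hp⟩ := hp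
    have := zip_tail_adj γ.out.adj z hz
    exact ⟨z.1, mem_verts_word.1 this.2, seg_near this.1 hp⟩

theorem plane_dist_le (p q : Plane) : dist p q ≤ |p 0 - q 0| + |p 1 - q 1| := by
  rw [EuclideanSpace.dist_eq, Fin.sum_univ_two, Real.dist_eq, Real.dist_eq]
  apply Real.sqrt_le_iff.2
  constructor
  · positivity
  · nlinarith [abs_nonneg (p 0 - q 0), abs_nonneg (p 1 - q 1)]

theorem Good_diam {w : ℕ} {L : Set ULoop} (hG : Good w L) {C : Set Plane} (hC : C ∈ clusters L) :
    Metric.diam C ≤ 4 * w + 4 := by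
  obtain ⟨γ0, h0, rfl⟩ := hC
  refine Metric.diam_le_of_forall_dist_le (by positivity) ?_
  intro p hp q hq
  unfold classTrace at hp hq
  rw [Set.mem_iUnion₂] at hp hq
  obtain ⟨γ, hγ, hp⟩ := hp
  obtain ⟨γ', hγ', hq⟩ := hq
  obtain ⟨v, hv, hv1, hv2⟩ := trace_near hp
  obtain ⟨v', hv', hv1', hv2'⟩ := trace_near hq
  have := hG γ hγ.1 γ' hγ'.1 ((linkedL_symm hγ.2).trans hγ'.2) v hv v' hv'
  have a1 : |(v'.1 : ℝ) - v.1| < 2 * w := by exact_mod_cast this.1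
  have a2 : |(v'.2 : ℝ) - v.2| < 2 * w := by exact_mod_cast this.2
  have b1 : |p 0 - q 0| ≤ 2 * w + 2 := by
    rw [abs_le] at *; rw [abs_lt] at *; constructor <;> linarith
  have b2 : |p 1 - q 1| ≤ 2 * w + 2 := by
    rw [abs_le] at *; rw [abs_lt] at *; constructor <;> linarith
  have := plane_dist_le p q
  linarith

theorem Ex_void_all {ι : Type*} (F : Finset ι) (p : ι → ℝ) (b : ι → Prop) (hb : ∀ i, b i) :
    Ex F p (fun T => if ∀ i ∈ T, ¬ b i then 1 else 0) = ∏ i ∈ F, (1 - p i) := by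
  rw [Ex_void]
  exact Finset.prod_congr (by ext i; simp [hb]) fun _ _ => rfl

theorem empty_lower (R : ℕ) (F : Finset ULoop) (hF : ∀ γ ∈ F, ULoop.verts γ ⊆ box 0 R) :
    Real.exp (-(7 * (2 * (R : ℝ) + 1) ^ 2 / 2)) ≤
      Ex F (fun γ => pm ((loopWeight γ : ℝ) / 2))
        (fun T => if (T : Set ULoop) = ∅ then 1 else 0) := by
  have h := Ex_void_all F (fun γ => pm ((loopWeight γ : ℝ) / 2)) (fun _ => True)
    (fun _ => trivial)
  have e := Eq.trans (show Ex F (fun γ => pm ((loopWeight γ : ℝ) / 2))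
      (fun T => if (T : Set ULoop) = ∅ then 1 else 0) = _ from by
    refine congrArg _ (funext fun T => ?_)
    by_cases hT : T = ∅
    · rw [if_pos (by simp [hT]), if_pos (by simp [hT])]
    · rw [if_neg (by simpa using hT), if_neg]
      intro hcon
      exact hT (Finset.eq_empty_iff_forall_notMem.2 fun i hi => hcon i hi trivial)) h
  rw [e]
  have hm := wide_mass_fin (bxF R) 1 one_pos F
    (fun γ hγ => ⟨hp_wide (by norm_num) (hp_one γ), by rw [bxF_eq]; exact hF γ hγ⟩)
  rw [bxF_card] at hm
  have hp : ∏ i ∈ F, (1 - pm ((loopWeight i : ℝ) / 2)) =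
      Real.exp (-((∑ γ ∈ F, (loopWeight γ : ℝ)) / 2)) := by
    rw [Finset.sum_div, ← Finset.sum_neg_distrib,
      Real.exp_sum]
    refine Finset.prod_congr rfl fun i _ => ?_
    unfold pm; ring
  rw [hp]
  apply Real.exp_le_exp.2
  push_cast at hm
  norm_num at hm
  linarith

theorem main_nat (δ : ℝ) (hδ : 0 < δ) (hδ1 : δ < 1) : ∃ c : ℝ, 0 < c ∧
    ∀ (α : ℝ) (R : ℕ) (P : Measure Config), 0 < α → α ≤ 1 / 2 → 1 ≤ R →
      IsLoopSoup (box 0 (R : ℤ)) α P →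
      c ≤ P.real {ω | ∀ C ∈ clusters (Config.loops ω), Metric.diam C < δ * (R : ℝ)} := by
  obtain ⟨c1, hc1, h1⟩ := combo ⌈20 / δ⌉₊
  refine ⟨Real.exp (-1) * min c1 (Real.exp (-(7 * (2 * (160 / δ) + 1) ^ 2 / 2))), by positivity, ?_⟩
  intro α R P hα hα2 hR hP
  haveI := hP.1
  have hR1 : (1 : ℝ) ≤ R := by exact_mod_cast hR
  by_cases hbig : 160 ≤ δ * R
  · set w := ⌊δ * R / 10⌋₊ with hw
    have hw1 : (w : ℝ) ≤ δ * R / 10 := Nat.floor_le (by positivity)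
    have hw2 : δ * R / 10 < w + 1 := Nat.lt_floor_add_one _
    have hw16 : 16 ≤ w := Nat.le_floor (by push_cast; linarith)
    have hwR : w ≤ R := by
      have : (w : ℝ) ≤ R := by nlinarith
      exact_mod_cast this
    have hRK : R ≤ ⌈20 / δ⌉₊ * w := by
      have hk : 20 / δ ≤ (⌈20 / δ⌉₊ : ℝ) := Nat.le_ceil _
      have hw' : δ * R / 20 ≤ w := by
        have : (16 : ℝ) ≤ w := by exact_mod_cast hw16
        linarith
      have : (R : ℝ) ≤ (⌈20 / δ⌉₊ : ℝ) * w := by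
        calc (R : ℝ) = 20 / δ * (δ * R / 20) := by field_simp
          _ ≤ _ := by gcongr
      exact_mod_cast this
    have hs := soup_ge hP hα hα2 (g := Good w) (fun L L' h hG => Good_mono h hG)
      (fun F hF => h1 w R hw16 hwR hRK F hF)
    refine le_trans ?_ (hs.trans (measureReal_mono ?_ (measure_ne_top _ _)))
    · gcongr; exact min_le_left _ _
    · intro ω hω C hC
      have := Good_diam hω hC
      have : (16 : ℝ) ≤ w := by exact_mod_cast hw16
      linarith
  · push Not at hbig
    have hs := soup_ge hP hα hα2 (g := fun L => L = ∅)
      (fun L L' h hG => Set.subset_empty_iff.1 (hG ▸ h)) (fun F hF => empty_lower R F hF)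
    refine le_trans ?_ (hs.trans (measureReal_mono ?_ (measure_ne_top _ _)))
    · have hRb : (R : ℝ) ≤ 160 / δ := by rw [le_div_iff₀ hδ]; linarith
      gcongr
      refine (min_le_right _ _).trans (Real.exp_le_exp.2 ?_)
      gcongr
    · rintro ω hω C ⟨γ, hγ, -⟩
      rw [Set.mem_setOf_eq] at hω
      rw [hω] at hγ
      exact hγ.elim

/-- For every `δ ∈ (0,1)` there is `c(δ) > 0` such that for every
intensity `α ∈ (0,1/2]` and every `R ≥ 1`, with probability at least `c(δ)` all the
clusters of the random walk loop soup in `B_R` with intensity `α` have (Euclidean)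
diameter smaller than `δR`. -/
theorem all_clusters_small :
    ∀ δ : ℝ, 0 < δ → δ < 1 →
    ∃ c : ℝ, 0 < c ∧
      ∀ (α : ℝ) (R : ℤ) (P : Measure Config),
        0 < α → α ≤ 1 / 2 → 1 ≤ R → IsLoopSoup (box 0 R) α P →
        ENNReal.ofReal c ≤
          P {ω | ∀ C ∈ clusters (Config.loops ω), Metric.diam C < δ * (R : ℝ)} := by
  intro δ hδ hδ1
  obtain ⟨c, hc, h⟩ := main_nat δ hδ hδ1
  refine ⟨c, hc, ?_⟩
  intro α R P hα hα2 hR hP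
  have hp := hP.1
  lift R to ℕ using by omega
  have := h α R P hα hα2 (by omega) hP
  rw [← ofReal_measureReal (measure_ne_top _ _)]
  exact ENNReal.ofReal_le_ofReal (by simpa using this)

end RWLSPaper
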